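/- Let n ≥ 1, let 0 < p < ∞, and let g be a holomorphic function on B_n. Then the operator J_g is bounded from H^p to H^p (i.e. there exists C > 0 with ‖J_g f‖_{H^p} ≤ C‖f‖_{H^p} for every f ∈ H^p) if and only if the measure dμ_g(z) = |Rg(z)|²(1−|z|²) dv(z) is a Carleson measure (equivalently, g ∈ BMOA). Moreover, the square of the least such constant C is comparable, with comparison constants depending only on n and p, to the Carleson constant sup_{ζ∈S_n, δ>0} δ^{−n} μ_g(B_δ(ζ)). -/

import Mathlib

open MeasureTheory Metric Set Filter
open scoped ENNReal NNReal Topology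

noncomputable section

/-- ℂⁿ with its Euclidean (Hermitian) structure. -/
abbrev En (n : ℕ) := EuclideanSpace ℂ (Fin n)

instance (n : ℕ) : MeasurableSpace (En n) := borel _
instance (n : ℕ) : BorelSpace (En n) := ⟨rfl⟩

/-- The open unit ball `B_n` of ℂⁿ. -/
def Bn (n : ℕ) : Set (En n) := Metric.ball 0 1

/-- The unit sphere `S_n = ∂B_n`. -/
def Sn (n : ℕ) : Set (En n) := Metric.sphere 0 1

/-- The Hermitian inner product `⟨z,w⟩ = ∑ z_k * conj (w_k)`. -/
def herm {n : ℕ} (z w : En n) : ℂ := ∑ k, z k * (starRingEnd ℂ) (w k)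

/-- The surface measure on the unit sphere, normalized so that `σ(S_n) = 1`
(the `(2n-1)`-dimensional Hausdorff measure restricted to the sphere, normalized). -/
def sigmaS (n : ℕ) : Measure (En n) :=
  ((μH[(2 * n - 1 : ℝ)] (Sn n))⁻¹) • (μH[(2 * n - 1 : ℝ)]).restrict (Sn n)

/-- Lebesgue measure on the unit ball, normalized so that `v(B_n) = 1`. -/
def volN (n : ℕ) : Measure (En n) :=
  ((volume (Bn n))⁻¹) • volume.restrict (Bn n)

/-- The radial derivative `Rg(z) = ∑ z_k ∂g/∂z_k (z) = (Dg)(z)[z]`. -/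
def radD {n : ℕ} (g : En n → ℂ) (z : En n) : ℂ := fderiv ℂ g z z

/-- The Volterra-type integration operator `J_g f(z) = ∫₀¹ f(tz) Rg(tz) dt/t`. -/
def J {n : ℕ} (g f : En n → ℂ) (z : En n) : ℂ :=
  ∫ t in Set.Ioo (0 : ℝ) 1, f (t • z) * radD g (t • z) / (t : ℂ)

/-- The Hardy space quasinorm `‖f‖_{H^p}`, with values in `ℝ≥0∞`:
`‖f‖_{H^p}^p = sup_{0<r<1} ∫_{S_n} |f(rζ)|^p dσ(ζ)`. -/
def hNorm (n : ℕ) (p : ℝ) (f : En n → ℂ) : ℝ≥0∞ :=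
  (⨆ r ∈ Set.Ioo (0 : ℝ) 1,
    ∫⁻ ζ, (‖f (r • ζ)‖₊ : ℝ≥0∞) ^ p ∂(sigmaS n)) ^ (1 / p)

/-- Membership in the Hardy space `H^p(B_n)`. -/
def MemHp (n : ℕ) (p : ℝ) (f : En n → ℂ) : Prop :=
  DifferentiableOn ℂ f (Bn n) ∧ hNorm n p f < ⊤

/-- The Carleson box `B_δ(ζ) = {z ∈ B_n : |1 - ⟨z,ζ⟩| < δ}`. -/
def cBox {n : ℕ} (ζ : En n) (δ : ℝ) : Set (En n) :=
  {z ∈ Bn n | ‖(1 : ℂ) - herm z ζ‖ < δ}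

/-- The measure `dμ_g(z) = |Rg(z)|²(1-|z|²) dv(z)`. -/
def muJ (n : ℕ) (g : En n → ℂ) : Measure (En n) :=
  (volN n).withDensity
    (fun z => (‖radD g z‖₊ : ℝ≥0∞) ^ 2 * ENNReal.ofReal (1 - ‖z‖ ^ 2))

/-- The admissible approach region `Γ_α(ζ) = {z ∈ B_n : |1-⟨z,ζ⟩| < (α/2)(1-|z|²)}`. -/
def Gam {n : ℕ} (α : ℝ) (ζ : En n) : Set (En n) :=
  {z ∈ Bn n | ‖(1 : ℂ) - herm z ζ‖ < α / 2 * (1 - ‖z‖ ^ 2)}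

open Classical in
/-- The involutive automorphism `φ_a` of the unit ball interchanging `0` and `a`:
`φ_a(z) = (a - P_a z - √(1-|a|²) (z - P_a z)) / (1 - ⟨z,a⟩)`, where `P_a` is the
orthogonal projection onto `ℂa`. -/
def mob {n : ℕ} (a z : En n) : En n :=
  if a = 0 then -z
  else ((1 : ℂ) - herm z a)⁻¹ •
    ((a - (herm z a / herm a a) • a) -
      ((Real.sqrt (1 - ‖a‖ ^ 2) : ℂ)) • (z - (herm z a / herm a a) • a))

/-- The norm of the invariant (real) gradient `∇̃f(z) = ∇(f ∘ φ_z)(0)`. -/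
def invGrad {n : ℕ} {F : Type*} [NormedAddCommGroup F] [NormedSpace ℝ F]
    (f : En n → F) (z : En n) : ℝ :=
  ‖fderiv ℝ (fun w => f (mob z w)) 0‖

/-- The invariant measure `dλ_n(z) = (1-|z|²)^{-(n+1)} dv(z)`. -/
def lamN (n : ℕ) : Measure (En n) :=
  (volN n).withDensity (fun z => ENNReal.ofReal ((1 - ‖z‖ ^ 2) ^ (-(n + 1 : ℝ))))

/-- The invariant Poisson integral `u_φ(z) = ∫_{S_n} φ(ζ) (1-|z|²)ⁿ/|1-⟨z,ζ⟩|^{2n} dσ(ζ)`. -/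
def poisson (n : ℕ) (φ : En n → ℝ) (z : En n) : ℝ :=
  ∫ ζ, φ ζ * ((1 - ‖z‖ ^ 2) ^ n / ‖(1 : ℂ) - herm z ζ‖ ^ (2 * n)) ∂(sigmaS n)

/-- The function `μ̃(ζ) = ∫_{Γ_α(ζ)} (1-|z|²)^{-n} dμ(z)`. -/
def tildeMu (n : ℕ) (α : ℝ) (μ : Measure (En n)) (ζ : En n) : ℝ≥0∞ :=
  ∫⁻ z in Gam α ζ, ENNReal.ofReal ((1 - ‖z‖ ^ 2) ^ (-(n : ℝ))) ∂μ

/-- The `L^{p/(p-s)}(S_n)`-norm of `μ̃`. -/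
def tildeMuNorm (n : ℕ) (α p s : ℝ) (μ : Measure (En n)) : ℝ≥0∞ :=
  (∫⁻ ζ, tildeMu n α μ ζ ^ (p / (p - s)) ∂(sigmaS n)) ^ ((p - s) / p)


/-- `μ` is a Carleson measure on `B_n`. -/
def IsCarleson (n : ℕ) (μ : Measure (En n)) : Prop :=
  ∃ C : ℝ≥0∞, C < ⊤ ∧ ∀ ζ ∈ Sn n, ∀ δ > (0 : ℝ), μ (cBox ζ δ) ≤ C * ENNReal.ofReal (δ ^ n)

/-- The Carleson constant `sup_{ζ∈S_n, δ>0} δ^{-n} μ(B_δ(ζ))` of a measure `μ`. -/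
def carlesonConst (n : ℕ) (μ : Measure (En n)) : ℝ≥0∞ :=
  ⨆ ζ ∈ Sn n, ⨆ δ ∈ Set.Ioi (0 : ℝ), μ (cBox ζ δ) / ENNReal.ofReal (δ ^ n)

/-! ### Uniformly distributed measures -/

/-- One-sided comparison of two uniformly distributed measures on open sets. -/
lemma measure_isOpen_le_liminf_of_uniform {E : Type*} [PseudoMetricSpace E]
    [SecondCountableTopology E] [MeasurableSpace E] [BorelSpace E] {μ ν : Measure E}
    [IsFiniteMeasure μ] [IsFiniteMeasure ν] {S : Set E} (hμS : ∀ᵐ x ∂μ, x ∈ S)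
    (hνS : ∀ᵐ x ∂ν, x ∈ S) {h k : ℝ → ℝ≥0∞} (hh : ∀ x ∈ S, ∀ r > 0, μ (ball x r) = h r)
    (hk : ∀ x ∈ S, ∀ r > 0, ν (ball x r) = k r) (hk0 : ∀ r > 0, k r ≠ 0)
    (hkt : ∀ r > 0, k r ≠ ⊤) {U : Set E} (hU : IsOpen U) :
    μ U ≤ liminf (fun j : ℕ => h (1 / (j + 1)) / k (1 / (j + 1))) atTop * ν U := by
  have hpos : ∀ j : ℕ, (0 : ℝ) < 1 / (j + 1) := fun j => by positivity
  have hmeas : ∀ r : ℝ, MeasurableSet {q : E × E | dist q.1 q.2 < r} := fun r =>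
    (isOpen_lt (by fun_prop) continuous_const).measurableSet
  have hball : ∀ (x : E) (r : ℝ), ν (U ∩ ball x r)
      = ∫⁻ y, U.indicator 1 y * {q : E × E | dist q.1 q.2 < r}.indicator 1 (x, y) ∂ν := by
    intro x r
    rw [← lintegral_indicator_one (hU.measurableSet.inter measurableSet_ball)]
    refine lintegral_congr fun y => ?_
    by_cases h1 : y ∈ U <;> by_cases h2 : dist x y < r <;>
      simp [indicator, h1, h2, dist_comm y x]
  have hmK : ∀ r : ℝ, Measurable (fun q : E × E =>
      U.indicator (1 : E → ℝ≥0∞) q.2 * {q : E × E | dist q.1 q.2 < r}.indicator 1 (q.1, q.2)) :=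
    fun r => ((measurable_one.indicator hU.measurableSet).comp measurable_snd).mul
      (measurable_one.indicator (hmeas r))
  have key : ∀ j : ℕ, ∫⁻ x, ν (U ∩ ball x (1 / (j + 1))) / k (1 / (j + 1)) ∂μ
      = h (1 / (j + 1)) / k (1 / (j + 1)) * ν U := by
    intro j
    simp only [div_eq_mul_inv (ν _)]
    rw [lintegral_mul_const' _ _ (ENNReal.inv_ne_top.2 (hk0 _ (hpos j)))]
    simp only [hball]
    rw [lintegral_lintegral_swap (hmK _).aemeasurable]
    have : ∀ᵐ y ∂ν, ∫⁻ x, U.indicator (1 : E → ℝ≥0∞) y *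
        {q : E × E | dist q.1 q.2 < 1 / ((j : ℝ) + 1)}.indicator 1 (x, y) ∂μ
        = U.indicator 1 y * h (1 / (j + 1)) := by
      filter_upwards [hνS] with y hy
      have hm : Measurable fun x : E =>
          {q : E × E | dist q.1 q.2 < 1 / ((j : ℝ) + 1)}.indicator (1 : E × E → ℝ≥0∞) (x, y) :=
        (measurable_one.indicator (hmeas _)).comp measurable_prodMk_right
      rw [lintegral_const_mul _ hm, ← hh y hy _ (hpos j),
        ← lintegral_indicator_one measurableSet_ball]
      rfl
    rw [lintegral_congr_ae this, lintegral_mul_const _ (measurable_one.indicator hU.measurableSet),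
      lintegral_indicator_one hU.measurableSet]
    simp only [div_eq_mul_inv]
    ring
  calc μ U = ∫⁻ x, U.indicator 1 x ∂μ := (lintegral_indicator_one hU.measurableSet).symm
    _ ≤ ∫⁻ x, liminf (fun j : ℕ => ν (U ∩ ball x (1 / (j + 1))) / k (1 / (j + 1))) atTop ∂μ := by
        refine lintegral_mono_ae ?_
        filter_upwards [hμS] with x hx
        by_cases hxU : x ∈ U
        · obtain ⟨ε, hε, hsub⟩ := Metric.isOpen_iff.1 hU x hxU
          refine le_trans ?_ (le_liminf_of_le (a := 1) ?_ ?_)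
          · simp [hxU]
          · isBoundedDefault
          have := (tendsto_one_div_add_atTop_nhds_zero_nat (𝕜 := ℝ)).eventually (gt_mem_nhds hε)
          filter_upwards [this] with j hj
          rw [inter_eq_right.2 ((ball_subset_ball hj.le).trans hsub), hk x hx _ (hpos j),
            ENNReal.div_self (hk0 _ (hpos j)) (hkt _ (hpos j))]
        · simp [hxU]
    _ ≤ liminf (fun j : ℕ => ∫⁻ x, ν (U ∩ ball x (1 / (j + 1))) / k (1 / (j + 1)) ∂μ) atTop := by
        refine lintegral_liminf_le fun j => ?_
        simp only [hball]
        exact ((hmK _).lintegral_prod_right').div_const _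
    _ = liminf (fun j : ℕ => h (1 / (j + 1)) / k (1 / (j + 1)) * ν U) atTop := by simp only [key]
    _ = _ := by
        by_cases h0 : ν U = 0
        · simp [h0]
        · rw [mul_comm, ENNReal.liminf_mul_const_of_ne_top (measure_ne_top ν U)]

/-- Two uniformly distributed probability measures on the same set agree. -/
lemma measure_eq_of_uniform {E : Type*} [PseudoMetricSpace E]
    [SecondCountableTopology E] [MeasurableSpace E] [BorelSpace E] {μ ν : Measure E}
    [IsProbabilityMeasure μ] [IsProbabilityMeasure ν] {S : Set E} (hμS : ∀ᵐ x ∂μ, x ∈ S)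
    (hνS : ∀ᵐ x ∂ν, x ∈ S) {h k : ℝ → ℝ≥0∞} (hh : ∀ x ∈ S, ∀ r > 0, μ (ball x r) = h r)
    (hk : ∀ x ∈ S, ∀ r > 0, ν (ball x r) = k r) (hh0 : ∀ r > 0, h r ≠ 0)
    (hk0 : ∀ r > 0, k r ≠ 0) : μ = ν := by
  have hSne : S.Nonempty := (hμS.exists).elim fun x hx => ⟨x, hx⟩
  obtain ⟨x₀, hx₀⟩ := hSne
  have hht : ∀ r > 0, h r ≠ ⊤ := fun r hr => by rw [← hh x₀ hx₀ r hr]; exact measure_ne_top _ _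
  have hkt : ∀ r > 0, k r ≠ ⊤ := fun r hr => by rw [← hk x₀ hx₀ r hr]; exact measure_ne_top _ _
  have h1 := fun {U : Set E} (hU : IsOpen U) =>
    measure_isOpen_le_liminf_of_uniform hμS hνS hh hk hk0 hkt hU
  have h2 := fun {U : Set E} (hU : IsOpen U) =>
    measure_isOpen_le_liminf_of_uniform hνS hμS hk hh hh0 hht hU
  have hinv : ∀ j : ℕ, k (1 / ((j : ℝ) + 1)) / h (1 / (j + 1))
      = (h (1 / (j + 1)) / k (1 / (j + 1)))⁻¹ := fun j => by
    have hp : (0 : ℝ) < 1 / (j + 1) := by positivity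
    rw [ENNReal.inv_div (Or.inl (hkt _ hp)) (Or.inl (hk0 _ hp))]
  simp only [hinv] at h2
  set a : ℕ → ℝ≥0∞ := fun j => h (1 / (j + 1)) / k (1 / (j + 1)) with ha
  have e1 : 1 ≤ liminf a atTop := by
    have := h1 isOpen_univ; rwa [measure_univ, measure_univ, mul_one] at this
  have e2 : 1 ≤ liminf (fun j => (a j)⁻¹) atTop := by
    have := h2 isOpen_univ; rwa [measure_univ, measure_univ, mul_one] at this
  have e3 : liminf (fun j => (a j)⁻¹) atTop = (limsup a atTop)⁻¹ := ENNReal.inv_limsup.symm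
  have e4 : limsup a atTop ≤ 1 := by rw [e3] at e2; exact ENNReal.one_le_inv.1 e2
  have e5 : liminf a atTop ≤ limsup a atTop := liminf_le_limsup
  have e6 : liminf a atTop = 1 := le_antisymm (e5.trans e4) e1
  have e7 : limsup a atTop = 1 := le_antisymm e4 (e1.trans e5)
  have hopen : ∀ U : Set E, IsOpen U → μ U = ν U := fun U hU => le_antisymm
    (by simpa [e6] using h1 hU) (by have := h2 hU; rw [e3, e7] at this; simpa using this)
  refine ext_of_generate_finite {s | IsOpen s} (BorelSpace.measurable_eq)
    isPiSystem_isOpen (fun U hU => hopen U hU) (by simp)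

/-! ### Hausdorff measure of the unit sphere -/

section Sphere

variable {E : Type*} [NormedAddCommGroup E] [InnerProductSpace ℝ E] [FiniteDimensional ℝ E]
  [MeasurableSpace E] [BorelSpace E]

lemma hausdorffMeasure_sphere_lt_top {d : ℕ} (hd : Module.finrank ℝ E = d + 1) :
    μH[(d : ℝ)] (sphere (0 : E) 1) < ⊤ := by
  have : Fact (Module.finrank ℝ E = d + 1) := ⟨hd⟩
  have hemi : ∀ v : E, ‖v‖ = 1 →
      μH[(d : ℝ)] {x ∈ sphere (0 : E) 1 | inner ℝ v x ≤ 0} < ⊤ := by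
    intro v hv
    have hfin : Module.finrank ℝ (ℝ ∙ v)ᗮ = d :=
      Submodule.finrank_orthogonal_span_singleton (by rintro rfl; simp at hv)
    set H : Set (sphere (0 : E) 1) := {x | inner ℝ v (x : E) ≤ 0} with hH
    have hHc : IsCompact H :=
      (isClosed_le (by fun_prop) continuous_const).isCompact
    have hHs : H ⊆ (stereographic hv).source := by
      intro x hx
      rw [stereographic_source]
      rintro rfl
      have : inner ℝ v v ≤ 0 := hx
      rw [real_inner_self_eq_norm_sq, hv] at this
      norm_num at this
    set K := stereographic hv '' H with hK
    have hKc : IsCompact K := hHc.image_of_continuousOn ((stereographic hv).continuousOn.mono hHs)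
    set F : (ℝ ∙ v)ᗮ → E := fun w => stereoInvFunAux v w with hF
    have hFl : LocallyLipschitz F := by
      have : ContDiff ℝ 1 F := contDiff_stereoInvFunAux.comp (ℝ ∙ v)ᗮ.subtypeL.contDiff
      exact this.locallyLipschitz
    obtain ⟨C, hC⟩ := (hFl.locallyLipschitzOn (s := K)).exists_lipschitzOnWith_of_compact hKc
    have hsub : {x ∈ sphere (0 : E) 1 | inner ℝ v x ≤ 0} ⊆ F '' K := by
      rintro x ⟨hx, hx'⟩
      refine ⟨stereographic hv ⟨x, hx⟩, ⟨⟨x, hx⟩, hx', rfl⟩, ?_⟩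
      have := (stereographic hv).left_inv (hHs (show (⟨x, hx⟩ : sphere (0 : E) 1) ∈ H from hx'))
      exact congrArg Subtype.val this
    have hKm : μH[(d : ℝ)] K < ⊤ := by
      have : Measure.IsAddHaarMeasure (μH[(Module.finrank ℝ (ℝ ∙ v)ᗮ : ℝ)] : Measure (ℝ ∙ v)ᗮ) :=
        inferInstance
      rw [hfin] at this
      exact hKc.measure_lt_top
    refine (measure_mono hsub).trans_lt
      ((hC.hausdorffMeasure_image_le (by positivity)).trans_lt ?_)
    exact ENNReal.mul_lt_top (ENNReal.rpow_lt_top_of_nonneg (by positivity) (by simp)) hKm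
  have : Nontrivial E := Module.nontrivial_of_finrank_pos (R := ℝ) (by omega)
  obtain ⟨v, hv⟩ := exists_norm_eq E (zero_le_one (α := ℝ))
  refine (measure_mono (t := {x ∈ sphere (0 : E) 1 | inner ℝ v x ≤ 0} ∪
    {x ∈ sphere (0 : E) 1 | inner ℝ (-v) x ≤ 0}) ?_).trans_lt
    ((measure_union_le _ _).trans_lt (ENNReal.add_lt_top.2 ⟨hemi v hv, hemi (-v) (by simpa)⟩))
  intro x hx
  rcases le_total (inner ℝ v x) 0 with h | h
  · exact Or.inl ⟨hx, h⟩
  · exact Or.inr ⟨hx, by simpa using h⟩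

lemma hausdorffMeasure_sphere_pos {d : ℕ} (hd : Module.finrank ℝ E = d + 1) :
    0 < μH[(d : ℝ)] (sphere (0 : E) 1) := by
  have : Fact (Module.finrank ℝ E = d + 1) := ⟨hd⟩
  have : Nontrivial E := Module.nontrivial_of_finrank_pos (R := ℝ) (by omega)
  obtain ⟨v, hv⟩ := exists_norm_eq E (zero_le_one (α := ℝ))
  have hfin : Module.finrank ℝ (ℝ ∙ v)ᗮ = d :=
    Submodule.finrank_orthogonal_span_singleton (by rintro rfl; simp at hv)
  refine lt_of_lt_of_le ?_
    (hausdorffMeasure_orthogonalProjectionOnto_le (ℝ ∙ v)ᗮ (d : ℝ) _ (by positivity))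
  have hsub : ball (0 : (ℝ ∙ v)ᗮ) 1 ⊆ (ℝ ∙ v)ᗮ.orthogonalProjectionOnto '' sphere (0 : E) 1 := by
    intro w hw
    have hw1 : ‖(w : E)‖ < 1 := by simpa using hw
    have horth : inner ℝ (w : E) v = 0 := Submodule.mem_orthogonal_singleton_iff_inner_left.1 w.2
    refine ⟨(w : E) + √(1 - ‖(w : E)‖ ^ 2) • v, ?_, ?_⟩
    · have h1 : (0 : ℝ) ≤ 1 - ‖(w : E)‖ ^ 2 := by nlinarith [norm_nonneg (w : E)]
      have : ‖(w : E) + √(1 - ‖(w : E)‖ ^ 2) • v‖ ^ 2 = 1 := by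
        rw [norm_add_sq_real, inner_smul_right, horth, norm_smul, hv, Real.norm_eq_abs, mul_one,
          sq_abs, Real.sq_sqrt h1]
        ring
      rw [mem_sphere_zero_iff_norm]
      nlinarith [norm_nonneg ((w : E) + √(1 - ‖(w : E)‖ ^ 2) • v)]
    · rw [map_add, map_smul, Submodule.orthogonalProjectionOnto_mem_subspace_eq_self]
      have : (ℝ ∙ v)ᗮ.orthogonalProjectionOnto v = 0 :=
        Submodule.orthogonalProjectionOnto_orthogonal_apply_eq_zero
          (Submodule.mem_span_singleton_self v)
      rw [this, smul_zero, add_zero]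
  refine lt_of_lt_of_le ?_ (measure_mono hsub)
  have : Measure.IsAddHaarMeasure (μH[(Module.finrank ℝ (ℝ ∙ v)ᗮ : ℝ)] : Measure (ℝ ∙ v)ᗮ) :=
    inferInstance
  rw [hfin] at this
  exact measure_ball_pos _ _ one_pos

end Sphere

lemma exists_linearIsometryEquiv_map_eq {E : Type*} [NormedAddCommGroup E]
    [InnerProductSpace ℝ E] {x y : E} (h : ‖x‖ = ‖y‖) :
    ∃ e : E ≃ₗᵢ[ℝ] E, e x = y :=
  ⟨(ℝ ∙ (x - y))ᗮ.reflection, Submodule.reflection_sub h⟩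

section Polar

variable {E : Type*} [NormedAddCommGroup E] [InnerProductSpace ℝ E] [FiniteDimensional ℝ E]
  [MeasurableSpace E] [BorelSpace E]

/-- A rotation-invariant probability measure on the unit sphere is unique. -/
lemma measure_eq_of_map_linearIsometryEquiv {μ ν : Measure E}
    [IsProbabilityMeasure μ] [IsProbabilityMeasure ν] (hμS : ∀ᵐ x ∂μ, x ∈ sphere (0 : E) 1)
    (hνS : ∀ᵐ x ∂ν, x ∈ sphere (0 : E) 1) (hμ : ∀ e : E ≃ₗᵢ[ℝ] E, μ.map e = μ)
    (hν : ∀ e : E ≃ₗᵢ[ℝ] E, ν.map e = ν) : μ = ν := by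
  obtain ⟨x₀, hx₀⟩ := hμS.exists
  have ball_eq : ∀ μ : Measure E, (∀ e : E ≃ₗᵢ[ℝ] E, μ.map e = μ) →
      ∀ x ∈ sphere (0 : E) 1, ∀ r > 0, μ (ball x r) = μ (ball x₀ r) := by
    intro μ hμ x hx r _
    obtain ⟨e, he⟩ := exists_linearIsometryEquiv_map_eq (x := x) (y := x₀)
      (by rw [mem_sphere_zero_iff_norm] at hx hx₀; rw [hx, hx₀])
    have hpre : e ⁻¹' ball x₀ r = ball x r := by
      ext y
      simp only [mem_preimage, mem_ball, ← he]
      rw [e.isometry.dist_eq]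
    rw [← hpre, ← Measure.map_apply e.continuous.measurable measurableSet_ball, hμ]
  have ball_ne : ∀ μ : Measure E, [IsProbabilityMeasure μ] → (∀ᵐ x ∂μ, x ∈ sphere (0 : E) 1) →
      (∀ e : E ≃ₗᵢ[ℝ] E, μ.map e = μ) → ∀ r > 0, μ (ball x₀ r) ≠ 0 := by
    intro μ _ hS hμ r hr h0
    obtain ⟨t, ht, hcov⟩ := (isCompact_sphere (0 : E) 1).elim_nhds_subcover (fun x => ball x r)
      (fun x _ => ball_mem_nhds x hr)
    have h1 : μ (⋃ x ∈ t, ball x r) = 0 := by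
      refine (measure_biUnion_null_iff t.countable_toSet).2 fun x hx => ?_
      rw [ball_eq μ hμ x (ht x hx) r hr, h0]
    have h2 : μ univ = 0 := by
      rw [← nonpos_iff_eq_zero, ← h1]
      refine measure_mono_ae ?_
      filter_upwards [hS] with x hx _ using hcov hx
    simp at h2
  exact measure_eq_of_uniform hμS hνS (ball_eq μ hμ) (ball_eq ν hν) (ball_ne μ hμS hμ)
    (ball_ne ν hνS hν)

/-- Integration in polar coordinates against `toSphere`. -/
lemma lintegral_polar_toSphere [Nontrivial E] {h : E → ℝ≥0∞} (hh : Measurable h) :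
    ∫⁻ z, h z ∂(volume : Measure E) = ∫⁻ t in Ioi (0 : ℝ),
      ENNReal.ofReal (t ^ (Module.finrank ℝ E - 1)) *
        ∫⁻ ζ, h (t • (ζ : E)) ∂(volume : Measure E).toSphere := by
  have hmp := (volume : Measure E).measurePreserving_homeomorphUnitSphereProd
  have h1 : ∫⁻ z, h z ∂(volume : Measure E) = ∫⁻ z : ({0}ᶜ : Set E), h z
      ∂((volume : Measure E).comap (↑)) := by
    rw [lintegral_subtype_comap (measurableSet_singleton _).compl, restrict_compl_singleton]
  have h2 : ∀ z : ({0}ᶜ : Set E), h z = (fun q : sphere (0 : E) 1 × Ioi (0 : ℝ) =>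
      h (q.2.1 • (q.1 : E))) (homeomorphUnitSphereProd E z) := by
    intro z
    have hz : ‖(z : E)‖ ≠ 0 := norm_ne_zero_iff.2 z.2
    simp [smul_smul, hz]
  have hm : Measurable (fun q : sphere (0 : E) 1 × Ioi (0 : ℝ) => h (q.2.1 • (q.1 : E))) :=
    hh.comp (by fun_prop)
  have h4 : Measurable (fun t : ℝ => ∫⁻ ζ, h (t • (ζ : E)) ∂(volume : Measure E).toSphere) := by
    have : Measurable (fun q : ℝ × sphere (0 : E) 1 => h (q.1 • (q.2 : E))) :=
      hh.comp (by fun_prop)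
    exact this.lintegral_prod_right'
  simp only [h1, h2]
  rw [hmp.lintegral_comp hm, lintegral_prod_symm _ hm.aemeasurable, Measure.volumeIoiPow,
    ← lintegral_subtype_comap measurableSet_Ioi]
  exact lintegral_withDensity_eq_lintegral_mul₀ (by fun_prop)
      (h4.comp measurable_subtype_coe).aemeasurable

lemma map_toSphere_linearIsometryEquiv (e : E ≃ₗᵢ[ℝ] E) :
    (((volume : Measure E).toSphere).map ((↑) : sphere (0 : E) 1 → E)).map e
      = ((volume : Measure E).toSphere).map (↑) := by
  ext s hs
  have hm : Measurable e := e.continuous.measurable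
  rw [Measure.map_apply hm hs, Measure.map_apply measurable_subtype_coe (hm hs),
    Measure.map_apply measurable_subtype_coe hs,
    Measure.toSphere_apply' _ (measurable_subtype_coe (hm hs)),
    Measure.toSphere_apply' _ (measurable_subtype_coe hs)]
  congr 1
  refine Eq.trans ?_ ((e.measurePreserving (E := E) (F := E)).measure_preimage_equiv
    (f := e.toHomeomorph.toMeasurableEquiv) _)
  congr 1
  change _ = e ⁻¹' _
  ext x
  simp only [Set.mem_smul, mem_image, mem_preimage, Subtype.exists, mem_sphere_zero_iff_norm]
  constructor
  · rintro ⟨t, ht, y, ⟨z, hz, hzs, rfl⟩, rfl⟩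
    exact ⟨t, ht, e z, ⟨e z, by simpa using hz, hzs, rfl⟩, by simp⟩
  · rintro ⟨t, ht, y, ⟨z, hz, hzs, rfl⟩, hx⟩
    refine ⟨t, ht, e.symm z, ⟨e.symm z, by simpa using hz, by simpa using hzs, rfl⟩, ?_⟩
    apply e.injective
    simpa using hx

end Polar

section Sigma

variable {n : ℕ}

lemma finrank_real_En : Module.finrank ℝ (En n) = 2 * n := by simp [finrank_real_of_complex]

lemma cast_sphere_dim (hn : 1 ≤ n) : (2 * n - 1 : ℝ) = ((2 * n - 1 : ℕ) : ℝ) := by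
  rw [Nat.cast_sub (by omega)]; push_cast; ring

lemma nontrivial_En (hn : 1 ≤ n) : Nontrivial (En n) :=
  Module.nontrivial_of_finrank_pos (R := ℝ) (by rw [finrank_real_En]; omega)

lemma isProbabilityMeasure_sigmaS (hn : 1 ≤ n) : IsProbabilityMeasure (sigmaS n) := by
  have hd : Module.finrank ℝ (En n) = (2 * n - 1) + 1 := by rw [finrank_real_En]; omega
  have h1 := hausdorffMeasure_sphere_lt_top hd
  have h2 := hausdorffMeasure_sphere_pos hd
  rw [← cast_sphere_dim hn] at h1 h2
  refine ⟨?_⟩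
  rw [sigmaS, Measure.smul_apply, Measure.restrict_apply_univ, smul_eq_mul]
  exact ENNReal.inv_mul_cancel h2.ne' h1.ne

lemma ae_sigmaS : ∀ᵐ ζ ∂(sigmaS n), ζ ∈ Sn n := by
  refine Measure.ae_smul_measure ?_ _
  exact ae_restrict_mem (isClosed_sphere (x := (0 : En n))).measurableSet

lemma measurePreserving_sigmaS (e : En n ≃ₗᵢ[ℝ] En n) :
    MeasurePreserving e (sigmaS n) (sigmaS n) := by
  have h1 := (e.toIsometryEquiv.measurePreserving_hausdorffMeasure (2 * n - 1 : ℝ)).restrict_preimage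
    (isClosed_sphere (x := (0 : En n)) (ε := 1)).measurableSet
  have h2 : e.toIsometryEquiv ⁻¹' sphere (0 : En n) 1 = sphere 0 1 := by ext; simp
  rw [h2] at h1
  exact h1.smul_measure _

/-- Integration in polar coordinates for the normalized measures. -/
lemma exists_polar (hn : 1 ≤ n) : ∃ c : ℝ≥0∞, c ≠ 0 ∧ c ≠ ⊤ ∧ ∀ h : En n → ℝ≥0∞, Measurable h →
    ∫⁻ z, h z ∂(volN n) = c * ∫⁻ t in Ioo (0 : ℝ) 1, ENNReal.ofReal (t ^ (2 * n - 1)) *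
      ∫⁻ ζ, h (t • ζ) ∂(sigmaS n) := by
  have : Nontrivial (En n) := nontrivial_En hn
  set μ := (volume : Measure (En n)).toSphere with hμ
  have hμ0 : μ univ ≠ 0 := by
    rw [Ne, Measure.measure_univ_eq_zero]; exact Measure.toSphere_ne_zero _
  have hμt : μ univ ≠ ⊤ := measure_ne_top _ _
  set ν : Measure (En n) := (μ univ)⁻¹ • μ.map (↑) with hν
  have hsub : Measurable ((↑) : sphere (0 : En n) 1 → En n) := measurable_subtype_coe
  have hνp : IsProbabilityMeasure ν := by
    refine ⟨?_⟩
    rw [hν, Measure.smul_apply, Measure.map_apply hsub MeasurableSet.univ, preimage_univ,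
      smul_eq_mul]
    exact ENNReal.inv_mul_cancel hμ0 hμt
  have hσp := isProbabilityMeasure_sigmaS hn
  have heq : sigmaS n = ν := by
    refine measure_eq_of_map_linearIsometryEquiv ae_sigmaS ?_
      (fun e => (measurePreserving_sigmaS e).map_eq) (fun e => ?_)
    · refine Measure.ae_smul_measure ?_ _
      refine (ae_map_iff hsub.aemeasurable
        (isClosed_sphere (x := (0 : En n)) (ε := 1)).measurableSet).2 ?_
      exact Eventually.of_forall fun x => x.2
    · rw [hν, Measure.map_smul, map_toSphere_linearIsometryEquiv]
  have hvol0 : volume (Bn n) ≠ 0 := (measure_ball_pos _ _ one_pos).ne'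
  have hvolt : volume (Bn n) ≠ ⊤ := measure_ball_lt_top.ne
  refine ⟨(volume (Bn n))⁻¹ * μ univ, mul_ne_zero (ENNReal.inv_ne_zero.2 hvolt) hμ0,
    ENNReal.mul_ne_top (ENNReal.inv_ne_top.2 hvol0) hμt, fun h hh => ?_⟩
  have hB : MeasurableSet (Bn n) := measurableSet_ball
  rw [volN, lintegral_smul_measure, ← lintegral_indicator hB,
    lintegral_polar_toSphere (hh.indicator hB), smul_eq_mul, mul_assoc]
  refine congrArg ((volume (Bn n))⁻¹ * ·) ?_
  have h3 : ∀ t : ℝ, ∫⁻ ζ, h (t • ζ) ∂(sigmaS n) =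
      (μ univ)⁻¹ * ∫⁻ ζ, h (t • (ζ : En n)) ∂μ := by
    intro t
    have : Measurable fun ζ : En n => h (t • ζ) := hh.comp (by fun_prop)
    rw [heq, hν, lintegral_smul_measure, lintegral_map this hsub, smul_eq_mul]
  have h4 : Measurable (fun t : ℝ => ENNReal.ofReal (t ^ (2 * n - 1)) *
      ∫⁻ ζ, h (t • ζ) ∂(sigmaS n)) := by
    have : Measurable (fun q : ℝ × En n => h (q.1 • q.2)) := hh.comp (by fun_prop)
    exact Measurable.mul (by fun_prop) this.lintegral_prod_right'
  rw [← lintegral_const_mul _ h4, ← lintegral_indicator measurableSet_Ioi,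
    ← lintegral_indicator measurableSet_Ioo]
  refine lintegral_congr fun t => ?_
  by_cases ht0 : 0 < t
  · by_cases ht1 : t < 1
    · rw [indicator_of_mem (mem_Ioi.2 ht0), indicator_of_mem (show t ∈ Ioo (0 : ℝ) 1 from ⟨ht0, ht1⟩), h3, finrank_real_En,
        mul_left_comm (ENNReal.ofReal _), ← mul_assoc (μ univ), ENNReal.mul_inv_cancel hμ0 hμt,
        one_mul]
      congr 1
      refine lintegral_congr fun ζ => indicator_of_mem ?_ _
      have : ‖(ζ : En n)‖ = 1 := by simp
      simp [Bn, norm_smul, abs_of_pos ht0, ht1]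
    · rw [indicator_of_mem (mem_Ioi.2 ht0), indicator_of_notMem (by simp [ht1])]
      have : ∀ ζ : sphere (0 : En n) 1, (Bn n).indicator h (t • (ζ : En n)) = 0 := by
        intro ζ
        refine indicator_of_notMem ?_ _
        simp [Bn, norm_smul, abs_of_pos ht0, not_lt.1 ht1]
      simp [this]
  · rw [indicator_of_notMem (by simpa using ht0), indicator_of_notMem (by simp [ht0])]

end Sigma

section Herm

variable {n : ℕ}

lemma herm_eq_inner (z w : En n) : herm z w = inner ℂ w z := by
  simp [herm, PiLp.inner_apply]

lemma herm_add_left (x y z : En n) : herm (x + y) z = herm x z + herm y z := by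
  simp [herm_eq_inner]

lemma herm_sub_left (x y z : En n) : herm (x - y) z = herm x z - herm y z := by
  simp [herm_eq_inner]

lemma herm_sub_right (x y z : En n) : herm x (y - z) = herm x y - herm x z := by
  simp [herm_eq_inner]

lemma herm_smul_left (c : ℂ) (x y : En n) : herm (c • x) y = c * herm x y := by
  simp [herm_eq_inner]

lemma herm_smul_right (c : ℂ) (x y : En n) : herm x (c • y) = (starRingEnd ℂ) c * herm x y := by
  simp [herm_eq_inner, mul_comm]

lemma herm_real_smul_left (c : ℝ) (x y : En n) : herm (c • x) y = c * herm x y := by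
  rw [← Complex.coe_smul, herm_smul_left]

lemma herm_real_smul_right (c : ℝ) (x y : En n) : herm x (c • y) = c * herm x y := by
  rw [← Complex.coe_smul, herm_eq_inner, inner_smul_left, herm_eq_inner]; simp

lemma herm_zero_right (x : En n) : herm x 0 = 0 := by simp [herm_eq_inner]

lemma star_herm (x y : En n) : (starRingEnd ℂ) (herm x y) = herm y x := by
  simp [herm_eq_inner]

lemma herm_self (x : En n) : herm x x = ((‖x‖ ^ 2 : ℝ) : ℂ) := by
  rw [herm_eq_inner, inner_self_eq_norm_sq_to_K]; norm_cast

lemma norm_herm_le (x y : En n) : ‖herm x y‖ ≤ ‖x‖ * ‖y‖ := by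
  rw [herm_eq_inner, mul_comm]; exact norm_inner_le_norm _ _

lemma norm_sub_sq_herm (x y : En n) : ‖x - y‖ ^ 2 = ‖x‖ ^ 2 + ‖y‖ ^ 2 - 2 * (herm x y).re := by
  have := norm_sub_sq (𝕜 := ℂ) y x
  rw [norm_sub_rev, this, herm_eq_inner]; simp; ring

lemma norm_add_sq_herm (x y : En n) : ‖x + y‖ ^ 2 = ‖x‖ ^ 2 + ‖y‖ ^ 2 + 2 * (herm x y).re := by
  have := norm_add_sq (𝕜 := ℂ) y x
  rw [add_comm x, this, herm_eq_inner]; simp; ring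

/-- The nonisotropic size `|1 - ⟨x, y⟩|`. -/
def dI (x y : En n) : ℝ := ‖(1 : ℂ) - herm x y‖

lemma dI_comm (x y : En n) : dI x y = dI y x := by
  rw [dI, ← star_herm y x, ← map_one (starRingEnd ℂ), ← map_sub, RCLike.norm_conj]; simp [dI]

lemma dI_nonneg (x y : En n) : 0 ≤ dI x y := norm_nonneg _

lemma one_sub_re_le_dI (x y : En n) : 1 - (herm x y).re ≤ dI x y := by
  have := Complex.re_le_norm ((1 : ℂ) - herm x y)
  simpa [dI] using this

lemma one_sub_norm_mul_le_dI (x y : En n) : 1 - ‖x‖ * ‖y‖ ≤ dI x y := by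
  have h1 := one_sub_re_le_dI x y
  have h2 := (Complex.re_le_norm _).trans (norm_herm_le x y)
  linarith

lemma one_sub_norm_le_dI {x y : En n} (hy : ‖y‖ ≤ 1) : 1 - ‖x‖ ≤ dI x y := by
  have := one_sub_norm_mul_le_dI x y
  nlinarith [norm_nonneg x]

lemma dI_pos {x y : En n} (hx : ‖x‖ < 1) (hy : ‖y‖ ≤ 1) : 0 < dI x y :=
  lt_of_lt_of_le (by linarith) (one_sub_norm_le_dI hy)

lemma dI_le_two {x y : En n} (hx : ‖x‖ ≤ 1) (hy : ‖y‖ ≤ 1) : dI x y ≤ 2 := by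
  have h1 := norm_sub_le (1 : ℂ) (herm x y)
  have h2 := norm_herm_le x y
  rw [norm_one] at h1
  unfold dI
  nlinarith [norm_nonneg x, norm_nonneg y]

lemma one_sub_sq_le_dI {x y : En n} (hx : ‖x‖ ≤ 1) (hy : ‖y‖ ≤ 1) : 1 - ‖x‖ ^ 2 ≤ 2 * dI x y := by
  have := one_sub_norm_le_dI (x := x) hy
  nlinarith [norm_nonneg x]

lemma norm_sub_sq_le_dI {x y : En n} (hx : ‖x‖ ≤ 1) (hy : ‖y‖ ≤ 1) : ‖x - y‖ ^ 2 ≤ 2 * dI x y := by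
  have := one_sub_re_le_dI x y
  rw [norm_sub_sq_herm]
  nlinarith [norm_nonneg x, norm_nonneg y]

/-- The quasi-triangle inequality for `dI` on the closed ball. -/
lemma dI_triangle {x s t : En n} (hx : ‖x‖ ≤ 1) (hs : ‖s‖ ≤ 1) (ht : ‖t‖ ≤ 1) :
    dI x t ≤ 3 * (dI x s + dI s t) := by
  have hid : (1 : ℂ) - herm x t = (1 - herm x s) + (1 - herm s t) - (1 - herm s s)
      - herm (x - s) (t - s) := by
    simp only [herm_sub_left, herm_sub_right]; ring
  have h1 : ‖(1 : ℂ) - herm s s‖ = 1 - ‖s‖ ^ 2 := by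
    rw [herm_self, ← Complex.ofReal_one, ← Complex.ofReal_sub, Complex.norm_real,
      Real.norm_of_nonneg (by nlinarith [norm_nonneg s])]
  have h2 := norm_herm_le (x - s) (t - s)
  have h3 := norm_sub_sq_le_dI hx hs
  have h4 := norm_sub_sq_le_dI ht hs
  have h5 := one_sub_sq_le_dI hs hx
  have h6 := one_sub_sq_le_dI hs ht
  rw [dI_comm] at h5
  rw [dI_comm] at h4
  have h7 : dI x t ≤ dI x s + dI s t + (1 - ‖s‖ ^ 2) + ‖x - s‖ * ‖t - s‖ := by
    have e1 := norm_sub_le ((1 - herm x s) + (1 - herm s t) - (1 - herm s s)) (herm (x - s) (t - s))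
    have e2 := norm_sub_le ((1 - herm x s) + (1 - herm s t)) (1 - herm s s)
    have e3 := norm_add_le (1 - herm x s) (1 - herm s t)
    rw [← hid] at e1
    unfold dI
    linarith
  nlinarith [sq_nonneg (‖x - s‖ - ‖t - s‖)]

lemma dI_le_two_mul {s ξ : En n} {r : ℝ} (hs : ‖s‖ ≤ 1) (hξ : ‖ξ‖ = 1) (hr0 : 0 ≤ r)
    (hr : r ≤ 1) : dI s ξ ≤ 2 * dI s (r • ξ) := by
  have h1 : (1 : ℂ) - herm s ξ = (1 - herm s (r • ξ)) - ((1 - r : ℝ) : ℂ) * herm s ξ := by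
    rw [herm_real_smul_right]; push_cast; ring
  have h2 := norm_sub_le (1 - herm s (r • ξ)) (((1 - r : ℝ) : ℂ) * herm s ξ)
  rw [← h1, norm_mul, Complex.norm_real, Real.norm_of_nonneg (by linarith)] at h2
  have h3 := norm_herm_le s ξ
  have h4 := one_sub_norm_le_dI (x := r • ξ) hs
  rw [dI_comm, norm_smul, Real.norm_of_nonneg hr0, hξ] at h4
  have h5 : ‖herm s ξ‖ ≤ 1 := h3.trans (by rw [hξ, mul_one]; exact hs)
  unfold dI at *
  nlinarith [mul_le_mul_of_nonneg_left h5 (sub_nonneg.2 hr)]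

end Herm

section Anisotropic

variable {n : ℕ}

/-- The nonisotropic dilation of size `τ` in the direction `ξ` and `√τ` orthogonally to it. -/
def anis (τ : ℝ) (ξ : En n) : En n →ₗ[ℂ] En n :=
  (√τ : ℂ) • LinearMap.transvection (((√τ - 1 : ℝ) : ℂ) • (innerₛₗ ℂ ξ)) ξ

lemma anis_apply (τ : ℝ) (ξ u : En n) :
    anis τ ξ u = (√τ : ℂ) • (u + (((√τ - 1 : ℝ) : ℂ) * herm u ξ) • ξ) := by
  simp [anis, LinearMap.transvection.apply, herm_eq_inner]

lemma herm_anis {τ : ℝ} (hτ : 0 ≤ τ) {ξ : En n} (hξ : ‖ξ‖ = 1) (u : En n) :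
    herm (anis τ ξ u) ξ = τ * herm u ξ := by
  rw [anis_apply, herm_smul_left, herm_add_left, herm_smul_left, herm_self, hξ]
  have : (√τ : ℂ) * √τ = τ := by rw [← Complex.ofReal_mul, Real.mul_self_sqrt hτ]
  push_cast
  linear_combination herm u ξ * this

lemma norm_anis_sq {τ : ℝ} (hτ : 0 ≤ τ) {ξ : En n} (hξ : ‖ξ‖ = 1) (u : En n) :
    ‖anis τ ξ u‖ ^ 2 = τ * ‖u‖ ^ 2 + (τ ^ 2 - τ) * ‖herm u ξ‖ ^ 2 := by
  have hs : √τ ^ 2 = τ := Real.sq_sqrt hτ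
  have h1 : (herm u ((((√τ - 1 : ℝ) : ℂ) * herm u ξ) • ξ)).re = (√τ - 1) * ‖herm u ξ‖ ^ 2 := by
    rw [herm_smul_right, map_mul, Complex.conj_ofReal, mul_assoc, Complex.conj_mul',
      Complex.re_ofReal_mul]
    norm_cast
  rw [anis_apply, norm_smul, mul_pow, Complex.norm_real, norm_add_sq_herm, norm_smul, hξ, norm_mul,
    Complex.norm_real, h1, Real.norm_eq_abs, Real.norm_eq_abs, sq_abs, hs, mul_one, mul_pow, sq_abs]
  linear_combination τ * ‖herm u ξ‖ ^ 2 * hs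

lemma abs_det_anis {τ : ℝ} (hτ : 0 ≤ τ) {ξ : En n} (hξ : ‖ξ‖ = 1) :
    |LinearMap.det ((anis τ ξ).restrictScalars ℝ)| = τ ^ (n + 1) := by
  have h1 : LinearMap.det (anis τ ξ) = ((√τ ^ (n + 1) : ℝ) : ℂ) := by
    rw [anis, LinearMap.det_smul, LinearMap.transvection.det]
    have : inner ℂ ξ ξ = (1 : ℂ) := by rw [← herm_eq_inner, herm_self, hξ]; simp
    rw [LinearMap.smul_apply, innerₛₗ_apply_apply, this, finrank_euclideanSpace_fin]
    push_cast
    rw [smul_eq_mul]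
    ring
  rw [LinearMap.det_restrictScalars, h1, Algebra.norm_complex_apply, Complex.normSq_ofReal,
    ← pow_two, ← pow_mul, mul_comm, pow_mul, Real.sq_sqrt hτ, abs_of_nonneg (by positivity)]

end Anisotropic

section Boxes

variable {n : ℕ}

lemma measurableSet_dI_lt {f : En n → En n} (hf : Continuous f) (ξ : En n) (r : ℝ) :
    MeasurableSet {w | dI (f w) ξ < r} := by
  have : Continuous fun w => dI (f w) ξ := by
    unfold dI; simp only [herm_eq_inner]; fun_prop
  exact (isOpen_lt this continuous_const).measurableSet

lemma volume_preimage_anis {τ : ℝ} (hτ : 0 < τ) {ξ : En n} (hξ : ‖ξ‖ = 1) (s : Set (En n)) :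
    volume s = ENNReal.ofReal (τ ^ (n + 1)) * volume (anis τ ξ ⁻¹' s) := by
  have hdet := abs_det_anis hτ.le hξ
  have hne : LinearMap.det ((anis τ ξ).restrictScalars ℝ) ≠ 0 := by
    intro h; rw [h, abs_zero] at hdet; exact (pow_pos hτ _).ne hdet
  have := Measure.addHaar_preimage_linearMap (volume : Measure (En n)) hne s
  rw [abs_inv, hdet] at this
  change volume (anis τ ξ ⁻¹' s) = _ at this
  rw [this, ← mul_assoc, ← ENNReal.ofReal_mul (by positivity), mul_inv_cancel₀ (by positivity),
    ENNReal.ofReal_one, one_mul]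

/-- Volume of Carleson boxes. -/
lemma exists_volN_box_le (n : ℕ) : ∃ C : ℝ≥0∞, C ≠ ⊤ ∧ ∀ ζ ∈ Sn n, ∀ δ > (0 : ℝ),
    volN n {w | dI w ζ < δ} ≤ C * ENNReal.ofReal (δ ^ (n + 1)) := by
  have hvol0 : volume (Bn n) ≠ 0 := (measure_ball_pos _ _ one_pos).ne'
  refine ⟨(volume (Bn n))⁻¹ * volume (ball (0 : En n) 2), ENNReal.mul_ne_top
    (ENNReal.inv_ne_top.2 hvol0) measure_ball_lt_top.ne, fun ζ hζ δ hδ => ?_⟩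
  have hζ1 : ‖ζ‖ = 1 := by simpa [Sn] using hζ
  rw [volN, Measure.smul_apply, smul_eq_mul, mul_assoc]
  refine mul_le_mul_right ?_ _
  rw [Bn, Measure.restrict_apply' (measurableSet_ball (x := (0 : En n))), mul_comm]
  change volume ({w | dI w ζ < δ} ∩ Bn n) ≤ _
  have h1 : volume ({w | dI w ζ < δ} ∩ Bn n) = volume ((fun x => ζ + x) ⁻¹' ({w | dI w ζ < δ} ∩ Bn n)) :=
    (measure_preimage_add _ _ _).symm
  rw [h1, volume_preimage_anis hδ hζ1]
  refine mul_le_mul_right (measure_mono ?_) _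
  rintro u ⟨hu1, hu2⟩
  have hu2 : ‖ζ + anis δ ζ u‖ < 1 := by simpa [Bn] using hu2
  have hu1 : dI (ζ + anis δ ζ u) ζ < δ := hu1
  have h2 : ‖herm u ζ‖ < 1 := by
    rw [dI, herm_add_left, herm_anis hδ.le hζ1, herm_self, hζ1] at hu1
    have : (1 : ℂ) - (((1 : ℝ) ^ 2 : ℝ) + δ * herm u ζ) = -(δ * herm u ζ) := by push_cast; ring
    rw [this, norm_neg, norm_mul, Complex.norm_real, Real.norm_of_nonneg hδ.le] at hu1
    nlinarith
  have h3 := norm_sub_sq_le_dI hu2.le hζ1.le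
  rw [add_sub_cancel_left, norm_anis_sq hδ.le hζ1] at h3
  have h4 : ‖herm u ζ‖ ^ 2 ≤ 1 := by nlinarith [norm_nonneg (herm u ζ)]
  have h5 : δ * ‖u‖ ^ 2 ≤ δ * 3 := by nlinarith [sq_nonneg (δ * ‖herm u ζ‖)]
  have h6 : ‖u‖ ^ 2 ≤ 3 := le_of_mul_le_mul_left h5 hδ
  rw [mem_ball_zero_iff]
  nlinarith [norm_nonneg u]

/-- Surface measure of nonisotropic caps. -/
lemma exists_sigmaS_cap_le (hn : 1 ≤ n) : ∃ C : ℝ≥0∞, C ≠ ⊤ ∧ ∀ ξ ∈ Sn n, ∀ δ > (0 : ℝ),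
    sigmaS n {ζ | dI ζ ξ < δ} ≤ C * ENNReal.ofReal (δ ^ n) := by
  obtain ⟨c, hc0, hct, hpol⟩ := exists_polar hn
  obtain ⟨C, hC, hbox⟩ := exists_volN_box_le n
  have := isProbabilityMeasure_sigmaS hn
  set A := ENNReal.ofReal (2 ^ (2 * n - 1)) * c⁻¹ * (C * ENNReal.ofReal (2 ^ (n + 1))) with hA
  have hAt : A ≠ ⊤ := by
    refine ENNReal.mul_ne_top (ENNReal.mul_ne_top ENNReal.ofReal_ne_top
      (ENNReal.inv_ne_top.2 hc0)) (ENNReal.mul_ne_top hC ENNReal.ofReal_ne_top)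
  refine ⟨max A (ENNReal.ofReal (2 ^ n)), (max_lt hAt.lt_top ENNReal.ofReal_lt_top).ne,
    fun ξ hξ δ hδ => ?_⟩
  have hξ1 : ‖ξ‖ = 1 := by simpa [Sn] using hξ
  rcases le_or_gt δ (1 / 2) with h | h
  · refine le_trans ?_ (mul_le_mul_left (le_max_left _ _) _)
    have hm : MeasurableSet {w : En n | dI w ξ < 2 * δ} := measurableSet_dI_lt continuous_id ξ _
    have h1 := hpol _ (measurable_one.indicator hm)
    rw [lintegral_indicator_one hm] at h1
    have h2 := hbox ξ hξ (2 * δ) (by positivity)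
    rw [h1] at h2
    set s := sigmaS n {ζ | dI ζ ξ < δ}
    have h3 : ENNReal.ofReal δ * (ENNReal.ofReal ((1 / 2) ^ (2 * n - 1)) * s) ≤
        ∫⁻ t in Ioo (0 : ℝ) 1, ENNReal.ofReal (t ^ (2 * n - 1)) *
          ∫⁻ ζ, {w : En n | dI w ξ < 2 * δ}.indicator 1 (t • ζ) ∂(sigmaS n) := by
      have hsub : Ioo (1 - δ) 1 ⊆ Ioo (0 : ℝ) 1 := Ioo_subset_Ioo (by linarith) le_rfl
      refine le_trans ?_ (lintegral_mono_set hsub)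
      have : ENNReal.ofReal δ = volume (Ioo (1 - δ) 1) := by rw [Real.volume_Ioo]; congr 1; ring
      rw [this, mul_comm, ← setLIntegral_const]
      refine setLIntegral_mono' measurableSet_Ioo fun t ht => ?_
      refine mul_le_mul' (ENNReal.ofReal_le_ofReal (pow_le_pow_left₀ (by norm_num)
        (by linarith [ht.1]) _)) ?_
      have hm' : MeasurableSet {ζ : En n | dI (t • ζ) ξ < 2 * δ} :=
        measurableSet_dI_lt (continuous_const_smul t) ξ _
      have e1 : ∫⁻ ζ, {w : En n | dI w ξ < 2 * δ}.indicator 1 (t • ζ) ∂(sigmaS n)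
          = sigmaS n {ζ : En n | dI (t • ζ) ξ < 2 * δ} := by
        rw [← lintegral_indicator_one hm']; rfl
      rw [e1]
      refine measure_mono_ae ?_
      filter_upwards [ae_sigmaS] with ζ hζ hζ'
      have hζ1 : ‖ζ‖ = 1 := by simpa [Sn] using hζ
      change dI (t • ζ) ξ < 2 * δ
      have hζ' : dI ζ ξ < δ := hζ'
      have e2 : (1 : ℂ) - herm (t • ζ) ξ = (1 - herm ζ ξ) + ((1 - t : ℝ) : ℂ) * herm ζ ξ := by
        rw [herm_real_smul_left]; push_cast; ring
      have e3 := norm_add_le (1 - herm ζ ξ) (((1 - t : ℝ) : ℂ) * herm ζ ξ)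
      have e4 := norm_herm_le ζ ξ
      rw [hζ1, hξ1] at e4
      rw [← e2, norm_mul, Complex.norm_real, Real.norm_of_nonneg (by linarith [ht.2])] at e3
      unfold dI at *
      nlinarith [ht.1, ht.2, norm_nonneg (herm ζ ξ)]
    have h4 : c * (ENNReal.ofReal δ * (ENNReal.ofReal ((1 / 2) ^ (2 * n - 1)) * s)) ≤
        C * ENNReal.ofReal ((2 * δ) ^ (n + 1)) := (mul_le_mul_right h3 _).trans h2
    have hδ0 : ENNReal.ofReal δ ≠ 0 := by simpa using hδ
    have e5 : ENNReal.ofReal (2 ^ (2 * n - 1)) * ENNReal.ofReal ((1 / 2) ^ (2 * n - 1)) = 1 := by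
      rw [← ENNReal.ofReal_mul (by positivity), ← mul_pow]; norm_num
    have e6 : c⁻¹ * c = 1 := ENNReal.inv_mul_cancel hc0 hct
    have e7 : (ENNReal.ofReal δ)⁻¹ * ENNReal.ofReal δ = 1 :=
      ENNReal.inv_mul_cancel hδ0 ENNReal.ofReal_ne_top
    calc s = (ENNReal.ofReal (2 ^ (2 * n - 1)) * ENNReal.ofReal ((1 / 2) ^ (2 * n - 1))) *
          (c⁻¹ * c) * ((ENNReal.ofReal δ)⁻¹ * ENNReal.ofReal δ) * s := by rw [e5, e6, e7]; simp
      _ = ENNReal.ofReal (2 ^ (2 * n - 1)) * c⁻¹ * (ENNReal.ofReal δ)⁻¹ *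
          (c * (ENNReal.ofReal δ * (ENNReal.ofReal ((1 / 2) ^ (2 * n - 1)) * s))) := by ring
      _ ≤ ENNReal.ofReal (2 ^ (2 * n - 1)) * c⁻¹ * (ENNReal.ofReal δ)⁻¹ *
          (C * ENNReal.ofReal ((2 * δ) ^ (n + 1))) := mul_le_mul_right h4 _
      _ = A * ENNReal.ofReal (δ ^ n) * ((ENNReal.ofReal δ)⁻¹ * ENNReal.ofReal δ) := by
          rw [hA, mul_pow, pow_succ δ, ENNReal.ofReal_mul (by positivity),
            ENNReal.ofReal_mul (by positivity)]
          ring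
      _ = A * ENNReal.ofReal (δ ^ n) := by rw [e7, mul_one]
  · refine le_trans prob_le_one (le_trans ?_ (mul_le_mul_left (le_max_right _ _) _))
    rw [← ENNReal.ofReal_mul (by positivity), ← mul_pow, ENNReal.one_le_ofReal]
    exact one_le_pow₀ (by linarith)

/-- The integral of the kernel `ρ_x^n / |1 - ⟨s, x⟩|^{2n}` against a Carleson measure. -/
lemma lintegral_kernel_le (hn : 1 ≤ n) {ν : Measure (En n)} (hν : ∀ᵐ s ∂ν, ‖s‖ ≤ 1) {K : ℝ≥0∞}
    (hK : ∀ ζ ∈ Sn n, ∀ δ > (0 : ℝ), ν {s | dI s ζ < δ} ≤ K * ENNReal.ofReal (δ ^ n))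
    {x : En n} (hx : ‖x‖ < 1) :
    ∫⁻ s, ENNReal.ofReal ((1 - ‖x‖ ^ 2) ^ n / dI s x ^ (2 * n)) ∂ν ≤
      ENNReal.ofReal (2 * 8 ^ n) * K := by
  obtain ⟨ξ, hξ, hxξ⟩ : ∃ ξ : En n, ‖ξ‖ = 1 ∧ x = ‖x‖ • ξ := by
    by_cases h0 : x = 0
    · have := nontrivial_En hn
      obtain ⟨ξ, hξ⟩ := exists_norm_eq (En n) (zero_le_one (α := ℝ))
      exact ⟨ξ, hξ, by simp [h0]⟩
    · refine ⟨‖x‖⁻¹ • x, ?_, ?_⟩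
      · rw [norm_smul, norm_inv, norm_norm, inv_mul_cancel₀ (norm_ne_zero_iff.2 h0)]
      · rw [smul_smul, mul_inv_cancel₀ (norm_ne_zero_iff.2 h0), one_smul]
  set d := 1 - ‖x‖ with hd
  have hd0 : 0 < d := by linarith
  have hρ : 1 - ‖x‖ ^ 2 ≤ 2 * d := by nlinarith [norm_nonneg x]
  have hρ0 : 0 ≤ 1 - ‖x‖ ^ 2 := by nlinarith [norm_nonneg x]
  have hm : ∀ r : ℝ, MeasurableSet {s : En n | dI s ξ < r} := fun r =>
    measurableSet_dI_lt continuous_id ξ r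
  have hpt : ∀ᵐ s ∂ν, ENNReal.ofReal ((1 - ‖x‖ ^ 2) ^ n / dI s x ^ (2 * n)) ≤
      ∑' k : ℕ, ENNReal.ofReal ((2 * d) ^ n / (2 ^ k * d) ^ (2 * n)) *
        {s : En n | dI s ξ < 2 ^ (k + 2) * d}.indicator 1 s := by
    filter_upwards [hν] with s hs
    have h1 : d ≤ dI s x := by rw [dI_comm]; exact one_sub_norm_le_dI hs
    have h2 : dI s ξ ≤ 2 * dI s x := by
      have := dI_le_two_mul (r := ‖x‖) hs hξ (norm_nonneg x) hx.le
      rwa [← hxξ] at this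
    obtain ⟨k, hk1, hk2⟩ := exists_nat_pow_near (x := dI s x / d) (y := (2 : ℝ))
      (by rwa [one_le_div hd0]) (by norm_num)
    rw [le_div_iff₀ hd0] at hk1
    rw [div_lt_iff₀ hd0] at hk2
    refine le_trans ?_ (ENNReal.le_tsum k)
    rw [indicator_of_mem (by change dI s ξ < _; rw [pow_succ]; linarith), Pi.one_apply, mul_one]
    refine ENNReal.ofReal_le_ofReal ?_
    gcongr
  refine (lintegral_mono_ae hpt).trans ?_
  rw [lintegral_tsum fun k => ((measurable_one.indicator (hm _)).const_mul _).aemeasurable]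
  have hterm : ∀ k : ℕ, ∫⁻ s, ENNReal.ofReal ((2 * d) ^ n / (2 ^ k * d) ^ (2 * n)) *
        {s : En n | dI s ξ < 2 ^ (k + 2) * d}.indicator 1 s ∂ν ≤
      ENNReal.ofReal (8 ^ n) * K * (2⁻¹ : ℝ≥0∞) ^ k := by
    intro k
    rw [lintegral_const_mul _ (measurable_one.indicator (hm _)), lintegral_indicator_one (hm _)]
    refine (mul_le_mul_right (hK ξ (by simpa [Sn] using hξ) _ (by positivity)) _).trans ?_
    rw [mul_left_comm, ← ENNReal.ofReal_mul (by positivity), mul_comm _ K, mul_assoc]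
    refine mul_le_mul_right ?_ _
    have : (2⁻¹ : ℝ≥0∞) ^ k = ENNReal.ofReal ((2⁻¹ : ℝ) ^ k) := by
      rw [ENNReal.ofReal_pow (by norm_num), ENNReal.ofReal_inv_of_pos (by norm_num)]; norm_num
    rw [this, ← ENNReal.ofReal_mul (by positivity)]
    refine ENNReal.ofReal_le_ofReal ?_
    have e1 : (2 * d) ^ n / (2 ^ k * d) ^ (2 * n) * (2 ^ (k + 2) * d) ^ n
        = 8 ^ n * (2⁻¹ ^ k) ^ n := by
      rw [pow_mul, ← div_pow, ← mul_pow, ← mul_pow]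
      congr 1
      rw [inv_pow]
      field_simp
      ring
    rw [e1]
    refine mul_le_mul_of_nonneg_left ?_ (by positivity)
    exact pow_le_of_le_one (by positivity) (pow_le_one₀ (by norm_num) (by norm_num)) (by omega)
  refine (ENNReal.tsum_le_tsum hterm).trans ?_
  rw [ENNReal.tsum_mul_left, ENNReal.tsum_geometric_two, ENNReal.ofReal_mul (by norm_num)]
  simp only [ENNReal.ofReal_ofNat]
  exact le_of_eq (by ring)

end Boxes

section Holomorphic

variable {E : Type*} [NormedAddCommGroup E] [NormedSpace ℂ E]

lemma hasDerivAt_slice {g : E → ℂ} {z v : E} {c : ℂ} (hg : DifferentiableAt ℂ g (z + c • v)) :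
    HasDerivAt (fun w : ℂ => g (z + w • v)) (fderiv ℂ g (z + c • v) v) c := by
  have h1 : HasDerivAt (fun w : ℂ => z + w • v) v c := by
    simpa using ((hasDerivAt_id c).smul_const v).const_add z
  exact hg.hasFDerivAt.comp_hasDerivAt c h1

/-- The Cauchy estimate for the Fréchet derivative. -/
lemma norm_fderiv_apply_le_of_forall_ball {g : E → ℂ} {z : E} {r M : ℝ} (hr : 0 < r)
    (hd : DifferentiableOn ℂ g (ball z r)) (hM : ∀ w ∈ ball z r, ‖g w‖ ≤ M) (v : E) :
    ‖fderiv ℂ g z v‖ ≤ 2 * M / r * ‖v‖ := by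
  rcases eq_or_ne v 0 with rfl | hv
  · simp
  have hv0 : 0 < ‖v‖ := norm_pos_iff.2 hv
  set R := r / (2 * ‖v‖) with hR
  have hR0 : 0 < R := by positivity
  have hmem : ∀ w : ℂ, ‖w‖ ≤ R → z + w • v ∈ ball z r := by
    intro w hw
    rw [mem_ball, dist_eq_norm, add_sub_cancel_left, norm_smul]
    calc ‖w‖ * ‖v‖ ≤ R * ‖v‖ := by gcongr
      _ = r / 2 := by rw [hR]; field_simp
      _ < r := by linarith
  have hder : ∀ w : ℂ, ‖w‖ ≤ R → HasDerivAt (fun w : ℂ => g (z + w • v))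
      (fderiv ℂ g (z + w • v) v) w := fun w hw =>
    hasDerivAt_slice ((hd _ (hmem w hw)).differentiableAt (isOpen_ball.mem_nhds (hmem w hw)))
  have h0 := (hder 0 (by simpa using hR0.le)).deriv
  rw [zero_smul, add_zero] at h0
  have hc : DiffContOnCl ℂ (fun w : ℂ => g (z + w • v)) (ball 0 R) := by
    refine DifferentiableOn.diffContOnCl ?_
    rw [closure_ball _ hR0.ne']
    exact fun w hw => (hder w (by simpa using hw)).differentiableAt.differentiableWithinAt
  have h1 := Complex.norm_deriv_le_of_forall_mem_sphere_norm_le hR0 hc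
    (fun w hw => hM _ (hmem w (by simpa using (mem_sphere_zero_iff_norm.1 hw).le)))
  rw [h0] at h1
  refine h1.trans (le_of_eq ?_)
  rw [hR]; field_simp

variable [FiniteDimensional ℂ E]

/-- Directional derivatives of holomorphic functions are holomorphic. -/
lemma differentiableOn_fderiv_apply_const {U : Set E} (hU : IsOpen U) {g : E → ℂ}
    (hg : DifferentiableOn ℂ g U) (v : E) : DifferentiableOn ℂ (fun z => fderiv ℂ g z v) U := by
  borelize E
  have : ProperSpace E := FiniteDimensional.proper ℂ E
  intro z₀ hz₀
  obtain ⟨ε, hε, hsub⟩ : ∃ ε > 0, closedBall z₀ (2 * ε) ⊆ U := by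
    obtain ⟨ε, hε, h⟩ := nhds_basis_closedBall.mem_iff.1 (hU.mem_nhds hz₀)
    exact ⟨ε / 2, half_pos hε, by rwa [mul_div_cancel₀ _ two_ne_zero]⟩
  obtain ⟨M, hM⟩ := (isCompact_closedBall z₀ (2 * ε)).exists_bound_of_continuousOn
    (hg.continuousOn.mono hsub)
  have hdiff : ∀ z ∈ ball z₀ (2 * ε), DifferentiableAt ℂ g z := fun z hz =>
    (hg z (hsub (ball_subset_closedBall hz))).differentiableAt
      (hU.mem_nhds (hsub (ball_subset_closedBall hz)))
  have hbound : ∀ z ∈ ball z₀ ε, ‖fderiv ℂ g z‖ ≤ 2 * M / ε := by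
    intro z hz
    have hsub' : ball z ε ⊆ ball z₀ (2 * ε) := ball_subset_ball' (by
      rw [mem_ball] at hz; linarith)
    have hM0 : 0 ≤ M := (norm_nonneg _).trans (hM z₀ (mem_closedBall_self (by positivity)))
    exact ContinuousLinearMap.opNorm_le_bound _ (by positivity) fun w =>
      norm_fderiv_apply_le_of_forall_ball hε
        (fun y hy => (hdiff y (hsub' hy)).differentiableWithinAt)
        (fun y hy => hM y (ball_subset_closedBall (hsub' hy))) w
  set ρ := ε / (2 * (‖v‖ + 1)) with hρ
  have hρ0 : 0 < ρ := by positivity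
  have hρv : ρ * ‖v‖ ≤ ε / 2 := by
    rw [hρ, div_mul_eq_mul_div, div_le_div_iff₀ (by positivity) (by norm_num)]
    nlinarith [norm_nonneg v]
  have hmem : ∀ z ∈ ball z₀ (ε / 2), ∀ w : ℂ, ‖w‖ ≤ ρ → z + w • v ∈ ball z₀ ε := by
    intro z hz w hw
    rw [mem_ball, dist_eq_norm] at hz ⊢
    calc ‖z + w • v - z₀‖ = ‖(z - z₀) + w • v‖ := by congr 1; abel
      _ ≤ ‖z - z₀‖ + ‖w‖ * ‖v‖ := (norm_add_le _ _).trans (by rw [norm_smul])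
      _ ≤ ‖z - z₀‖ + ρ * ‖v‖ := by gcongr
      _ < ε := by linarith
  have hballs : ball z₀ ε ⊆ ball z₀ (2 * ε) := ball_subset_ball (by linarith)
  have hcm : ∀ θ, ‖circleMap 0 ρ θ‖ ≤ ρ := fun θ => by
    rw [norm_circleMap_zero, abs_of_pos hρ0]
  set kern : ℝ → ℂ := fun θ => deriv (circleMap 0 ρ) θ * ((circleMap 0 ρ θ - 0) ^ 2)⁻¹ with hkern
  have hkc : Continuous kern := by
    have h1 : Continuous (circleMap 0 ρ) := continuous_circleMap 0 ρ
    have h2 : ∀ θ, (circleMap 0 ρ θ - 0) ^ 2 ≠ 0 := fun θ => by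
      rw [sub_zero]; exact pow_ne_zero _ (circleMap_ne_center hρ0.ne')
    simp only [hkern, deriv_circleMap]
    exact (h1.mul continuous_const).mul (((h1.sub continuous_const).pow 2).inv₀ h2)
  have hcont : ∀ z ∈ ball z₀ (ε / 2), Continuous fun θ => kern θ * g (z + circleMap 0 ρ θ • v) := by
    intro z hz
    refine hkc.mul (continuous_iff_continuousAt.2 fun θ => ?_)
    have h1 := (hdiff _ (hballs (hmem z hz _ (hcm θ)))).continuousAt
    exact ContinuousAt.comp (f := fun θ => z + circleMap 0 ρ θ • v) h1
      (by have := continuous_circleMap 0 ρ; fun_prop)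
  have hformula : ∀ z ∈ ball z₀ (ε / 2), fderiv ℂ g z v =
      (2 * Real.pi * Complex.I : ℂ)⁻¹ • ∫ θ in (0 : ℝ)..2 * Real.pi,
        kern θ * g (z + circleMap 0 ρ θ • v) := by
    intro z hz
    have hVo : IsOpen ((fun w : ℂ => z + w • v) ⁻¹' ball z₀ (2 * ε)) :=
      isOpen_ball.preimage (by fun_prop)
    have h1 := Complex.two_pi_I_inv_smul_circleIntegral_sub_sq_inv_smul_of_differentiable
      (f := fun w : ℂ => g (z + w • v)) hVo (c := 0) (R := ρ) (w₀ := 0)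
      (fun w hw => hballs (hmem z hz w (by simpa using hw)))
      (fun w hw => (hasDerivAt_slice (hdiff _ hw)).differentiableAt.differentiableWithinAt)
      (mem_ball_self hρ0)
    have h2 := (hasDerivAt_slice (g := g) (z := z) (v := v) (c := 0)
      (hdiff _ (hballs (hmem z hz 0 (by simpa using hρ0.le))))).deriv
    rw [zero_smul, add_zero] at h2
    rw [← h2, ← h1, circleIntegral]
    simp only [smul_eq_mul, hkern, mul_assoc]
  have hder := hasFDerivAt_integral_of_dominated_of_fderiv_le (𝕜 := ℂ)
    (μ := volume.restrict (Ioc (0 : ℝ) (2 * Real.pi)))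
    (F := fun z θ => kern θ * g (z + circleMap 0 ρ θ • v))
    (F' := fun z θ => kern θ • fderiv ℂ g (z + circleMap 0 ρ θ • v)) (x₀ := z₀)
    (bound := fun θ => ‖kern θ‖ * (2 * M / ε)) (ball_mem_nhds z₀ (half_pos hε))
    (by filter_upwards [ball_mem_nhds z₀ (half_pos hε)] with z hz
        exact (hcont z hz).aestronglyMeasurable)
    ((hcont z₀ (mem_ball_self (half_pos hε))).integrableOn_Ioc)
    (by
      have h1 : Measurable fun θ => fderiv ℂ g (z₀ + circleMap 0 ρ θ • v) :=
        (measurable_fderiv ℂ g).comp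
          (by have := continuous_circleMap 0 ρ; fun_prop : Continuous fun θ =>
            z₀ + circleMap 0 ρ θ • v).measurable
      exact (hkc.measurable.smul h1).aestronglyMeasurable)
    (Eventually.of_forall fun θ z hz => by
      rw [norm_smul]
      exact mul_le_mul_of_nonneg_left (hbound _ (hmem z hz _ (hcm θ))) (norm_nonneg _))
    ((hkc.norm.mul continuous_const).integrableOn_Ioc)
    (Eventually.of_forall fun θ z hz => by
      have h1 := (hdiff _ (hballs (hmem z hz _ (hcm θ)))).hasFDerivAt
      have h2 : HasFDerivAt (fun z => z + circleMap 0 ρ θ • v) (ContinuousLinearMap.id ℂ E) z :=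
        (hasFDerivAt_id z).add_const _
      have h3 := (h1.comp z h2).const_mul (kern θ)
      simpa using h3)
  have hev : (fun z => fderiv ℂ g z v) =ᶠ[𝓝 z₀] fun z => (2 * Real.pi * Complex.I : ℂ)⁻¹ •
      ∫ θ in (0 : ℝ)..2 * Real.pi, kern θ * g (z + circleMap 0 ρ θ • v) := by
    filter_upwards [ball_mem_nhds z₀ (half_pos hε)] with z hz using hformula z hz
  refine DifferentiableAt.differentiableWithinAt (DifferentiableAt.congr_of_eventuallyEq ?_ hev)
  simp only [intervalIntegral.integral_of_le Real.two_pi_pos.le]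
  exact hder.differentiableAt.const_smul ((2 * Real.pi * Complex.I : ℂ)⁻¹)

/-- Holomorphic functions on open subsets of a finite-dimensional space are smooth. -/
lemma contDiffOn_nat_of_differentiableOn {U : Set E} (hU : IsOpen U) (m : ℕ) {g : E → ℂ}
    (hg : DifferentiableOn ℂ g U) : ContDiffOn ℂ m g U := by
  induction m generalizing g with
  | zero => exact contDiffOn_zero.2 hg.continuousOn
  | succ m ih =>
    push_cast
    rw [contDiffOn_succ_iff_fderiv_of_isOpen hU]
    exact ⟨hg, fun h => by simp at h, contDiffOn_clm_apply.2 fun y => ih (differentiableOn_fderiv_apply_const hU hg y)⟩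

end Holomorphic

section RadialIntegral

variable {n : ℕ} {f g : En n → ℂ}

lemma real_smul_mem_Bn {z : En n} (hz : z ∈ Bn n) {t : ℝ} (ht : t ∈ Icc (0 : ℝ) 1) :
    t • z ∈ Bn n := by
  rw [Bn, mem_ball_zero_iff] at *
  rw [norm_smul, Real.norm_eq_abs, abs_of_nonneg ht.1]
  nlinarith [norm_nonneg z, ht.2]

lemma differentiableOn_radD {U : Set (En n)} (hU : IsOpen U) (hg : DifferentiableOn ℂ g U) :
    DifferentiableOn ℂ (radD g) U := by
  have h := (contDiffOn_nat_of_differentiableOn hU 2 hg).fderiv_of_isOpen (m := 1) hU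
    (by norm_num)
  exact (h.differentiableOn one_ne_zero).clm_apply differentiableOn_id

/-- The integrand of `J` in a form without the singularity at `t = 0`. -/
def radKernel (g f : En n → ℂ) (q : En n × En n) : ℂ := f q.1 * fderiv ℂ g q.1 q.2

lemma J_eq_setIntegral_Ioc (g f : En n → ℂ) (z : En n) :
    J g f z = ∫ t in Ioc (0 : ℝ) 1, radKernel g f (t • z, z) := by
  rw [J, integral_Ioc_eq_integral_Ioo]
  refine setIntegral_congr_fun measurableSet_Ioo fun t ht => ?_
  have : (t : ℂ) ≠ 0 := by exact_mod_cast ht.1.ne'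
  simp only [radD, radKernel]
  rw [ContinuousLinearMap.map_smul_of_tower, Complex.real_smul]
  field_simp

lemma contDiffOn_radKernel (hg : DifferentiableOn ℂ g (Bn n)) (hf : DifferentiableOn ℂ f (Bn n)) :
    ContDiffOn ℂ 1 (radKernel g f) (Bn n ×ˢ univ) := by
  have hU : IsOpen (Bn n) := isOpen_ball
  have h1 := (contDiffOn_nat_of_differentiableOn hU 1 hf).comp contDiff_fst.contDiffOn
    (fun q (hq : q ∈ Bn n ×ˢ (univ : Set (En n))) => hq.1)
  have h2 := ((contDiffOn_nat_of_differentiableOn hU 2 hg).fderiv_of_isOpen (m := 1) hU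
    (by norm_num)).comp contDiff_fst.contDiffOn
    (fun q (hq : q ∈ Bn n ×ˢ (univ : Set (En n))) => hq.1)
  exact h1.mul (h2.clm_apply contDiff_snd.contDiffOn)

lemma differentiableOn_J (hg : DifferentiableOn ℂ g (Bn n)) (hf : DifferentiableOn ℂ f (Bn n)) :
    DifferentiableOn ℂ (J g f) (Bn n) := by
  have hU : IsOpen (Bn n ×ˢ (univ : Set (En n))) := isOpen_ball.prod isOpen_univ
  have hk := contDiffOn_radKernel hg hf
  have hkd : ContinuousOn (fderiv ℂ (radKernel g f)) (Bn n ×ˢ univ) :=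
    hk.continuousOn_fderiv_of_isOpen hU le_rfl
  set m : ℝ → En n →L[ℂ] En n × En n := fun t =>
    (t : ℂ) • ContinuousLinearMap.inl ℂ (En n) (En n) + ContinuousLinearMap.inr ℂ (En n) (En n)
    with hm
  have hmc : Continuous m :=
    (Complex.continuous_ofReal.smul continuous_const).add continuous_const
  have hmv : ∀ t z, m t z = (t • z, z) := fun t z => by simp [hm]
  intro z₀ hz₀
  obtain ⟨ε, hε, hsub⟩ : ∃ ε > 0, closedBall z₀ ε ⊆ Bn n :=
    nhds_basis_closedBall.mem_iff.1 (isOpen_ball.mem_nhds hz₀)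
  have hmaps : MapsTo (fun q : ℝ × En n => (q.1 • q.2, q.2)) (Icc (0 : ℝ) 1 ×ˢ closedBall z₀ ε)
      (Bn n ×ˢ univ) := fun q hq => ⟨real_smul_mem_Bn (hsub hq.2) hq.1, mem_univ _⟩
  have hqc : Continuous (fun q : ℝ × En n => (q.1 • q.2, q.2)) := by fun_prop
  have hF'c : ContinuousOn (fun q : ℝ × En n => (fderiv ℂ (radKernel g f) (q.1 • q.2, q.2)).comp
      (m q.1)) (Icc (0 : ℝ) 1 ×ˢ closedBall z₀ ε) :=
    (hkd.comp hqc.continuousOn hmaps).clm_comp (hmc.comp continuous_fst).continuousOn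
  have hFc : ContinuousOn (fun q : ℝ × En n => radKernel g f (q.1 • q.2, q.2))
      (Icc (0 : ℝ) 1 ×ˢ closedBall z₀ ε) := hk.continuousOn.comp hqc.continuousOn hmaps
  obtain ⟨M, hM⟩ := (isCompact_Icc.prod (isCompact_closedBall z₀ ε)).exists_bound_of_continuousOn
    hF'c
  have hsl : ∀ z ∈ closedBall z₀ ε, ContinuousOn (fun t : ℝ => radKernel g f (t • z, z))
      (Icc 0 1) := fun z hz => hFc.comp (f := fun t : ℝ => (t, z)) (by fun_prop)
        fun t ht => ⟨ht, hz⟩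
  have hsl' : ContinuousOn (fun t : ℝ => (fderiv ℂ (radKernel g f) (t • z₀, z₀)).comp (m t))
      (Icc 0 1) := hF'c.comp (f := fun t : ℝ => (t, z₀)) (by fun_prop)
        fun t ht => ⟨ht, mem_closedBall_self hε.le⟩
  have hder := hasFDerivAt_integral_of_dominated_of_fderiv_le (𝕜 := ℂ)
    (μ := volume.restrict (Ioc (0 : ℝ) 1))
    (F := fun z t => radKernel g f (t • z, z))
    (F' := fun z t => (fderiv ℂ (radKernel g f) (t • z, z)).comp (m t)) (x₀ := z₀)
    (bound := fun _ => M) (ball_mem_nhds z₀ hε)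
    (by filter_upwards [ball_mem_nhds z₀ hε] with z hz
        exact ((hsl z (ball_subset_closedBall hz)).mono Ioc_subset_Icc_self).aestronglyMeasurable
          measurableSet_Ioc)
    (((hsl z₀ (mem_closedBall_self hε.le)).integrableOn_Icc).mono_set Ioc_subset_Icc_self)
    ((hsl'.mono Ioc_subset_Icc_self).aestronglyMeasurable measurableSet_Ioc)
    (by filter_upwards [ae_restrict_mem measurableSet_Ioc] with t ht z hz
        exact hM (t, z) ⟨Ioc_subset_Icc_self ht, ball_subset_closedBall hz⟩)
    (by simp)
    (by filter_upwards [ae_restrict_mem measurableSet_Ioc] with t ht z hz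
        have hmem := hmaps (x := (t, z)) ⟨Ioc_subset_Icc_self ht, ball_subset_closedBall hz⟩
        have h1 : HasFDerivAt (radKernel g f) (fderiv ℂ (radKernel g f) (t • z, z)) (m t z) := by
          rw [hmv]
          exact ((hk.differentiableOn one_ne_zero _ hmem).differentiableAt
            (hU.mem_nhds hmem)).hasFDerivAt
        have h2 := h1.comp z (m t).hasFDerivAt
        simpa only [Function.comp_def, hmv] using h2)
  refine DifferentiableAt.differentiableWithinAt ?_
  have he : J g f = fun z => ∫ t in Ioc (0 : ℝ) 1, radKernel g f (t • z, z) :=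
    funext (J_eq_setIntegral_Ioc g f)
  rw [he]
  exact hder.differentiableAt

lemma J_smul (g f : En n → ℂ) (z : En n) (s : ℝ) :
    J g f (s • z) = ∫ u in (0 : ℝ)..s, radKernel g f (u • z, z) := by
  rw [J_eq_setIntegral_Ioc, ← intervalIntegral.integral_of_le zero_le_one]
  have h := intervalIntegral.smul_integral_comp_mul_right (a := 0) (b := 1)
    (fun u : ℝ => radKernel g f (u • z, z)) s
  rw [zero_mul, one_mul] at h
  rw [← h, ← intervalIntegral.integral_smul]
  congr 1; ext t
  simp only [radKernel, smul_smul, ContinuousLinearMap.map_smul_of_tower,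
    Algebra.smul_def, Complex.coe_algebraMap]
  ring

/-- The radial derivative of a Volterra-type integral. -/
lemma radD_J (hg : DifferentiableOn ℂ g (Bn n)) (hf : DifferentiableOn ℂ f (Bn n)) {z : En n}
    (hz : z ∈ Bn n) : radD (J g f) z = f z * radD g z := by
  have hJ : DifferentiableAt ℂ (J g f) z :=
    (differentiableOn_J hg hf z hz).differentiableAt (isOpen_ball.mem_nhds hz)
  have hslice : HasDerivAt (fun s : ℝ => J g f (s • z)) (radD (J g f) z) 1 := by
    have h1 : HasDerivAt (fun s : ℝ => s • z) z 1 := by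
      simpa using (hasDerivAt_id (1 : ℝ)).smul_const z
    have h2 : HasFDerivAt (J g f) ((fderiv ℂ (J g f) z).restrictScalars ℝ) ((1 : ℝ) • z) := by
      rw [one_smul]; exact hJ.hasFDerivAt.restrictScalars ℝ
    exact h2.comp_hasDerivAt (1 : ℝ) h1
  have hV : IsOpen ((fun u : ℝ => u • z) ⁻¹' Bn n) := isOpen_ball.preimage (by fun_prop)
  have hc : ContinuousOn (fun u : ℝ => radKernel g f (u • z, z))
      ((fun u : ℝ => u • z) ⁻¹' Bn n) :=
    (contDiffOn_radKernel hg hf).continuousOn.comp (by fun_prop) fun u hu => ⟨hu, mem_univ _⟩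
  have h1V : (1 : ℝ) ∈ (fun u : ℝ => u • z) ⁻¹' Bn n := by simpa using hz
  have hftc : HasDerivAt (fun s : ℝ => ∫ u in (0 : ℝ)..s, radKernel g f (u • z, z))
      (radKernel g f ((1 : ℝ) • z, z)) 1 := by
    refine intervalIntegral.integral_hasDerivAt_right ?_ ?_ ?_
    · refine (hc.mono ?_).intervalIntegrable
      rw [uIcc_of_le zero_le_one]
      exact fun u hu => real_smul_mem_Bn hz hu
    · exact hc.stronglyMeasurableAtFilter hV _ h1V
    · exact hc.continuousAt (hV.mem_nhds h1V)
  have heq : (fun s : ℝ => J g f (s • z)) =ᶠ[𝓝 1] fun s => ∫ u in (0 : ℝ)..s,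
      radKernel g f (u • z, z) := by
    exact Eventually.of_forall fun s => J_smul g f z s
  have := hslice.unique (hftc.congr_of_eventuallyEq heq)
  simpa [radKernel, radD] using this

end RadialIntegral

section SphereMean

variable {n : ℕ}

lemma aestronglyMeasurable_sigmaS {F : Type*} [NormedAddCommGroup F] [SecondCountableTopology F]
    {φ : En n → F} (h : ContinuousOn φ (Sn n)) : AEStronglyMeasurable φ (sigmaS n) := by
  have h1 := h.aestronglyMeasurable_of_isCompact (μ := sigmaS n) (isCompact_sphere 0 1)
    isClosed_sphere.measurableSet
  rwa [Measure.restrict_eq_self_of_ae_mem ae_sigmaS] at h1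

lemma integrable_sigmaS (hn : 1 ≤ n) {φ : En n → ℝ} (h : ContinuousOn φ (Sn n)) :
    Integrable φ (sigmaS n) := by
  have := isProbabilityMeasure_sigmaS hn
  obtain ⟨M, hM⟩ := (isCompact_sphere (0 : En n) 1).exists_bound_of_continuousOn h
  exact Integrable.of_bound (aestronglyMeasurable_sigmaS h) M
    (ae_sigmaS.mono fun ζ hζ => hM ζ hζ)

lemma norm_smul_sphere {ζ : En n} (hζ : ζ ∈ Sn n) (c : ℂ) : ‖c • ζ‖ = ‖c‖ := by
  rw [norm_smul, mem_sphere_zero_iff_norm.1 hζ, mul_one]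

lemma continuousOn_smul_sphere {F : Type*} [TopologicalSpace F] {φ : En n → F} {R : ℝ}
    (hφ : ContinuousOn φ (ball 0 R)) {c : ℂ} (hc : ‖c‖ < R) :
    ContinuousOn (fun ζ => φ (c • ζ)) (Sn n) :=
  hφ.comp (by fun_prop) fun ζ hζ => by
    rw [mem_ball_zero_iff, norm_smul_sphere hζ]; exact hc

lemma continuousAt_sphereMean (hn : 1 ≤ n) {φ : En n → ℝ} {R : ℝ}
    (hφ : ContinuousOn φ (ball 0 R)) {c : ℝ → ℂ} {s : ℝ} (hc : ContinuousAt c s) (hs : ‖c s‖ < R) :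
    ContinuousAt (fun u => ∫ ζ, φ (c u • ζ) ∂(sigmaS n)) s := by
  have := isProbabilityMeasure_sigmaS hn
  obtain ⟨R', h1, h2⟩ := exists_between hs
  obtain ⟨M, hM⟩ := (isCompact_closedBall (0 : En n) R').exists_bound_of_continuousOn
    (hφ.mono (closedBall_subset_ball h2))
  have hev : ∀ᶠ u in 𝓝 s, ‖c u‖ < R' := hc.norm.eventually_lt continuousAt_const h1
  refine tendsto_integral_filter_of_dominated_convergence (fun _ => M) ?_ ?_
    (integrable_const _) ?_
  · filter_upwards [hev] with u hu
    exact aestronglyMeasurable_sigmaS (continuousOn_smul_sphere hφ (hu.trans h2))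
  · filter_upwards [hev] with u hu
    filter_upwards [ae_sigmaS] with ζ hζ
    exact hM _ (by rw [mem_closedBall_zero_iff, norm_smul_sphere hζ]; exact hu.le)
  · filter_upwards [ae_sigmaS] with ζ hζ
    have hmem : c s • ζ ∈ ball (0 : En n) R := by
      rw [mem_ball_zero_iff, norm_smul_sphere hζ]; exact hs
    exact (hφ.continuousAt (isOpen_ball.mem_nhds hmem)).tendsto.comp
      (hc.smul continuousAt_const)

lemma hasDerivAt_sphereMean (hn : 1 ≤ n) {φ ψ : En n → ℝ} {R : ℝ}
    (hφ : ContinuousOn φ (ball 0 R)) (hψ : ContinuousOn ψ (ball 0 R)) {c : ℝ → ℂ} {k : ℝ → ℝ}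
    {s : ℝ} (hc : Continuous c) (hk : ContinuousAt k s) (hs : ‖c s‖ < R)
    (hder : ∀ᶠ u in 𝓝 s, ∀ ζ ∈ Sn n, HasDerivAt (fun u => φ (c u • ζ)) (k u * ψ (c u • ζ)) u) :
    HasDerivAt (fun u => ∫ ζ, φ (c u • ζ) ∂(sigmaS n)) (k s * ∫ ζ, ψ (c s • ζ) ∂(sigmaS n)) s := by
  have := isProbabilityMeasure_sigmaS hn
  obtain ⟨R', h1, h2⟩ := exists_between hs
  obtain ⟨M, hM⟩ := (isCompact_closedBall (0 : En n) R').exists_bound_of_continuousOn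
    (hψ.mono (closedBall_subset_ball h2))
  have hev : ∀ᶠ u in 𝓝 s, ‖c u‖ < R' :=
    hc.continuousAt.norm.eventually_lt continuousAt_const h1
  have hevk : ∀ᶠ u in 𝓝 s, ‖k u‖ < ‖k s‖ + 1 :=
    hk.norm.eventually_lt continuousAt_const (by linarith)
  have hall := (hev.and hevk).and hder
  have h := hasDerivAt_integral_of_dominated_loc_of_deriv_le (μ := sigmaS n)
    (F := fun u ζ => φ (c u • ζ)) (F' := fun u ζ => k u * ψ (c u • ζ)) (x₀ := s)
    (bound := fun _ => (‖k s‖ + 1) * M) hall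
    (by filter_upwards [hev] with u hu
        exact aestronglyMeasurable_sigmaS (continuousOn_smul_sphere hφ (hu.trans h2)))
    (integrable_sigmaS hn (continuousOn_smul_sphere hφ hs))
    (aestronglyMeasurable_sigmaS (continuousOn_const.mul (continuousOn_smul_sphere hψ hs)))
    (by filter_upwards [ae_sigmaS] with ζ hζ u hu
        rw [norm_mul]
        have h3 := hM (c u • ζ) (by
          rw [mem_closedBall_zero_iff, norm_smul_sphere hζ]; exact hu.1.1.le)
        have h4 := hu.1.2.le
        gcongr)
    (integrable_const _)
    (by filter_upwards [ae_sigmaS] with ζ hζ u hu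
        exact hu.2 ζ hζ)
  simpa only [integral_const_mul] using h.2

/-- Rotation invariance of the surface measure. -/
lemma integral_sigmaS_rotate {φ : En n → ℝ} {c : ℂ} (hc : ‖c‖ = 1) (a : ℂ) :
    ∫ ζ, φ (a • (c • ζ)) ∂(sigmaS n) = ∫ ζ, φ (a • ζ) ∂(sigmaS n) := by
  set e : En n ≃ₗᵢ[ℝ] En n :=
    { (LinearEquiv.smulOfNeZero ℂ (En n) c (norm_ne_zero_iff.1 (by rw [hc]; norm_num))).restrictScalars ℝ with
      norm_map' := fun x => by
        change ‖c • x‖ = ‖x‖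
        rw [norm_smul, hc, one_mul] }
  exact (measurePreserving_sigmaS e).integral_comp e.toHomeomorph.measurableEmbedding
    (fun ζ => φ (a • ζ))

end SphereMean

section HardyStein

variable {n : ℕ}

/-- The regularized squared modulus of a pair of functions. -/
def hsW (ε : ℝ) (f₁ f₂ : En n → ℂ) (z : En n) : ℝ := ε + ‖f₁ z‖ ^ 2 + ‖f₂ z‖ ^ 2

/-- The squared modulus of the radial derivative of a pair of functions. -/
def hsY (f₁ f₂ : En n → ℂ) (z : En n) : ℝ := ‖radD f₁ z‖ ^ 2 + ‖radD f₂ z‖ ^ 2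

def hsX (f₁ f₂ : En n → ℂ) (z : En n) : ℂ :=
  starRingEnd ℂ (f₁ z) * radD f₁ z + starRingEnd ℂ (f₂ z) * radD f₂ z

def hsV (f₁ f₂ : En n → ℂ) (z : En n) : ℂ :=
  starRingEnd ℂ (f₁ z) * radD (radD f₁) z + starRingEnd ℂ (f₂ z) * radD (radD f₂) z

/-- Twice the logarithmic derivative of `hsW ^ (p / 2)`. -/
def hsZ (p ε : ℝ) (f₁ f₂ : En n → ℂ) (z : En n) : ℂ :=
  ((p * hsW ε f₁ f₂ z ^ (p / 2 - 1) : ℝ) : ℂ) * hsX f₁ f₂ z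

/-- The logarithmic derivative of `hsZ` in the complex direction `κ`. -/
def hsZD (p ε : ℝ) (f₁ f₂ : En n → ℂ) (κ : ℂ) (z : En n) : ℂ :=
  ((p * (p / 2 - 1) * hsW ε f₁ f₂ z ^ (p / 2 - 2) * (2 * (κ * hsX f₁ f₂ z).re) : ℝ) : ℂ)
      * hsX f₁ f₂ z
    + ((p * hsW ε f₁ f₂ z ^ (p / 2 - 1) : ℝ) : ℂ) *
      (starRingEnd ℂ κ * (hsY f₁ f₂ z : ℂ) + κ * hsV f₁ f₂ z)

/-- The slice Laplacian of `hsW ^ (p / 2)`. -/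
def hsD (p ε : ℝ) (f₁ f₂ : En n → ℂ) (z : En n) : ℝ :=
  2 * p * hsW ε f₁ f₂ z ^ (p / 2 - 1) * hsY f₁ f₂ z +
    2 * p * (p / 2 - 1) * hsW ε f₁ f₂ z ^ (p / 2 - 2) * ‖hsX f₁ f₂ z‖ ^ 2

variable {p ε R : ℝ} {f₁ f₂ : En n → ℂ}

lemma hsW_pos (hε : 0 < ε) (f₁ f₂ : En n → ℂ) (z : En n) : 0 < hsW ε f₁ f₂ z := by
  unfold hsW; positivity

lemma hsY_nonneg (f₁ f₂ : En n → ℂ) (z : En n) : 0 ≤ hsY f₁ f₂ z := by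
  unfold hsY; positivity

lemma re_hsZD_sub_im_hsZD (p ε : ℝ) (f₁ f₂ : En n → ℂ) (z : En n) :
    (hsZD p ε f₁ f₂ 1 z).re - (hsZD p ε f₁ f₂ Complex.I z).im = hsD p ε f₁ f₂ z := by
  simp only [hsZD, hsD, ← Complex.normSq_eq_norm_sq (hsX f₁ f₂ z), Complex.normSq_apply,
    Complex.add_re, Complex.add_im, Complex.mul_re, Complex.mul_im, Complex.ofReal_re,
    Complex.ofReal_im, Complex.conj_I, Complex.I_re, Complex.I_im, map_one, Complex.one_re,
    Complex.one_im, Complex.neg_re, Complex.neg_im]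
  ring

lemma norm_hsX_sq_le (hε : 0 < ε) (f₁ f₂ : En n → ℂ) (z : En n) :
    ‖hsX f₁ f₂ z‖ ^ 2 ≤ hsW ε f₁ f₂ z * hsY f₁ f₂ z := by
  have h1 : ‖hsX f₁ f₂ z‖ ≤ ‖f₁ z‖ * ‖radD f₁ z‖ + ‖f₂ z‖ * ‖radD f₂ z‖ := by
    refine (norm_add_le _ _).trans (le_of_eq ?_)
    simp
  have h2 : ‖hsX f₁ f₂ z‖ ^ 2 ≤ (‖f₁ z‖ * ‖radD f₁ z‖ + ‖f₂ z‖ * ‖radD f₂ z‖) ^ 2 := by gcongr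
  unfold hsW hsY
  nlinarith [sq_nonneg (‖f₁ z‖ * ‖radD f₂ z‖ - ‖f₂ z‖ * ‖radD f₁ z‖),
    mul_nonneg hε.le (add_nonneg (sq_nonneg ‖radD f₁ z‖) (sq_nonneg ‖radD f₂ z‖))]

lemma hsD_bounds (hp : 0 < p) (hε : 0 < ε) (f₁ f₂ : En n → ℂ) (z : En n) :
    min (p ^ 2) (2 * p) * (hsW ε f₁ f₂ z ^ (p / 2 - 1) * hsY f₁ f₂ z) ≤ hsD p ε f₁ f₂ z ∧
    hsD p ε f₁ f₂ z ≤ max (p ^ 2) (2 * p) * (hsW ε f₁ f₂ z ^ (p / 2 - 1) * hsY f₁ f₂ z) := by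
  have hW := hsW_pos hε f₁ f₂ z
  have hY := hsY_nonneg f₁ f₂ z
  have hX := norm_hsX_sq_le hε f₁ f₂ z
  set W := hsW ε f₁ f₂ z
  set Y := hsY f₁ f₂ z
  set T := W ^ (p / 2 - 2) with hT
  have hT0 : 0 < T := Real.rpow_pos_of_pos hW _
  have hpow : W ^ (p / 2 - 1) = T * W := by
    rw [hT, ← Real.rpow_add_one hW.ne']; congr 1; ring
  have hX' : T * ‖hsX f₁ f₂ z‖ ^ 2 ≤ T * (W * Y) := by gcongr
  have hX0 : 0 ≤ T * ‖hsX f₁ f₂ z‖ ^ 2 := by positivity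
  have hD : hsD p ε f₁ f₂ z = 2 * p * (T * (W * Y)) +
      p * (p - 2) * (T * ‖hsX f₁ f₂ z‖ ^ 2) := by
    change 2 * p * W ^ (p / 2 - 1) * Y + _ = _
    rw [hpow]; ring
  rw [hD, hpow, mul_assoc T W Y]
  set a := T * (W * Y)
  set b := T * ‖hsX f₁ f₂ z‖ ^ 2
  have ha : 0 ≤ a := hX0.trans hX'
  rcases le_total p 2 with h2 | h2
  · have h3 : p ^ 2 ≤ 2 * p := by nlinarith
    rw [min_eq_left h3, max_eq_right h3]
    have h4 : 0 ≤ p * (2 - p) := by nlinarith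
    constructor <;> nlinarith
  · have h3 : 2 * p ≤ p ^ 2 := by nlinarith
    rw [min_eq_right h3, max_eq_left h3]
    have h4 : 0 ≤ p * (p - 2) := by nlinarith
    constructor <;> nlinarith

lemma hasDerivAt_holo_curve {f : En n → ℂ} (hf : DifferentiableOn ℂ f (ball 0 R)) {c : ℝ → ℂ}
    {κ : ℂ} {u : ℝ} (hc : HasDerivAt c (κ * c u) u) {ζ : En n} (hm : c u • ζ ∈ ball (0 : En n) R) :
    HasDerivAt (fun u => f (c u • ζ)) (κ * radD f (c u • ζ)) u := by
  have h1 : HasFDerivAt f ((fderiv ℂ f (c u • ζ)).restrictScalars ℝ) (c u • ζ) :=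
    ((hf _ hm).differentiableAt (isOpen_ball.mem_nhds hm)).hasFDerivAt.restrictScalars ℝ
  have h2 : HasDerivAt (fun u => c u • ζ) ((κ * c u) • ζ) u := hc.smul_const ζ
  have h3 := h1.comp_hasDerivAt u h2
  refine h3.congr_deriv ?_
  rw [mul_smul, ContinuousLinearMap.coe_restrictScalars', map_smul, smul_eq_mul, radD]

lemma hasDerivAt_hsW_curve (hf₁ : DifferentiableOn ℂ f₁ (ball 0 R))
    (hf₂ : DifferentiableOn ℂ f₂ (ball 0 R)) {c : ℝ → ℂ} {κ : ℂ} {u : ℝ}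
    (hc : HasDerivAt c (κ * c u) u) {ζ : En n} (hm : c u • ζ ∈ ball (0 : En n) R) :
    HasDerivAt (fun u => hsW ε f₁ f₂ (c u • ζ)) (2 * (κ * hsX f₁ f₂ (c u • ζ)).re) u := by
  have h1 := (hasDerivAt_holo_curve hf₁ hc hm).norm_sq
  have h2 := (hasDerivAt_holo_curve hf₂ hc hm).norm_sq
  refine (((hasDerivAt_const u ε).add h1).add h2).congr_deriv ?_
  simp only [hsX, Complex.inner, Complex.mul_re, Complex.mul_im, Complex.add_re, Complex.add_im,
    Complex.conj_re, Complex.conj_im]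
  ring

lemma hasDerivAt_hsU_curve (hε : 0 < ε) (hf₁ : DifferentiableOn ℂ f₁ (ball 0 R))
    (hf₂ : DifferentiableOn ℂ f₂ (ball 0 R)) {c : ℝ → ℂ} {κ : ℂ} {u : ℝ}
    (hc : HasDerivAt c (κ * c u) u) {ζ : En n} (hm : c u • ζ ∈ ball (0 : En n) R) :
    HasDerivAt (fun u => hsW ε f₁ f₂ (c u • ζ) ^ (p / 2)) (κ * hsZ p ε f₁ f₂ (c u • ζ)).re u := by
  refine ((hasDerivAt_hsW_curve hf₁ hf₂ hc hm).rpow_const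
    (Or.inl (hsW_pos hε f₁ f₂ _).ne')).congr_deriv ?_
  rw [hsZ, mul_left_comm, Complex.re_ofReal_mul]
  ring

lemma hasDerivAt_hsZ_curve (hε : 0 < ε) (hf₁ : DifferentiableOn ℂ f₁ (ball 0 R))
    (hf₂ : DifferentiableOn ℂ f₂ (ball 0 R)) {c : ℝ → ℂ} {κ : ℂ} {u : ℝ}
    (hc : HasDerivAt c (κ * c u) u) {ζ : En n} (hm : c u • ζ ∈ ball (0 : En n) R) :
    HasDerivAt (fun u => hsZ p ε f₁ f₂ (c u • ζ)) (hsZD p ε f₁ f₂ κ (c u • ζ)) u := by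
  have hW := (((hasDerivAt_hsW_curve (ε := ε) hf₁ hf₂ hc hm).rpow_const (p := p / 2 - 1)
    (Or.inl (hsW_pos hε f₁ f₂ _).ne')).const_mul p).ofReal_comp
  have h1 := hasDerivAt_holo_curve hf₁ hc hm
  have h2 := hasDerivAt_holo_curve hf₂ hc hm
  have h3 := hasDerivAt_holo_curve (differentiableOn_radD isOpen_ball hf₁) hc hm
  have h4 := hasDerivAt_holo_curve (differentiableOn_radD isOpen_ball hf₂) hc hm
  have hX := ((h1.star).mul h3).add ((h2.star).mul h4)
  refine (hW.mul hX).congr_deriv ?_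
  have e1 : ∀ w : ℂ, (‖w‖ : ℂ) ^ 2 = starRingEnd ℂ w * w := fun w => by
    rw [← Complex.normSq_eq_conj_mul_self, Complex.normSq_eq_norm_sq]; push_cast; ring
  have e2 : p / 2 - 1 - 1 = p / 2 - 2 := by ring
  simp only [hsZD, hsX, hsY, hsV, e2, Complex.star_def, map_mul, Complex.ofReal_mul,
    Complex.ofReal_add, Complex.ofReal_pow, e1, Pi.mul_apply, Pi.add_apply]
  ring

end HardyStein

section HardySteinIdentity

variable {n : ℕ} {p ε R : ℝ} {f₁ f₂ : En n → ℂ}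

lemma continuousOn_hsW (hf₁ : DifferentiableOn ℂ f₁ (ball 0 R))
    (hf₂ : DifferentiableOn ℂ f₂ (ball 0 R)) : ContinuousOn (hsW ε f₁ f₂) (ball 0 R) :=
  (continuousOn_const.add (hf₁.continuousOn.norm.pow 2)).add (hf₂.continuousOn.norm.pow 2)

lemma continuousOn_hsW_rpow (hε : 0 < ε) (hf₁ : DifferentiableOn ℂ f₁ (ball 0 R))
    (hf₂ : DifferentiableOn ℂ f₂ (ball 0 R)) (a : ℝ) :
    ContinuousOn (fun z => hsW ε f₁ f₂ z ^ a) (ball 0 R) :=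
  (continuousOn_hsW hf₁ hf₂).rpow_const fun z _ => Or.inl (hsW_pos hε f₁ f₂ z).ne'

lemma continuousOn_hsY (hf₁ : DifferentiableOn ℂ f₁ (ball 0 R))
    (hf₂ : DifferentiableOn ℂ f₂ (ball 0 R)) : ContinuousOn (hsY f₁ f₂) (ball 0 R) :=
  ((differentiableOn_radD isOpen_ball hf₁).continuousOn.norm.pow 2).add
    ((differentiableOn_radD isOpen_ball hf₂).continuousOn.norm.pow 2)

lemma continuousOn_hsX (hf₁ : DifferentiableOn ℂ f₁ (ball 0 R))
    (hf₂ : DifferentiableOn ℂ f₂ (ball 0 R)) : ContinuousOn (hsX f₁ f₂) (ball 0 R) :=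
  ((Complex.continuous_conj.comp_continuousOn hf₁.continuousOn).mul
    (differentiableOn_radD isOpen_ball hf₁).continuousOn).add
  ((Complex.continuous_conj.comp_continuousOn hf₂.continuousOn).mul
    (differentiableOn_radD isOpen_ball hf₂).continuousOn)

lemma continuousOn_hsV (hf₁ : DifferentiableOn ℂ f₁ (ball 0 R))
    (hf₂ : DifferentiableOn ℂ f₂ (ball 0 R)) : ContinuousOn (hsV f₁ f₂) (ball 0 R) :=
  ((Complex.continuous_conj.comp_continuousOn hf₁.continuousOn).mul
    (differentiableOn_radD isOpen_ball
      (differentiableOn_radD isOpen_ball hf₁)).continuousOn).add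
  ((Complex.continuous_conj.comp_continuousOn hf₂.continuousOn).mul
    (differentiableOn_radD isOpen_ball
      (differentiableOn_radD isOpen_ball hf₂)).continuousOn)

lemma continuousOn_hsZ (hε : 0 < ε) (hf₁ : DifferentiableOn ℂ f₁ (ball 0 R))
    (hf₂ : DifferentiableOn ℂ f₂ (ball 0 R)) : ContinuousOn (hsZ p ε f₁ f₂) (ball 0 R) :=
  (Complex.continuous_ofReal.comp_continuousOn
    (continuousOn_const.mul (continuousOn_hsW_rpow hε hf₁ hf₂ _))).mul (continuousOn_hsX hf₁ hf₂)

lemma continuousOn_hsZD (hε : 0 < ε) (hf₁ : DifferentiableOn ℂ f₁ (ball 0 R))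
    (hf₂ : DifferentiableOn ℂ f₂ (ball 0 R)) (κ : ℂ) :
    ContinuousOn (hsZD p ε f₁ f₂ κ) (ball 0 R) := by
  have hX := continuousOn_hsX hf₁ hf₂
  refine ((Complex.continuous_ofReal.comp_continuousOn ((continuousOn_const.mul
    (continuousOn_hsW_rpow hε hf₁ hf₂ _)).mul (continuousOn_const.mul
      (Complex.continuous_re.comp_continuousOn (continuousOn_const.mul hX))))).mul hX).add
    ((Complex.continuous_ofReal.comp_continuousOn
    (continuousOn_const.mul (continuousOn_hsW_rpow hε hf₁ hf₂ _))).mul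
    ((continuousOn_const.mul (Complex.continuous_ofReal.comp_continuousOn
      (continuousOn_hsY hf₁ hf₂))).add (continuousOn_const.mul (continuousOn_hsV hf₁ hf₂))))

lemma continuousOn_hsD (hε : 0 < ε) (hf₁ : DifferentiableOn ℂ f₁ (ball 0 R))
    (hf₂ : DifferentiableOn ℂ f₂ (ball 0 R)) : ContinuousOn (hsD p ε f₁ f₂) (ball 0 R) :=
  ((continuousOn_const.mul (continuousOn_hsW_rpow hε hf₁ hf₂ _)).mul
    (continuousOn_hsY hf₁ hf₂)).add ((continuousOn_const.mul
      (continuousOn_hsW_rpow hε hf₁ hf₂ _)).mul ((continuousOn_hsX hf₁ hf₂).norm.pow 2))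

/-- The spherical mean of `hsW ^ (p / 2)`. -/
def hsM (p ε : ℝ) (f₁ f₂ : En n → ℂ) (t : ℝ) : ℝ :=
  ∫ ζ, hsW ε f₁ f₂ ((t : ℂ) • ζ) ^ (p / 2) ∂(sigmaS n)

def hsN (p ε : ℝ) (f₁ f₂ : En n → ℂ) (t : ℝ) : ℝ :=
  ∫ ζ, (hsZ p ε f₁ f₂ ((t : ℂ) • ζ)).re ∂(sigmaS n)

/-- The spherical mean of `hsD`. -/
def hsDM (p ε : ℝ) (f₁ f₂ : En n → ℂ) (t : ℝ) : ℝ :=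
  ∫ ζ, hsD p ε f₁ f₂ ((t : ℂ) • ζ) ∂(sigmaS n)

lemma norm_ofReal_lt {t : ℝ} (h0 : 0 ≤ t) (h1 : t < R) : ‖(t : ℂ)‖ < R := by
  rwa [Complex.norm_real, Real.norm_of_nonneg h0]

lemma hasDerivAt_ofReal_curve {u : ℝ} (hu : u ≠ 0) :
    HasDerivAt (fun t : ℝ => (t : ℂ)) (((u⁻¹ : ℝ) : ℂ) * (u : ℂ)) u := by
  have h := Complex.ofRealCLM.hasDerivAt (x := u)
  refine h.congr_deriv ?_
  rw [← Complex.ofReal_mul, inv_mul_cancel₀ hu]; simp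

lemma mem_ball_smul_sphere {ζ : En n} (hζ : ζ ∈ Sn n) {c : ℂ} (hc : ‖c‖ < R) :
    c • ζ ∈ ball (0 : En n) R := by
  rwa [mem_ball_zero_iff, norm_smul_sphere hζ]

lemma hasDerivAt_hsM (hn : 1 ≤ n) (hε : 0 < ε) (hf₁ : DifferentiableOn ℂ f₁ (ball 0 R))
    (hf₂ : DifferentiableOn ℂ f₂ (ball 0 R)) {t : ℝ} (h0 : 0 < t) (h1 : t < R) :
    HasDerivAt (hsM p ε f₁ f₂) (t⁻¹ * hsN p ε f₁ f₂ t) t := by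
  refine hasDerivAt_sphereMean hn (continuousOn_hsW_rpow hε hf₁ hf₂ _)
    (Complex.continuous_re.comp_continuousOn (continuousOn_hsZ hε hf₁ hf₂))
    Complex.continuous_ofReal (k := fun u => u⁻¹) (continuousAt_inv₀ h0.ne')
    (norm_ofReal_lt h0.le h1) ?_
  filter_upwards [lt_mem_nhds h0, gt_mem_nhds h1] with u hu0 hu1 ζ hζ
  have h := hasDerivAt_hsU_curve (p := p) hε hf₁ hf₂ (hasDerivAt_ofReal_curve hu0.ne')
    (mem_ball_smul_sphere hζ (norm_ofReal_lt hu0.le hu1))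
  rwa [Complex.re_ofReal_mul] at h

lemma re_hsZD_ofReal (k : ℝ) (z : En n) :
    (hsZD p ε f₁ f₂ (k : ℂ) z).re = k * (hsZD p ε f₁ f₂ 1 z).re := by
  simp only [hsZD, Complex.add_re, Complex.re_ofReal_mul, Complex.conj_ofReal, map_one, one_mul,
    Complex.ofReal_re]
  ring

lemma integral_im_hsZD_I (hn : 1 ≤ n) (hε : 0 < ε) (hf₁ : DifferentiableOn ℂ f₁ (ball 0 R))
    (hf₂ : DifferentiableOn ℂ f₂ (ball 0 R)) {t : ℝ} (h0 : 0 ≤ t) (h1 : t < R) :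
    ∫ ζ, (hsZD p ε f₁ f₂ Complex.I ((t : ℂ) • ζ)).im ∂(sigmaS n) = 0 := by
  set c : ℝ → ℂ := fun θ => (t : ℂ) * Complex.exp (θ * Complex.I) with hc
  have hcn : ∀ θ, ‖c θ‖ < R := fun θ => by
    rw [hc, norm_mul, Complex.norm_exp_ofReal_mul_I, mul_one]; exact norm_ofReal_lt h0 h1
  have hcd : ∀ θ, HasDerivAt c (Complex.I * c θ) θ := fun θ => by
    have h2 : HasDerivAt (fun θ : ℝ => (θ : ℂ) * Complex.I) Complex.I θ := by
      simpa using (Complex.ofRealCLM.hasDerivAt (x := θ)).mul_const Complex.I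
    refine (h2.cexp.const_mul (t : ℂ)).congr_deriv ?_
    simp only [hc]; ring
  have hcc : Continuous c := by fun_prop
  have h := hasDerivAt_sphereMean hn (φ := fun z => (hsZ p ε f₁ f₂ z).im)
    (ψ := fun z => (hsZD p ε f₁ f₂ Complex.I z).im)
    (Complex.continuous_im.comp_continuousOn (continuousOn_hsZ hε hf₁ hf₂))
    (Complex.continuous_im.comp_continuousOn (continuousOn_hsZD hε hf₁ hf₂ _))
    hcc (k := fun _ => 1) (s := 0) continuousAt_const (hcn 0) (Eventually.of_forall
      fun θ ζ hζ => by
        have h3 := hasDerivAt_hsZ_curve (p := p) hε hf₁ hf₂ (hcd θ)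
          (mem_ball_smul_sphere hζ (hcn θ))
        have h4 := Complex.imCLM.hasFDerivAt.comp_hasDerivAt θ h3
        rw [one_mul]
        exact h4)
  have hconst : (fun u => ∫ ζ, (hsZ p ε f₁ f₂ (c u • ζ)).im ∂(sigmaS n)) =
      fun _ => ∫ ζ, (hsZ p ε f₁ f₂ ((t : ℂ) • ζ)).im ∂(sigmaS n) := by
    ext θ
    rw [← integral_sigmaS_rotate (φ := fun z => (hsZ p ε f₁ f₂ z).im)
      (Complex.norm_exp_ofReal_mul_I θ) (t : ℂ)]
    simp only [hc, mul_smul]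
  rw [hconst] at h
  have h5 := h.unique (hasDerivAt_const (0 : ℝ) _)
  simpa [hc] using h5

lemma hasDerivAt_hsN (hn : 1 ≤ n) (hε : 0 < ε) (hf₁ : DifferentiableOn ℂ f₁ (ball 0 R))
    (hf₂ : DifferentiableOn ℂ f₂ (ball 0 R)) {t : ℝ} (h0 : 0 < t) (h1 : t < R) :
    HasDerivAt (hsN p ε f₁ f₂) (t⁻¹ * hsDM p ε f₁ f₂ t) t := by
  have hD : hsDM p ε f₁ f₂ t = ∫ ζ, (hsZD p ε f₁ f₂ 1 ((t : ℂ) • ζ)).re ∂(sigmaS n) := by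
    rw [hsDM, ← sub_zero (∫ ζ, (hsZD p ε f₁ f₂ 1 ((t : ℂ) • ζ)).re ∂(sigmaS n)),
      ← integral_im_hsZD_I (p := p) hn hε hf₁ hf₂ h0.le h1, ← integral_sub]
    · simp only [re_hsZD_sub_im_hsZD]
    · exact integrable_sigmaS hn (continuousOn_smul_sphere (Complex.continuous_re.comp_continuousOn
        (continuousOn_hsZD hε hf₁ hf₂ _)) (norm_ofReal_lt h0.le h1))
    · exact integrable_sigmaS hn (continuousOn_smul_sphere (Complex.continuous_im.comp_continuousOn
        (continuousOn_hsZD hε hf₁ hf₂ _)) (norm_ofReal_lt h0.le h1))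
  rw [hD]
  refine hasDerivAt_sphereMean hn (φ := fun z => (hsZ p ε f₁ f₂ z).re)
    (ψ := fun z => (hsZD p ε f₁ f₂ 1 z).re)
    (Complex.continuous_re.comp_continuousOn (continuousOn_hsZ hε hf₁ hf₂))
    (Complex.continuous_re.comp_continuousOn (continuousOn_hsZD hε hf₁ hf₂ _))
    Complex.continuous_ofReal (k := fun u => u⁻¹) (continuousAt_inv₀ h0.ne')
    (norm_ofReal_lt h0.le h1) ?_
  filter_upwards [lt_mem_nhds h0, gt_mem_nhds h1] with u hu0 hu1 ζ hζ
  have h := hasDerivAt_hsZ_curve (p := p) hε hf₁ hf₂ (hasDerivAt_ofReal_curve hu0.ne')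
    (mem_ball_smul_sphere hζ (norm_ofReal_lt hu0.le hu1))
  have h4 := Complex.reCLM.hasFDerivAt.comp_hasDerivAt u h
  rw [← re_hsZD_ofReal]
  exact h4

lemma hsD_nonneg (hp : 0 < p) (hε : 0 < ε) (f₁ f₂ : En n → ℂ) (z : En n) :
    0 ≤ hsD p ε f₁ f₂ z := by
  refine le_trans ?_ (hsD_bounds hp hε f₁ f₂ z).1
  have := hsY_nonneg f₁ f₂ z
  have := hsW_pos hε f₁ f₂ z
  positivity

lemma hsDM_nonneg (hp : 0 < p) (hε : 0 < ε) (f₁ f₂ : En n → ℂ) (t : ℝ) :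
    0 ≤ hsDM p ε f₁ f₂ t :=
  integral_nonneg fun _ => hsD_nonneg hp hε f₁ f₂ _

lemma hsM_nonneg (hε : 0 < ε) (f₁ f₂ : En n → ℂ) (t : ℝ) : 0 ≤ hsM p ε f₁ f₂ t :=
  integral_nonneg fun _ => Real.rpow_nonneg (hsW_pos hε f₁ f₂ _).le _

lemma monotoneOn_hsN (hn : 1 ≤ n) (hp : 0 < p) (hε : 0 < ε)
    (hf₁ : DifferentiableOn ℂ f₁ (ball 0 R)) (hf₂ : DifferentiableOn ℂ f₂ (ball 0 R)) :
    MonotoneOn (hsN p ε f₁ f₂) (Ico 0 R) := by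
  refine monotoneOn_of_deriv_nonneg (convex_Ico 0 R) (fun t ht => ?_) ?_ ?_
  · refine (continuousAt_sphereMean hn (φ := fun z => (hsZ p ε f₁ f₂ z).re)
      (Complex.continuous_re.comp_continuousOn (continuousOn_hsZ hε hf₁ hf₂))
      Complex.continuous_ofReal.continuousAt (norm_ofReal_lt ht.1 ht.2)).continuousWithinAt
  · rw [interior_Ico]
    exact fun t ht => (hasDerivAt_hsN hn hε hf₁ hf₂ ht.1 ht.2).differentiableAt.differentiableWithinAt
  · rw [interior_Ico]
    intro t ht
    rw [(hasDerivAt_hsN hn hε hf₁ hf₂ ht.1 ht.2).deriv]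
    exact mul_nonneg (inv_nonneg.2 ht.1.le) (hsDM_nonneg hp hε f₁ f₂ t)

lemma hsN_nonneg (hn : 1 ≤ n) (hp : 0 < p) (hε : 0 < ε)
    (hf₁ : DifferentiableOn ℂ f₁ (ball 0 R)) (hf₂ : DifferentiableOn ℂ f₂ (ball 0 R)) {t : ℝ}
    (h0 : 0 ≤ t) (h1 : t < R) : 0 ≤ hsN p ε f₁ f₂ t := by
  refine le_trans (le_of_eq ?_) (monotoneOn_hsN hn hp hε hf₁ hf₂ ⟨le_rfl, h0.trans_lt h1⟩ ⟨h0, h1⟩ h0)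
  simp [hsN, hsZ, hsX, radD]

lemma monotoneOn_hsM (hn : 1 ≤ n) (hp : 0 < p) (hε : 0 < ε)
    (hf₁ : DifferentiableOn ℂ f₁ (ball 0 R)) (hf₂ : DifferentiableOn ℂ f₂ (ball 0 R)) :
    MonotoneOn (hsM p ε f₁ f₂) (Ico 0 R) := by
  refine monotoneOn_of_deriv_nonneg (convex_Ico 0 R) (fun t ht => ?_) ?_ ?_
  · exact (continuousAt_sphereMean hn (continuousOn_hsW_rpow hε hf₁ hf₂ _)
      Complex.continuous_ofReal.continuousAt (norm_ofReal_lt ht.1 ht.2)).continuousWithinAt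
  · rw [interior_Ico]
    exact fun t ht => (hasDerivAt_hsM hn hε hf₁ hf₂ ht.1 ht.2).differentiableAt.differentiableWithinAt
  · rw [interior_Ico]
    intro t ht
    rw [(hasDerivAt_hsM hn hε hf₁ hf₂ ht.1 ht.2).deriv]
    exact mul_nonneg (inv_nonneg.2 ht.1.le) (hsN_nonneg hn hp hε hf₁ hf₂ ht.1.le ht.2)

lemma continuousOn_hsDM (hn : 1 ≤ n) (hε : 0 < ε) (hf₁ : DifferentiableOn ℂ f₁ (ball 0 R))
    (hf₂ : DifferentiableOn ℂ f₂ (ball 0 R)) : ContinuousOn (hsDM p ε f₁ f₂) (Ico 0 R) :=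
  fun _ ht => (continuousAt_sphereMean hn (continuousOn_hsD hε hf₁ hf₂)
    Complex.continuous_ofReal.continuousAt (norm_ofReal_lt ht.1 ht.2)).continuousWithinAt

/-- A Hardy–Stein type identity. -/
lemma hsM_eq (hn : 1 ≤ n) (hε : 0 < ε) (hf₁ : DifferentiableOn ℂ f₁ (ball 0 R))
    (hf₂ : DifferentiableOn ℂ f₂ (ball 0 R)) {ρ r : ℝ} (h0 : 0 < ρ) (hr : ρ ≤ r) (h1 : r < R) :
    hsM p ε f₁ f₂ r = hsM p ε f₁ f₂ ρ + hsN p ε f₁ f₂ ρ * Real.log (r / ρ) +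
      ∫ t in ρ..r, t⁻¹ * hsDM p ε f₁ f₂ t * Real.log (r / t) := by
  have hmem : ∀ t ∈ uIcc ρ r, 0 < t ∧ t < R := by
    rw [uIcc_of_le hr]; exact fun t ht => ⟨h0.trans_le ht.1, ht.2.trans_lt h1⟩
  have hr0 : r ≠ 0 := (h0.trans_le hr).ne'
  have hder : ∀ t ∈ uIcc ρ r, HasDerivAt (fun t => hsM p ε f₁ f₂ t +
      hsN p ε f₁ f₂ t * Real.log (r / t)) (t⁻¹ * hsDM p ε f₁ f₂ t * Real.log (r / t)) t := by
    intro t ht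
    obtain ⟨ht0, ht1⟩ := hmem t ht
    have hl : HasDerivAt (fun t => Real.log (r / t)) (-t⁻¹) t := by
      have h3 : HasDerivAt (fun t => Real.log r - Real.log t) (-t⁻¹) t := by
        exact ((hasDerivAt_const t (Real.log r)).sub (Real.hasDerivAt_log ht0.ne')).congr_deriv
          (zero_sub _)
      refine h3.congr_of_eventuallyEq ?_
      filter_upwards [lt_mem_nhds ht0] with u hu
      exact Real.log_div hr0 hu.ne'
    refine ((hasDerivAt_hsM hn hε hf₁ hf₂ ht0 ht1).add
      ((hasDerivAt_hsN hn hε hf₁ hf₂ ht0 ht1).mul hl)).congr_deriv ?_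
    ring
  rw [intervalIntegral.integral_eq_sub_of_hasDerivAt hder]
  · simp [hr0]
  · refine ContinuousOn.intervalIntegrable ?_
    have hne : ∀ t ∈ uIcc ρ r, t ≠ 0 := fun t ht => (hmem t ht).1.ne'
    refine ((continuousOn_id.inv₀ hne).mul ((continuousOn_hsDM hn hε hf₁ hf₂).mono
      fun t ht => ⟨(hmem t ht).1.le, (hmem t ht).2⟩)).mul (ContinuousOn.log
        (continuousOn_const.div continuousOn_id hne) fun t ht => div_ne_zero hr0 (hne t ht))

end HardySteinIdentity

section HardySteinVolume

variable {n : ℕ}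

/-- The outer shell of the unit ball. -/
def shell (n : ℕ) : Set (En n) := {z | 1 / 2 < ‖z‖ ∧ ‖z‖ < 1}

lemma isOpen_shell : IsOpen (shell n) :=
  (isOpen_lt continuous_const continuous_norm).inter (isOpen_lt continuous_norm continuous_const)

lemma shell_subset_Bn : shell n ⊆ Bn n := fun _ hz => mem_ball_zero_iff.2 hz.2

lemma measurable_indicator_of_continuousOn {X F : Type*} [TopologicalSpace X] [MeasurableSpace X]
    [BorelSpace X] [TopologicalSpace F] [MeasurableSpace F] [BorelSpace F] [Zero F]
    {s : Set X} (hs : MeasurableSet s) {φ : X → F} (h : ContinuousOn φ s) :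
    Measurable (s.indicator φ) := by
  classical
  rw [← piecewise_eq_indicator]
  exact h.measurable_piecewise continuousOn_const hs

lemma ofReal_integral_sigmaS (hn : 1 ≤ n) {φ : En n → ℝ} {R : ℝ} (hφ : ContinuousOn φ (ball 0 R))
    (h0 : ∀ z ∈ ball 0 R, 0 ≤ φ z) {t : ℝ} (ht0 : 0 ≤ t) (ht : t < R) :
    ENNReal.ofReal (∫ ζ, φ ((t : ℂ) • ζ) ∂(sigmaS n)) =
      ∫⁻ ζ, ENNReal.ofReal (φ (t • ζ)) ∂(sigmaS n) := by
  have hc := norm_ofReal_lt ht0 ht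
  rw [ofReal_integral_eq_lintegral_ofReal (integrable_sigmaS hn (continuousOn_smul_sphere hφ hc))
    (ae_sigmaS.mono fun ζ hζ => h0 _ (mem_ball_smul_sphere hζ hc))]
  simp only [Complex.coe_smul]

lemma exists_shell_polar (hn : 1 ≤ n) : ∃ c : ℝ≥0∞, c ≠ 0 ∧ c ≠ ⊤ ∧ ∀ φ : En n → ℝ,
    ContinuousOn φ (Bn n) → (∀ z ∈ Bn n, 0 ≤ φ z) →
    ∫⁻ z in shell n, ENNReal.ofReal (φ z * (1 - ‖z‖ ^ 2)) ∂(volN n) =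
      c * ∫⁻ t in Ioo (1 / 2 : ℝ) 1, ENNReal.ofReal
        (t ^ (2 * n - 1) * (1 - t ^ 2) * ∫ ζ, φ ((t : ℂ) • ζ) ∂(sigmaS n)) := by
  obtain ⟨c, hc0, hct, hc⟩ := exists_polar hn
  refine ⟨c, hc0, hct, fun φ hφ h0 => ?_⟩
  have hcont : ContinuousOn (fun z => ENNReal.ofReal (φ z * (1 - ‖z‖ ^ 2))) (shell n) :=
    ENNReal.continuous_ofReal.comp_continuousOn ((hφ.mono shell_subset_Bn).mul (by fun_prop))
  rw [← lintegral_indicator isOpen_shell.measurableSet,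
    hc _ (measurable_indicator_of_continuousOn isOpen_shell.measurableSet hcont)]
  congr 1
  rw [← lintegral_indicator measurableSet_Ioo, ← lintegral_indicator measurableSet_Ioo]
  congr 1; ext t
  by_cases ht : t ∈ Ioo (1 / 2 : ℝ) 1
  · have ht' : t ∈ Ioo (0 : ℝ) 1 := ⟨by linarith [ht.1], ht.2⟩
    rw [indicator_of_mem ht, indicator_of_mem ht', ENNReal.ofReal_mul (mul_nonneg
      (pow_nonneg ht'.1.le _) (by nlinarith [ht'.1, ht'.2])), ENNReal.ofReal_mul
      (pow_nonneg ht'.1.le _), ofReal_integral_sigmaS hn hφ h0 ht'.1.le ht'.2, mul_assoc]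
    congr 1
    rw [← lintegral_const_mul' _ _ ENNReal.ofReal_ne_top]
    refine lintegral_congr_ae ?_
    filter_upwards [ae_sigmaS] with ζ hζ
    have hn1 : ‖t • ζ‖ = t := by
      rw [norm_smul, mem_sphere_zero_iff_norm.1 hζ, mul_one, Real.norm_of_nonneg ht'.1.le]
    have hmem : t • ζ ∈ shell n := by
      rw [shell, mem_ofPred_eq, hn1]; exact ht
    rw [indicator_of_mem hmem, hn1, mul_comm, ENNReal.ofReal_mul (by nlinarith [ht'.1, ht'.2])]
  · rw [indicator_of_notMem ht]
    by_cases ht' : t ∈ Ioo (0 : ℝ) 1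
    · rw [indicator_of_mem ht']
      have : ∫⁻ ζ, (shell n).indicator (fun z => ENNReal.ofReal (φ z * (1 - ‖z‖ ^ 2))) (t • ζ)
          ∂(sigmaS n) = 0 := by
        rw [← lintegral_zero (μ := sigmaS n)]
        refine lintegral_congr_ae ?_
        filter_upwards [ae_sigmaS] with ζ hζ
        refine indicator_of_notMem (fun hm => ht ?_) _
        rw [shell, mem_ofPred_eq, norm_smul, mem_sphere_zero_iff_norm.1 hζ, mul_one,
          Real.norm_of_nonneg ht'.1.le] at hm
        exact hm
      rw [this, mul_zero]
    · rw [indicator_of_notMem ht']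

variable {p : ℝ}

lemma continuousOn_hsW_mul_hsY {ε R : ℝ} (hε : 0 < ε) {f₁ f₂ : En n → ℂ}
    (hf₁ : DifferentiableOn ℂ f₁ (ball 0 R)) (hf₂ : DifferentiableOn ℂ f₂ (ball 0 R)) (a : ℝ) :
    ContinuousOn (fun z => hsW ε f₁ f₂ z ^ a * hsY f₁ f₂ z) (ball 0 R) :=
  (continuousOn_hsW_rpow hε hf₁ hf₂ a).mul (continuousOn_hsY hf₁ hf₂)

lemma hsDM_bounds (hn : 1 ≤ n) (hp : 0 < p) {ε R : ℝ} (hε : 0 < ε) {f₁ f₂ : En n → ℂ}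
    (hf₁ : DifferentiableOn ℂ f₁ (ball 0 R)) (hf₂ : DifferentiableOn ℂ f₂ (ball 0 R)) {t : ℝ}
    (h0 : 0 ≤ t) (h1 : t < R) :
    min (p ^ 2) (2 * p) * (∫ ζ, (fun z => hsW ε f₁ f₂ z ^ (p / 2 - 1) * hsY f₁ f₂ z) ((t : ℂ) • ζ)
      ∂(sigmaS n)) ≤ hsDM p ε f₁ f₂ t ∧ hsDM p ε f₁ f₂ t ≤ max (p ^ 2) (2 * p) *
      (∫ ζ, (fun z => hsW ε f₁ f₂ z ^ (p / 2 - 1) * hsY f₁ f₂ z) ((t : ℂ) • ζ) ∂(sigmaS n)) := by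
  have hc := norm_ofReal_lt h0 h1
  have i1 := integrable_sigmaS hn (continuousOn_smul_sphere
    (continuousOn_hsW_mul_hsY hε hf₁ hf₂ (p / 2 - 1)) hc)
  have i2 := integrable_sigmaS hn (continuousOn_smul_sphere
    (continuousOn_hsD (p := p) hε hf₁ hf₂) hc)
  rw [← integral_const_mul, ← integral_const_mul]
  exact ⟨integral_mono (i1.const_mul _) i2 fun ζ => (hsD_bounds hp hε f₁ f₂ _).1,
    integral_mono i2 (i1.const_mul _) fun ζ => (hsD_bounds hp hε f₁ f₂ _).2⟩

lemma ofReal_hsM (hn : 1 ≤ n) {ε R : ℝ} (hε : 0 < ε) {f₁ f₂ : En n → ℂ}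
    (hf₁ : DifferentiableOn ℂ f₁ (ball 0 R)) (hf₂ : DifferentiableOn ℂ f₂ (ball 0 R)) {t : ℝ}
    (h0 : 0 ≤ t) (h1 : t < R) : ENNReal.ofReal (hsM p ε f₁ f₂ t) =
      ∫⁻ ζ, ENNReal.ofReal (hsW ε f₁ f₂ (t • ζ) ^ (p / 2)) ∂(sigmaS n) :=
  ofReal_integral_sigmaS hn (continuousOn_hsW_rpow hε hf₁ hf₂ _)
    (fun z _ => Real.rpow_nonneg (hsW_pos hε f₁ f₂ z).le _) h0 h1

/-- The integral in the Hardy–Stein identity as a lower integral. -/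
lemma ofReal_integral_hsDM (hn : 1 ≤ n) (hp : 0 < p) {ε R : ℝ} (hε : 0 < ε) {f₁ f₂ : En n → ℂ}
    (hf₁ : DifferentiableOn ℂ f₁ (ball 0 R)) (hf₂ : DifferentiableOn ℂ f₂ (ball 0 R)) {ρ r : ℝ}
    (h0 : 0 < ρ) (hr : ρ ≤ r) (h1 : r < R) :
    ENNReal.ofReal (∫ t in ρ..r, t⁻¹ * hsDM p ε f₁ f₂ t * Real.log (r / t)) =
      ∫⁻ t in Ioc ρ r, ENNReal.ofReal (t⁻¹ * hsDM p ε f₁ f₂ t * Real.log (r / t)) := by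
  have hr0 : r ≠ 0 := (h0.trans_le hr).ne'
  have hne : ∀ t ∈ Icc ρ r, t ≠ 0 := fun t ht => (h0.trans_le ht.1).ne'
  rw [intervalIntegral.integral_of_le hr, ofReal_integral_eq_lintegral_ofReal]
  · refine IntegrableOn.mono_set (ContinuousOn.integrableOn_Icc ?_) Ioc_subset_Icc_self
    exact ((continuousOn_id.inv₀ hne).mul ((continuousOn_hsDM hn hε hf₁ hf₂).mono
      fun t ht => ⟨h0.le.trans ht.1, ht.2.trans_lt h1⟩)).mul (ContinuousOn.log
        (continuousOn_const.div continuousOn_id hne) fun t ht => div_ne_zero hr0 (hne t ht))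
  · filter_upwards [ae_restrict_mem measurableSet_Ioc] with t ht
    have ht0 := h0.trans ht.1
    exact mul_nonneg (mul_nonneg (inv_nonneg.2 ht0.le) (hsDM_nonneg hp hε f₁ f₂ t))
      (Real.log_nonneg ((one_le_div ht0).2 ht.2))

/-- Upper Hardy–Stein estimate. -/
lemma exists_hardyStein_upper (hn : 1 ≤ n) (hp : 0 < p) : ∃ C : ℝ≥0∞, C ≠ ⊤ ∧
    ∀ f₁ f₂ : En n → ℂ, DifferentiableOn ℂ f₁ (Bn n) → DifferentiableOn ℂ f₂ (Bn n) →
    ∀ ε : ℝ, 0 < ε → ∀ r ∈ Ioo (3 / 4 : ℝ) 1,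
      ∫⁻ ζ, ENNReal.ofReal (hsW ε f₁ f₂ (r • ζ) ^ (p / 2)) ∂(sigmaS n) ≤
        C * (∫⁻ ζ, ENNReal.ofReal (hsW ε f₁ f₂ ((3 / 4 : ℝ) • ζ) ^ (p / 2)) ∂(sigmaS n)) +
        C * ∫⁻ z in shell n, ENNReal.ofReal
          (hsW ε f₁ f₂ z ^ (p / 2 - 1) * hsY f₁ f₂ z * (1 - ‖z‖ ^ 2)) ∂(volN n) := by
  obtain ⟨c, hc0, hct, hc⟩ := exists_shell_polar hn
  set B := max (p ^ 2) (2 * p) with hB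
  have hB0 : 0 < B := by positivity
  set L := 1 + Real.log 2 / Real.log (3 / 2) with hL
  have hl32 : 0 < Real.log (3 / 2) := Real.log_pos (by norm_num)
  have hl2 : 0 < Real.log 2 := Real.log_pos (by norm_num)
  refine ⟨ENNReal.ofReal L + ENNReal.ofReal (2 ^ (2 * n) * B * 2) * c⁻¹,
    ENNReal.add_ne_top.2 ⟨ENNReal.ofReal_ne_top, ENNReal.mul_ne_top ENNReal.ofReal_ne_top
      (ENNReal.inv_ne_top.2 hc0)⟩, fun f₁ f₂ hf₁ hf₂ ε hε r hr => ?_⟩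
  have hmono := monotoneOn_hsN (p := p) hn hp hε hf₁ hf₂
  have hM34 : hsN p ε f₁ f₂ (1 / 2) * Real.log (3 / 2) ≤ hsM p ε f₁ f₂ (3 / 4) := by
    have h := hsM_eq (p := p) hn hε hf₁ hf₂ (ρ := 1 / 2) (r := 3 / 4) (by norm_num) (by norm_num)
      (by norm_num)
    have h2 : 0 ≤ ∫ t in (1 / 2 : ℝ)..(3 / 4), t⁻¹ * hsDM p ε f₁ f₂ t *
        Real.log (3 / 4 / t) := by
      refine intervalIntegral.integral_nonneg (by norm_num) fun t ht => ?_
      have ht0 : (0 : ℝ) < t := lt_of_lt_of_le (by norm_num) ht.1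
      exact mul_nonneg (mul_nonneg (inv_nonneg.2 ht0.le) (hsDM_nonneg hp hε f₁ f₂ t))
        (Real.log_nonneg ((one_le_div ht0).2 ht.2))
    have h3 := hsM_nonneg (p := p) hε f₁ f₂ (1 / 2)
    norm_num at h h2 h3 ⊢
    linarith
  have hM12 : hsM p ε f₁ f₂ (1 / 2) ≤ hsM p ε f₁ f₂ (3 / 4) :=
    monotoneOn_hsM hn hp hε hf₁ hf₂ (by constructor <;> norm_num) (by constructor <;> norm_num)
      (by norm_num)
  have hN0 := hsN_nonneg (p := p) hn hp hε hf₁ hf₂ (t := 1 / 2) (by norm_num) (by norm_num)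
  have hlr : Real.log (r / (1 / 2)) ≤ Real.log 2 :=
    Real.log_le_log (by linarith [hr.1]) (by linarith [hr.2])
  have hkey := hsM_eq (p := p) hn hε hf₁ hf₂ (ρ := 1 / 2) (r := r) (by norm_num)
    (by linarith [hr.1]) hr.2
  have hreal : hsM p ε f₁ f₂ r ≤ L * hsM p ε f₁ f₂ (3 / 4) +
      ∫ t in (1 / 2 : ℝ)..r, t⁻¹ * hsDM p ε f₁ f₂ t * Real.log (r / t) := by
    rw [hkey]
    have h1 : hsN p ε f₁ f₂ (1 / 2) ≤ hsM p ε f₁ f₂ (3 / 4) / Real.log (3 / 2) :=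
      (le_div_iff₀ hl32).2 hM34
    have h2 : hsN p ε f₁ f₂ (1 / 2) * Real.log (r / (1 / 2)) ≤
        hsM p ε f₁ f₂ (3 / 4) / Real.log (3 / 2) * Real.log 2 := by
      calc _ ≤ hsN p ε f₁ f₂ (1 / 2) * Real.log 2 := by gcongr
        _ ≤ _ := by gcongr
    have h3 : L * hsM p ε f₁ f₂ (3 / 4) = hsM p ε f₁ f₂ (3 / 4) +
        hsM p ε f₁ f₂ (3 / 4) / Real.log (3 / 2) * Real.log 2 := by rw [hL]; ring
    linarith
  have hvol := hc (fun z => hsW ε f₁ f₂ z ^ (p / 2 - 1) * hsY f₁ f₂ z)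
    (continuousOn_hsW_mul_hsY hε hf₁ hf₂ _) fun z _ => mul_nonneg
      (Real.rpow_nonneg (hsW_pos hε f₁ f₂ z).le _) (hsY_nonneg f₁ f₂ z)
  have hint : ∫⁻ t in Ioc (1 / 2 : ℝ) r, ENNReal.ofReal
      (t⁻¹ * hsDM p ε f₁ f₂ t * Real.log (r / t)) ≤
      ENNReal.ofReal (2 ^ (2 * n) * B * 2) * ∫⁻ t in Ioo (1 / 2 : ℝ) 1, ENNReal.ofReal
        (t ^ (2 * n - 1) * (1 - t ^ 2) * ∫ ζ, (fun z => hsW ε f₁ f₂ z ^ (p / 2 - 1) *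
          hsY f₁ f₂ z) ((t : ℂ) • ζ) ∂(sigmaS n)) := by
    rw [← lintegral_const_mul' _ _ ENNReal.ofReal_ne_top]
    refine (setLIntegral_mono' measurableSet_Ioc fun t ht => ?_).trans
      (lintegral_mono_set fun t ht => ⟨ht.1, ht.2.trans_lt hr.2⟩)
    rw [← ENNReal.ofReal_mul (by positivity)]
    refine ENNReal.ofReal_le_ofReal ?_
    have ht0 : (0 : ℝ) < t := lt_trans (by norm_num) ht.1
    have ht1 : t < 1 := ht.2.trans_lt hr.2
    have hb := (hsDM_bounds hn hp hε hf₁ hf₂ ht0.le ht1).2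
    have hD := hsDM_nonneg hp hε f₁ f₂ t
    set e := ∫ ζ, (fun z => hsW ε f₁ f₂ z ^ (p / 2 - 1) * hsY f₁ f₂ z) ((t : ℂ) • ζ) ∂(sigmaS n)
    have hlog : Real.log (r / t) ≤ 2 * (1 - t ^ 2) := by
      have h1 : r / t ≤ 1 / t := by gcongr; exact hr.2.le
      have h2 := Real.log_le_sub_one_of_pos (div_pos (by linarith [hr.1] : (0 : ℝ) < r) ht0)
      have h3 : 1 / t ≤ 1 + 2 * (1 - t) := by
        rw [div_le_iff₀ ht0]; nlinarith [ht.1]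
      nlinarith
    have hlog0 : 0 ≤ Real.log (r / t) := Real.log_nonneg ((one_le_div ht0).2 ht.2)
    have hinv : t⁻¹ ≤ 2 ^ (2 * n) * t ^ (2 * n - 1) := by
      rw [inv_le_iff_one_le_mul₀ ht0, mul_assoc, ← pow_succ, Nat.sub_add_cancel (by omega),
        ← mul_pow]
      exact one_le_pow₀ (by linarith [ht.1])
    calc t⁻¹ * hsDM p ε f₁ f₂ t * Real.log (r / t)
        ≤ (2 ^ (2 * n) * t ^ (2 * n - 1)) * (B * e) * (2 * (1 - t ^ 2)) := by
          have := inv_nonneg.2 ht0.le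
          gcongr
          exact mul_nonneg (by positivity) (hD.trans hb)
      _ = _ := by ring
  rw [← ofReal_hsM hn hε hf₁ hf₂ (by linarith [hr.1]) hr.2,
    ← ofReal_hsM hn hε hf₁ hf₂ (by norm_num) (by norm_num), hvol]
  refine (ENNReal.ofReal_le_ofReal hreal).trans (ENNReal.ofReal_add_le.trans ?_)
  rw [ofReal_integral_hsDM hn hp hε hf₁ hf₂ (by norm_num) (by linarith [hr.1]) hr.2]
  refine add_le_add ?_ (hint.trans ?_)
  · rw [ENNReal.ofReal_mul (by positivity)]
    gcongr
    exact le_self_add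
  · rw [← mul_assoc, add_mul]
    rw [mul_assoc _ c⁻¹ c, ENNReal.inv_mul_cancel hc0 hct, mul_one]
    gcongr
    exact le_add_self

/-- Lower Hardy–Stein estimate. -/
lemma exists_hardyStein_lower (hn : 1 ≤ n) (hp : 0 < p) : ∃ C : ℝ≥0∞, C ≠ ⊤ ∧
    ∀ f₁ f₂ : En n → ℂ, DifferentiableOn ℂ f₁ (Bn n) → DifferentiableOn ℂ f₂ (Bn n) →
    ∀ ε : ℝ, 0 < ε → ∀ M : ℝ≥0∞, (∀ r ∈ Ioo (0 : ℝ) 1,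
      ∫⁻ ζ, ENNReal.ofReal (hsW ε f₁ f₂ (r • ζ) ^ (p / 2)) ∂(sigmaS n) ≤ M) →
      ∫⁻ z in shell n, ENNReal.ofReal
          (hsW ε f₁ f₂ z ^ (p / 2 - 1) * hsY f₁ f₂ z * (1 - ‖z‖ ^ 2)) ∂(volN n) ≤ C * M := by
  obtain ⟨c, hc0, hct, hc⟩ := exists_shell_polar hn
  set b := min (p ^ 2) (2 * p) with hb
  have hb0 : 0 < b := by positivity
  refine ⟨c * ENNReal.ofReal (2 / b), ENNReal.mul_ne_top hct ENNReal.ofReal_ne_top,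
    fun f₁ f₂ hf₁ hf₂ ε hε M hM => ?_⟩
  have hvol := hc (fun z => hsW ε f₁ f₂ z ^ (p / 2 - 1) * hsY f₁ f₂ z)
    (continuousOn_hsW_mul_hsY hε hf₁ hf₂ _) fun z _ => mul_nonneg
      (Real.rpow_nonneg (hsW_pos hε f₁ f₂ z).le _) (hsY_nonneg f₁ f₂ z)
  set G : ℝ → ℝ → ℝ≥0∞ := fun r t =>
    ENNReal.ofReal (t⁻¹ * hsDM p ε f₁ f₂ t * Real.log (r / t)) with hG
  have hGr : ∀ r ∈ Ioo (1 / 2 : ℝ) 1, ∫⁻ t in Ioo (1 / 2 : ℝ) 1, G r t ≤ M := by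
    intro r hr
    have hr0 : (0 : ℝ) < r := lt_trans (by norm_num) hr.1
    have h1 : ∫⁻ t in Ioo (1 / 2 : ℝ) 1, G r t ≤ ∫⁻ t in Ioc (1 / 2 : ℝ) r, G r t := by
      rw [← lintegral_indicator measurableSet_Ioo, ← lintegral_indicator measurableSet_Ioc]
      refine lintegral_mono fun t => indicator_le (fun t ht => ?_) t
      by_cases htr : t ≤ r
      · rw [indicator_of_mem (show t ∈ Ioc (1 / 2 : ℝ) r from ⟨ht.1, htr⟩)]
      · have ht0 : (0 : ℝ) < t := lt_trans (by norm_num) ht.1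
        rw [hG]
        simp only
        rw [ENNReal.ofReal_of_nonpos]
        · exact zero_le
        · exact mul_nonpos_of_nonneg_of_nonpos (mul_nonneg (inv_nonneg.2 ht0.le)
            (hsDM_nonneg hp hε f₁ f₂ t)) (Real.log_nonpos (div_nonneg hr0.le ht0.le)
              ((div_le_one ht0).2 (not_le.1 htr).le))
    refine h1.trans (le_trans ?_ (hM r ⟨hr0, hr.2⟩))
    rw [← ofReal_hsM hn hε hf₁ hf₂ hr0.le hr.2, ← ofReal_integral_hsDM hn hp hε hf₁ hf₂
      (by norm_num) hr.1.le hr.2]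
    refine ENNReal.ofReal_le_ofReal ?_
    rw [hsM_eq (p := p) hn hε hf₁ hf₂ (ρ := 1 / 2) (r := r) (by norm_num) hr.1.le hr.2]
    have h2 := hsM_nonneg (p := p) hε f₁ f₂ (1 / 2)
    have h3 := hsN_nonneg (p := p) hn hp hε hf₁ hf₂ (t := 1 / 2) (by norm_num) (by norm_num)
    have h4 : 0 ≤ Real.log (r / (1 / 2)) := Real.log_nonneg (by linarith [hr.1])
    have h5 := mul_nonneg h3 h4
    linarith
  have hG1 : ∫⁻ t in Ioo (1 / 2 : ℝ) 1, G 1 t ≤ M := by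
    set u : ℕ → ℝ := fun k => 1 - 1 / (k + 3) with hu
    have hu1 : ∀ k, u k ∈ Ioo (1 / 2 : ℝ) 1 := fun k => by
      have h3 : (0 : ℝ) < k + 3 := by positivity
      have h4 : 1 / ((k : ℝ) + 3) < 1 / 2 := by
        apply one_div_lt_one_div_of_lt (by norm_num)
        have : (0 : ℝ) ≤ k := k.cast_nonneg
        linarith
      have h5 : 0 < 1 / ((k : ℝ) + 3) := by positivity
      constructor <;> simp only [hu] <;> linarith
    have hulim : Tendsto u atTop (𝓝 1) := by
      have h3 : Tendsto (fun k : ℕ => 1 / ((k : ℝ) + 3)) atTop (𝓝 0) :=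
        tendsto_const_nhds.div_atTop (tendsto_atTop_add_const_right _ _ tendsto_natCast_atTop_atTop)
      simpa [hu] using h3.const_sub 1
    have hlim : ∀ t ∈ Ioo (1 / 2 : ℝ) 1, Tendsto (fun k => G (u k) t) atTop (𝓝 (G 1 t)) := by
      intro t ht
      have ht0 : (0 : ℝ) < t := lt_trans (by norm_num) ht.1
      refine (ENNReal.continuous_ofReal.tendsto _).comp (Tendsto.const_mul _ ?_)
      exact (Real.continuousAt_log (by positivity)).tendsto.comp (hulim.div_const t)
    calc ∫⁻ t in Ioo (1 / 2 : ℝ) 1, G 1 t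
        = ∫⁻ t in Ioo (1 / 2 : ℝ) 1, liminf (fun k => G (u k) t) atTop :=
          setLIntegral_congr_fun measurableSet_Ioo fun t ht => (hlim t ht).liminf_eq.symm
      _ ≤ liminf (fun k => ∫⁻ t in Ioo (1 / 2 : ℝ) 1, G (u k) t) atTop := by
          refine lintegral_liminf_le' fun k => ?_
          have hne : ∀ t ∈ Ioo (1 / 2 : ℝ) 1, t ≠ 0 := fun t ht =>
            (lt_trans (by norm_num) ht.1 : (0 : ℝ) < t).ne'
          have h0 : (0 : ℝ) < u k := lt_trans (by norm_num) (hu1 k).1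
          refine ContinuousOn.aemeasurable (ENNReal.continuous_ofReal.comp_continuousOn
            (((continuousOn_id.inv₀ hne).mul ((continuousOn_hsDM hn hε hf₁ hf₂).mono
            fun t ht => ⟨by linarith [ht.1], ht.2⟩)).mul (ContinuousOn.log
            (continuousOn_const.div continuousOn_id hne) fun t ht =>
              div_ne_zero h0.ne' (hne t ht)))) measurableSet_Ioo
      _ ≤ M := liminf_le_of_frequently_le' (Frequently.of_forall fun k => hGr _ (hu1 k))
  rw [hvol, mul_assoc]
  gcongr
  refine le_trans ?_ (mul_le_mul_right hG1 _)
  rw [← lintegral_const_mul' _ _ ENNReal.ofReal_ne_top]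
  refine setLIntegral_mono' measurableSet_Ioo fun t ht => ?_
  simp only [hG]
  rw [← ENNReal.ofReal_mul (by positivity)]
  refine ENNReal.ofReal_le_ofReal ?_
  have ht0 : (0 : ℝ) < t := lt_trans (by norm_num) ht.1
  have hbd := (hsDM_bounds hn hp hε hf₁ hf₂ ht0.le ht.2).1
  have he0 : 0 ≤ ∫ ζ, (fun z => hsW ε f₁ f₂ z ^ (p / 2 - 1) * hsY f₁ f₂ z) ((t : ℂ) • ζ)
      ∂(sigmaS n) := integral_nonneg fun ζ => mul_nonneg
        (Real.rpow_nonneg (hsW_pos hε f₁ f₂ _).le _) (hsY_nonneg f₁ f₂ _)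
  set e := ∫ ζ, (fun z => hsW ε f₁ f₂ z ^ (p / 2 - 1) * hsY f₁ f₂ z) ((t : ℂ) • ζ) ∂(sigmaS n)
  have hlog : (1 - t ^ 2) / 2 ≤ Real.log (1 / t) := by
    have h1 := Real.one_sub_inv_le_log_of_pos (x := 1 / t) (by positivity)
    rw [one_div, inv_inv] at h1
    rw [one_div]
    nlinarith [ht.2]
  have hpow : t ^ (2 * n - 1) ≤ t⁻¹ := (pow_le_one₀ ht0.le ht.2.le).trans
    ((one_le_inv₀ ht0).2 ht.2.le)
  have h6 : 0 ≤ (1 - t ^ 2) / 2 := by nlinarith [ht.2]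
  calc t ^ (2 * n - 1) * (1 - t ^ 2) * e
      = 2 / b * (t ^ (2 * n - 1) * (b * e) * ((1 - t ^ 2) / 2)) := by field_simp
    _ ≤ 2 / b * (t⁻¹ * hsDM p ε f₁ f₂ t * Real.log (1 / t)) := by
        have := inv_nonneg.2 ht0.le
        have := hsDM_nonneg hp hε f₁ f₂ t
        gcongr

/-- Integral means of holomorphic functions over spheres are increasing. -/
lemma lintegral_sphere_mono (hn : 1 ≤ n) (hp : 0 < p) {R : ℝ} {F : En n → ℂ}
    (hF : DifferentiableOn ℂ F (ball 0 R)) {s r : ℝ} (hs : 0 ≤ s) (hsr : s ≤ r) (hr : r < R) :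
    ∫⁻ ζ, ‖F (s • ζ)‖ₑ ^ p ∂(sigmaS n) ≤ ∫⁻ ζ, ‖F (r • ζ)‖ₑ ^ p ∂(sigmaS n) := by
  have := isProbabilityMeasure_sigmaS hn
  have hr0 := hs.trans hsr
  have hpow : ∀ w : ℂ, ‖w‖ₑ ^ p = ENNReal.ofReal ((‖w‖ ^ 2) ^ (p / 2)) := fun w => by
    rw [← ofReal_norm, ENNReal.ofReal_rpow_of_nonneg (norm_nonneg _) hp.le,
      ← Real.rpow_natCast, ← Real.rpow_mul (norm_nonneg _)]
    congr 2; push_cast; ring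
  have hle : ∀ ε > 0, ∫⁻ ζ, ‖F (s • ζ)‖ₑ ^ p ∂(sigmaS n) ≤ ENNReal.ofReal (hsM p ε F 0 r) := by
    intro ε hε
    refine le_trans ?_ (ENNReal.ofReal_le_ofReal (monotoneOn_hsM hn hp hε hF
      (differentiableOn_const 0) ⟨hs, hsr.trans_lt hr⟩ ⟨hr0, hr⟩ hsr))
    refine le_of_le_of_eq ?_
      (ofReal_hsM hn hε hF (differentiableOn_const 0) hs (hsr.trans_lt hr)).symm
    refine lintegral_mono fun ζ => ?_
    rw [hpow]
    refine ENNReal.ofReal_le_ofReal (Real.rpow_le_rpow (by positivity) ?_ (by positivity))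
    simp [hsW, hε.le]
  have hbound := (isCompact_closedBall (0 : En n) r).exists_bound_of_continuousOn
    (hF.continuousOn.mono (closedBall_subset_ball hr))
  obtain ⟨M, hM⟩ := hbound
  have hlim : Tendsto (fun ε => hsM p ε F 0 r) (𝓝[>] 0)
      (𝓝 (∫ ζ, (‖F ((r : ℂ) • ζ)‖ ^ 2) ^ (p / 2) ∂(sigmaS n))) := by
    refine tendsto_integral_filter_of_dominated_convergence (fun _ => (1 + M ^ 2) ^ (p / 2))
      ?_ ?_ (integrable_const _) ?_
    · filter_upwards [self_mem_nhdsWithin] with ε hε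
      exact aestronglyMeasurable_sigmaS (continuousOn_smul_sphere
        (continuousOn_hsW_rpow hε hF (differentiableOn_const 0) _) (norm_ofReal_lt hr0 hr))
    · filter_upwards [self_mem_nhdsWithin, nhdsWithin_le_nhds (gt_mem_nhds (zero_lt_one' ℝ))]
        with ε hε hε1
      filter_upwards [ae_sigmaS] with ζ hζ
      have h1 := hM ((r : ℂ) • ζ) (by
        rw [mem_closedBall_zero_iff, norm_smul_sphere hζ, Complex.norm_real,
          Real.norm_of_nonneg hr0])
      have h2 := hsW_pos hε F 0 ((r : ℂ) • ζ)
      rw [Real.norm_of_nonneg (Real.rpow_nonneg h2.le _)]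
      refine Real.rpow_le_rpow h2.le ?_ (by positivity)
      simp only [hsW, Pi.zero_apply, norm_zero]
      have : ‖F ((r : ℂ) • ζ)‖ ^ 2 ≤ M ^ 2 := by gcongr
      rw [zero_pow two_ne_zero, add_zero]
      linarith [hε1]
    · refine Eventually.of_forall fun ζ => ?_
      have h1 : Tendsto (fun ε : ℝ => hsW ε F 0 ((r : ℂ) • ζ)) (𝓝 0)
          (𝓝 (‖F ((r : ℂ) • ζ)‖ ^ 2)) := by
        have : Continuous fun ε : ℝ => hsW ε F 0 ((r : ℂ) • ζ) := by unfold hsW; fun_prop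
        simpa [hsW] using this.tendsto 0
      exact ((Real.continuousAt_rpow_const _ _ (Or.inr (by positivity))).tendsto.comp
        h1).mono_left nhdsWithin_le_nhds
  have h3 := ge_of_tendsto ((ENNReal.continuous_ofReal.tendsto _).comp hlim)
    (by filter_upwards [self_mem_nhdsWithin] with ε hε using hle ε hε)
  refine h3.trans (le_of_eq ?_)
  rw [ofReal_integral_sigmaS hn (φ := fun z => (‖F z‖ ^ 2) ^ (p / 2))
    ((hF.continuousOn.norm.pow 2).rpow_const fun z _ => Or.inr (by positivity))
    (fun z _ => by positivity) hr0 hr]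
  simp only [hpow]

end HardySteinVolume

section Growth

variable {n : ℕ}

lemma volN_univ : volN n univ = 1 := by
  rw [volN, Measure.smul_apply, Measure.restrict_apply_univ, smul_eq_mul]
  exact ENNReal.inv_mul_cancel (measure_ball_pos _ _ one_pos).ne' measure_ball_lt_top.ne

instance isProbabilityMeasure_volN : IsProbabilityMeasure (volN n) := ⟨volN_univ⟩

lemma ae_volN : ∀ᵐ z ∂(volN n), z ∈ Bn n :=
  Measure.ae_smul_measure (ae_restrict_mem measurableSet_ball) _

lemma lintegral_anis {τ : ℝ} (hτ : 0 < τ) {ξ : En n} (hξ : ‖ξ‖ = 1) {h : En n → ℝ≥0∞}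
    (hh : Measurable h) : ∫⁻ u, h (anis τ ξ u) = (ENNReal.ofReal (τ ^ (n + 1)))⁻¹ * ∫⁻ w, h w := by
  have hA : Measurable (anis τ ξ) :=
    (LinearMap.continuous_of_finiteDimensional (anis τ ξ)).measurable
  have h0 : ENNReal.ofReal (τ ^ (n + 1)) ≠ 0 := by
    rw [Ne, ENNReal.ofReal_eq_zero, not_le]; positivity
  have hmap : Measure.map (anis τ ξ) volume =
      (ENNReal.ofReal (τ ^ (n + 1)))⁻¹ • (volume : Measure (En n)) := by
    ext s hs
    rw [Measure.map_apply hA hs, Measure.smul_apply, smul_eq_mul, volume_preimage_anis hτ hξ s,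
      ← mul_assoc, ENNReal.inv_mul_cancel h0 ENNReal.ofReal_ne_top, one_mul]
  rw [← lintegral_map hh hA, hmap, lintegral_smul_measure, smul_eq_mul]

lemma enorm_rpow_continuousOn {f : En n → ℂ} {U : Set (En n)} (hf : ContinuousOn f U) (q : ℝ) :
    ContinuousOn (fun z => ‖f z‖ₑ ^ q) U :=
  (ENNReal.continuous_rpow_const (y := q)).comp_continuousOn hf.enorm

/-- The submean value property on the unit ball. -/
lemma enorm_rpow_le_lintegral_volN (hn : 1 ≤ n) {q : ℝ} (hq : 0 < q) {G : En n → ℂ}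
    (hG : DifferentiableOn ℂ G (Bn n)) : ‖G 0‖ₑ ^ q ≤ ∫⁻ u, ‖G u‖ₑ ^ q ∂(volN n) := by
  have := isProbabilityMeasure_sigmaS hn
  obtain ⟨c, hc0, hct, hc⟩ := exists_polar hn
  have h1 := hc (fun _ => ‖G 0‖ₑ ^ q) measurable_const
  have h2 := hc _ (measurable_indicator_of_continuousOn measurableSet_ball
    (enorm_rpow_continuousOn hG.continuousOn q))
  calc ‖G 0‖ₑ ^ q = ∫⁻ _, ‖G 0‖ₑ ^ q ∂(volN n) := by simp
    _ ≤ ∫⁻ z, (Bn n).indicator (fun z => ‖G z‖ₑ ^ q) z ∂(volN n) := by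
        rw [h1, Bn, h2]
        gcongr c * ?_
        refine setLIntegral_mono' measurableSet_Ioo fun t ht => ?_
        gcongr _ * ?_
        have h3 := lintegral_sphere_mono hn hq hG le_rfl ht.1.le ht.2
        simp only [zero_smul] at h3
        refine h3.trans (lintegral_mono_ae ?_)
        filter_upwards [ae_sigmaS] with ζ hζ
        have hm := mem_ball_smul_sphere (R := 1) hζ (norm_ofReal_lt ht.1.le ht.2)
        rw [Complex.coe_smul] at hm
        rw [indicator_of_mem hm]
    _ ≤ _ := lintegral_mono fun z => indicator_le_self _ _ z

lemma exists_growth (hn : 1 ≤ n) : ∃ C : ℝ≥0∞, C ≠ ⊤ ∧ ∀ q : ℝ, 0 < q → ∀ F : En n → ℂ,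
    ∀ R : ℝ, 1 < R → DifferentiableOn ℂ F (ball 0 R) → ∀ z ∈ Bn n,
      ENNReal.ofReal ((1 - ‖z‖ ^ 2) ^ n) * ‖F z‖ₑ ^ q ≤ C * ∫⁻ ζ, ‖F ζ‖ₑ ^ q ∂(sigmaS n) := by
  have := isProbabilityMeasure_sigmaS hn
  obtain ⟨c, hc0, hct, hc⟩ := exists_polar hn
  refine ⟨ENNReal.ofReal (8 ^ (n + 1) * 2) * c, ENNReal.mul_ne_top ENNReal.ofReal_ne_top hct,
    fun q hq F R hR hF z hz => ?_⟩
  rw [Bn, mem_ball_zero_iff] at hz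
  set ρ := 1 - ‖z‖ ^ 2 with hρ
  have hρ0 : 0 < ρ := by nlinarith [norm_nonneg z]
  have hρ1 : ρ ≤ 1 := by nlinarith [norm_nonneg z]
  set τ := ρ / 8 with hτ
  have hτ0 : 0 < τ := by positivity
  obtain ⟨ξ, hξ, hzξ⟩ : ∃ ξ : En n, ‖ξ‖ = 1 ∧ z = (‖z‖ : ℂ) • ξ := by
    rcases eq_or_ne z 0 with rfl | h0
    · have := nontrivial_En hn
      obtain ⟨ξ, hξ⟩ := exists_norm_eq (En n) zero_le_one
      exact ⟨ξ, hξ, by simp⟩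
    · have h1 : (‖z‖ : ℂ) ≠ 0 := by exact_mod_cast (norm_pos_iff.2 h0).ne'
      refine ⟨(‖z‖ : ℂ)⁻¹ • z, ?_, by rw [smul_smul, mul_inv_cancel₀ h1, one_smul]⟩
      rw [norm_smul, norm_inv, Complex.norm_real, norm_norm,
        inv_mul_cancel₀ (norm_pos_iff.2 h0).ne']
  set D : Set (En n) := {w | 1 - 2 * ρ < ‖w‖ ^ 2 ∧ ‖w‖ < 1} with hD
  have hDo : IsOpen D := (isOpen_lt continuous_const (continuous_norm.pow 2)).inter
    (isOpen_lt continuous_norm continuous_const)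
  have hmem : ∀ u ∈ Bn n, z + anis τ ξ u ∈ D := by
    intro u hu
    rw [Bn, mem_ball_zero_iff] at hu
    have h1 : ‖herm u ξ‖ ≤ 1 := by
      have := norm_herm_le u ξ
      rw [hξ, mul_one] at this; linarith
    have h2 := norm_anis_sq hτ0.le hξ u
    have h3 := norm_add_sq_herm (anis τ ξ u) z
    have h4 : |(herm (anis τ ξ u) z).re| ≤ τ := by
      refine (Complex.abs_re_le_norm _).trans ?_
      rw [hzξ, herm_smul_right, herm_anis hτ0.le hξ, norm_mul, norm_mul]
      simp only [Complex.conj_ofReal, Complex.norm_real, norm_norm, Real.norm_of_nonneg hτ0.le]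
      calc ‖z‖ * (τ * ‖herm u ξ‖) ≤ 1 * (τ * 1) := by gcongr
        _ = τ := by ring
    have h5 : ‖anis τ ξ u‖ ^ 2 ≤ τ := by
      rw [h2]
      have : τ ^ 2 - τ ≤ 0 := by nlinarith
      have h6 := mul_nonpos_of_nonpos_of_nonneg this (sq_nonneg ‖herm u ξ‖)
      have h7 : ‖u‖ ^ 2 ≤ 1 := pow_le_one₀ (norm_nonneg u) hu.le
      have h8 := mul_le_of_le_one_right hτ0.le h7
      linarith
    rw [abs_le] at h4
    rw [add_comm] at h3
    have h6 := sq_nonneg ‖anis τ ξ u‖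
    have h7 : ‖z + anis τ ξ u‖ ^ 2 ≤ ‖z‖ ^ 2 + 3 * τ := by linarith [h4.2]
    have h8 : ‖z‖ ^ 2 - 2 * τ ≤ ‖z + anis τ ξ u‖ ^ 2 := by linarith [h4.1]
    refine ⟨by linarith, ?_⟩
    have h9 : ‖z + anis τ ξ u‖ ^ 2 < 1 ^ 2 := by linarith
    exact lt_of_pow_lt_pow_left₀ 2 zero_le_one h9
  have hDB : D ⊆ ball 0 R := fun w hw => by
    rw [mem_ball_zero_iff]; linarith [hw.2]
  set h : En n → ℝ≥0∞ := D.indicator (fun w => ‖F w‖ₑ ^ q) with hh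
  have hhm : Measurable h := measurable_indicator_of_continuousOn hDo.measurableSet
    (enorm_rpow_continuousOn (hF.continuousOn.mono hDB) q)
  have hG : DifferentiableOn ℂ (fun u => F (z + anis τ ξ u)) (Bn n) := by
    have hA : Differentiable ℂ fun u => z + anis τ ξ u :=
      (differentiable_const z).add (LinearMap.toContinuousLinearMap (anis τ ξ)).differentiable
    exact hF.comp hA.differentiableOn fun u hu => hDB (hmem u hu)
  have hsub := enorm_rpow_le_lintegral_volN hn hq hG
  simp only [map_zero, add_zero] at hsub
  set M := ∫⁻ ζ, ‖F ζ‖ₑ ^ q ∂(sigmaS n) with hM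
  have hvB : volume (Bn n) ≠ 0 := (measure_ball_pos _ _ one_pos).ne'
  have hanis : ∫⁻ u, ‖F (z + anis τ ξ u)‖ₑ ^ q ∂(volN n) ≤
      (ENNReal.ofReal (τ ^ (n + 1)))⁻¹ * ∫⁻ w, h w ∂(volN n) := by
    rw [volN, lintegral_smul_measure, lintegral_smul_measure, smul_eq_mul, smul_eq_mul,
      mul_left_comm]
    gcongr _ * ?_
    calc ∫⁻ u in Bn n, ‖F (z + anis τ ξ u)‖ₑ ^ q
        ≤ ∫⁻ u in Bn n, h (z + anis τ ξ u) := by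
          refine setLIntegral_mono' measurableSet_ball fun u hu => ?_
          rw [hh, indicator_of_mem (hmem u hu)]
      _ ≤ ∫⁻ u, h (z + anis τ ξ u) := setLIntegral_le_lintegral _ _
      _ = (ENNReal.ofReal (τ ^ (n + 1)))⁻¹ * ∫⁻ w, h (z + w) :=
          lintegral_anis hτ0 hξ (h := fun w => h (z + w)) (hhm.comp (measurable_const_add z))
      _ = (ENNReal.ofReal (τ ^ (n + 1)))⁻¹ * ∫⁻ w, h w := by rw [lintegral_add_left_eq_self]
      _ = (ENNReal.ofReal (τ ^ (n + 1)))⁻¹ * ∫⁻ w in Bn n, h w := by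
          rw [← lintegral_indicator (show MeasurableSet (Bn n) from measurableSet_ball)]
          congr 2; ext w
          by_cases hw : w ∈ Bn n
          · rw [indicator_of_mem hw]
          · rw [indicator_of_notMem hw, hh, indicator_of_notMem]
            exact fun hwD => hw (mem_ball_zero_iff.2 hwD.2)
  have hslice : ∫⁻ w, h w ∂(volN n) ≤ c * (ENNReal.ofReal (2 * ρ) * M) := by
    rw [hc h hhm]
    gcongr c * ?_
    calc ∫⁻ t in Ioo (0 : ℝ) 1, ENNReal.ofReal (t ^ (2 * n - 1)) * ∫⁻ ζ, h (t • ζ) ∂(sigmaS n)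
        ≤ ∫⁻ t in Ioo (0 : ℝ) 1, (Ioo (1 - 2 * ρ) 1).indicator (fun _ => M) t := by
          refine setLIntegral_mono' measurableSet_Ioo fun t ht => ?_
          have h1 : ENNReal.ofReal (t ^ (2 * n - 1)) ≤ 1 := by
            rw [ENNReal.ofReal_le_one]; exact pow_le_one₀ ht.1.le ht.2.le
          refine (mul_le_of_le_one_left' h1).trans ?_
          by_cases ht' : t ∈ Ioo (1 - 2 * ρ) 1
          · rw [indicator_of_mem ht']
            have h2 := lintegral_sphere_mono hn hq hF ht.1.le ht.2.le hR
            simp only [one_smul] at h2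
            exact (lintegral_mono fun ζ => indicator_le_self _ _ _).trans h2
          · rw [indicator_of_notMem ht']
            refine le_of_eq ?_
            rw [← lintegral_zero (μ := sigmaS n)]
            refine lintegral_congr_ae ?_
            filter_upwards [ae_sigmaS] with ζ hζ
            refine indicator_of_notMem (fun hm => ht' ?_) _
            have h3 : ‖t • ζ‖ = t := by
              rw [norm_smul, mem_sphere_zero_iff_norm.1 hζ, mul_one, Real.norm_of_nonneg ht.1.le]
            rw [hD, mem_ofPred_eq, h3] at hm
            exact ⟨by nlinarith [hm.1, ht.1, ht.2], ht.2⟩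
      _ ≤ ∫⁻ t, (Ioo (1 - 2 * ρ) 1).indicator (fun _ => M) t := setLIntegral_le_lintegral _ _
      _ = ENNReal.ofReal (2 * ρ) * M := by
          rw [lintegral_indicator_const measurableSet_Ioo, Real.volume_Ioo, mul_comm]
          congr 2; ring
  have hτne : ENNReal.ofReal (τ ^ (n + 1)) ≠ 0 := by
    rw [Ne, ENNReal.ofReal_eq_zero, not_le]; positivity
  have hconst : ENNReal.ofReal (ρ ^ n) * (ENNReal.ofReal (τ ^ (n + 1)))⁻¹ * ENNReal.ofReal (2 * ρ)
      = ENNReal.ofReal (8 ^ (n + 1) * 2) := by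
    rw [← ENNReal.ofReal_inv_of_pos (by positivity), ← ENNReal.ofReal_mul (by positivity),
      ← ENNReal.ofReal_mul (by positivity)]
    congr 1
    rw [hτ, div_pow, pow_succ ρ]
    field_simp
  calc ENNReal.ofReal (ρ ^ n) * ‖F z‖ₑ ^ q
      ≤ ENNReal.ofReal (ρ ^ n) * ((ENNReal.ofReal (τ ^ (n + 1)))⁻¹ *
          (c * (ENNReal.ofReal (2 * ρ) * M))) := by
        gcongr
        exact hsub.trans (hanis.trans (by gcongr))
    _ = ENNReal.ofReal (ρ ^ n) * (ENNReal.ofReal (τ ^ (n + 1)))⁻¹ * ENNReal.ofReal (2 * ρ) *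
          c * M := by ring
    _ = _ := by rw [hconst]

/-- The test function `((1 - |a|²)ⁿ / (1 - ⟨w, a⟩)²ⁿ) ^ (1 / q)`. -/
def testFn (q : ℝ) (a w : En n) : ℂ :=
  (((1 - ‖a‖ ^ 2) ^ (n / q) : ℝ) : ℂ) * (1 - herm w a) ^ (((-(2 * n / q) : ℝ)) : ℂ)

/-- The kernel `(1 - |x|²)ⁿ / |1 - ⟨s, x⟩|²ⁿ`. -/
def kerQ (s x : En n) : ℝ := (1 - ‖x‖ ^ 2) ^ n / dI s x ^ (2 * n)

lemma kerQ_nonneg (s : En n) {x : En n} (hx : ‖x‖ ≤ 1) : 0 ≤ kerQ s x := by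
  have : 0 ≤ 1 - ‖x‖ ^ 2 := by nlinarith [norm_nonneg x]
  unfold kerQ
  have := dI_nonneg s x
  positivity

lemma re_one_sub_herm_pos {w a : En n} (h : ‖w‖ * ‖a‖ < 1) : 0 < (1 - herm w a).re := by
  have h1 := (Complex.abs_re_le_norm (herm w a)).trans (norm_herm_le w a)
  rw [abs_le] at h1
  rw [Complex.sub_re, Complex.one_re]
  linarith [h1.2]

lemma enorm_testFn_rpow {q : ℝ} (hq : 0 < q) {a w : En n} (ha : ‖a‖ < 1) :
    ‖testFn q a w‖ₑ ^ q = ENNReal.ofReal (kerQ w a) := by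
  have h0 : 0 ≤ 1 - ‖a‖ ^ 2 := by nlinarith [norm_nonneg a]
  rw [← ofReal_norm, ENNReal.ofReal_rpow_of_nonneg (norm_nonneg _) hq.le, testFn,
    norm_mul, Complex.norm_cpow_real, Complex.norm_real,
    Real.norm_of_nonneg (Real.rpow_nonneg h0 _), Real.mul_rpow (Real.rpow_nonneg h0 _)
      (Real.rpow_nonneg (norm_nonneg _) _), ← Real.rpow_mul h0, ← Real.rpow_mul (norm_nonneg _),
    div_mul_cancel₀ _ hq.ne', neg_mul, div_mul_cancel₀ _ hq.ne', Real.rpow_neg (norm_nonneg _)]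
  congr 1
  rw [kerQ, dI, div_eq_mul_inv]
  norm_cast

lemma differentiableOn_testFn {q : ℝ} (a : En n) {R : ℝ} (hR : R * ‖a‖ ≤ 1) :
    DifferentiableOn ℂ (testFn q a) (ball 0 R) := by
  have h1 : Differentiable ℂ fun w : En n => 1 - herm w a := by
    simp only [herm_eq_inner]
    exact (differentiable_const _).sub (innerSL ℂ a).differentiable
  refine DifferentiableOn.const_mul ?_ _
  intro w hw
  rw [mem_ball_zero_iff] at hw
  have h2 : ‖w‖ * ‖a‖ < 1 := by
    rcases (norm_nonneg a).eq_or_lt with h | h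
    · rw [← h]; simp
    · exact (mul_lt_mul_of_pos_right hw h).trans_le hR
  exact ((h1 w).cpow_const (Or.inl (re_one_sub_herm_pos h2))).differentiableWithinAt

/-- Powers of holomorphic functions are dominated by a multiple of their Poisson integrals. -/
lemma exists_subPoisson (hn : 1 ≤ n) : ∃ C : ℝ≥0∞, C ≠ ⊤ ∧ ∀ q : ℝ, 0 < q → ∀ f : En n → ℂ,
    DifferentiableOn ℂ f (Bn n) → ∀ r ∈ Ioo (0 : ℝ) 1, ∀ z ∈ Bn n,
      ‖f (r • z)‖ₑ ^ q ≤
        C * ∫⁻ ζ, ENNReal.ofReal (kerQ ζ z) * ‖f (r • ζ)‖ₑ ^ q ∂(sigmaS n) := by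
  obtain ⟨C, hC, h⟩ := exists_growth hn
  refine ⟨C, hC, fun q hq f hf r hr z hz => ?_⟩
  have hz1 : ‖z‖ < 1 := mem_ball_zero_iff.1 hz
  set m := max r ‖z‖ with hm
  have hm0 : 0 < m := lt_max_of_lt_left hr.1
  have hm1 : m < 1 := max_lt hr.2 hz1
  have hF : DifferentiableOn ℂ (fun w => f (r • w) * testFn q z w) (ball 0 m⁻¹) := by
    refine DifferentiableOn.mul ?_ (differentiableOn_testFn z ?_)
    · refine hf.comp (g := f) (f := fun w => r • w) ((differentiable_id.const_smul r).differentiableOn) fun w hw => ?_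
      rw [mem_ball_zero_iff] at hw
      rw [Bn, mem_ball_zero_iff, norm_smul, Real.norm_of_nonneg hr.1.le]
      calc r * ‖w‖ < r * m⁻¹ := by gcongr; exact hr.1
        _ ≤ m * m⁻¹ := by gcongr; exact le_max_left _ _
        _ = 1 := mul_inv_cancel₀ hm0.ne'
    · rw [inv_mul_le_one₀ hm0]; exact le_max_right _ _
  have h1 := h q hq _ _ ((one_lt_inv₀ hm0).2 hm1) hF z hz
  have hρ : 0 < 1 - ‖z‖ ^ 2 := by nlinarith [norm_nonneg z]
  have hQ : ENNReal.ofReal ((1 - ‖z‖ ^ 2) ^ n) * ENNReal.ofReal (kerQ z z) = 1 := by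
    rw [← ENNReal.ofReal_mul (by positivity)]
    have : (1 - ‖z‖ ^ 2) ^ n * kerQ z z = 1 := by
      have hd : dI z z = 1 - ‖z‖ ^ 2 := by
        rw [dI, herm_self]
        have : (1 : ℂ) - ((‖z‖ : ℂ)) ^ 2 = ((1 - ‖z‖ ^ 2 : ℝ) : ℂ) := by push_cast; ring
        norm_cast
        rw [Real.norm_of_nonneg hρ.le]
      rw [kerQ, hd, two_mul, pow_add]
      field_simp
    rw [this, ENNReal.ofReal_one]
  simp only [enorm_mul, ENNReal.mul_rpow_of_nonneg _ _ hq.le, enorm_testFn_rpow hq hz1] at h1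
  calc ‖f (r • z)‖ₑ ^ q = ENNReal.ofReal ((1 - ‖z‖ ^ 2) ^ n) * (‖f (r • z)‖ₑ ^ q *
        ENNReal.ofReal (kerQ z z)) := by rw [mul_left_comm, hQ, mul_one]
    _ ≤ _ := h1
    _ = _ := by simp only [mul_comm]

end Growth

section Carleson

lemma lintegral_mul_sq_le {α : Type*} [MeasurableSpace α] (μ : Measure α) {f g : α → ℝ≥0∞}
    (hf : AEMeasurable f μ) (hg : AEMeasurable g μ) :
    (∫⁻ x, f x * g x ∂μ) ^ 2 ≤ (∫⁻ x, f x ^ 2 ∂μ) * ∫⁻ x, g x ^ 2 ∂μ := by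
  have h := ENNReal.lintegral_mul_le_Lp_mul_Lq μ Real.HolderConjugate.two_two hf hg
  simp only [Pi.mul_apply, ENNReal.rpow_two] at h
  calc (∫⁻ x, f x * g x ∂μ) ^ 2
      ≤ ((∫⁻ x, f x ^ 2 ∂μ) ^ (1 / 2 : ℝ) * (∫⁻ x, g x ^ 2 ∂μ) ^ (1 / 2 : ℝ)) ^ 2 := by gcongr
    _ = _ := by
      rw [mul_pow, ← ENNReal.rpow_two, ← ENNReal.rpow_two, ← ENNReal.rpow_mul, ← ENNReal.rpow_mul]
      norm_num

lemma le_of_sq_le_mul {a b : ℝ≥0∞} (ha : a ≠ ⊤) (h : a ^ 2 ≤ b * a) : a ≤ b := by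
  rcases eq_or_ne a 0 with h0 | h0
  · simp [h0]
  · rw [pow_two] at h
    exact (ENNReal.mul_le_mul_iff_left h0 ha).1 h

/-- The square of an integral operator, controlled by the composition of its kernel. -/
lemma lintegral_kernel_sq_le {α : Type*} [MeasurableSpace α] {μ ν : Measure α} [SFinite μ]
    [SFinite ν] {Q : α → α → ℝ≥0∞} (hQ : Measurable (Function.uncurry Q)) {u : α → ℝ≥0∞}
    (hu : Measurable u) {A : ℝ≥0∞} {B : Set α} (hB : ∀ᵐ x ∂μ, x ∈ B)
    (hQQ : ∀ x ∈ B, ∀ t ∈ B, ∫⁻ s, Q s x * Q s t ∂ν ≤ A * (Q x t + Q t x)) :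
    ∫⁻ s, (∫⁻ x, Q s x * u x ∂μ) ^ 2 ∂ν ≤
      2 * A * ∫⁻ x, ∫⁻ t, Q x t * (u x * u t) ∂μ ∂μ := by
  have hm {γ : Type _} [MeasurableSpace γ] {a b : γ → α} (ha : Measurable a) (hb : Measurable b) :
      Measurable fun c => Q (a c) (b c) := hQ.comp (ha.prodMk hb)
  have e1 : ∀ s, (∫⁻ x, Q s x * u x ∂μ) ^ 2 =
      ∫⁻ x, ∫⁻ t, Q s x * u x * (Q s t * u t) ∂μ ∂μ := by
    intro s
    have h1 : Measurable fun x => Q s x * u x := (hm measurable_const measurable_id).mul hu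
    rw [pow_two, ← lintegral_mul_const _ h1]
    exact lintegral_congr fun x => (lintegral_const_mul _ h1).symm
  have hI : ∫⁻ x, ∫⁻ t, Q t x * (u x * u t) ∂μ ∂μ = ∫⁻ x, ∫⁻ t, Q x t * (u x * u t) ∂μ ∂μ := by
    rw [lintegral_lintegral_swap]
    · exact lintegral_congr fun x => lintegral_congr fun t => by rw [mul_comm (u t)]
    · exact ((hm measurable_snd measurable_fst).mul
        ((hu.comp measurable_fst).mul (hu.comp measurable_snd))).aemeasurable
  have m3 : Measurable fun q : α × α × α => Q q.1 q.2.1 * u q.2.1 * (Q q.1 q.2.2 * u q.2.2) := by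
    refine Measurable.mul (Measurable.mul ?_ ?_) (Measurable.mul ?_ ?_)
    · exact hm (by fun_prop) (by fun_prop)
    · exact hu.comp (by fun_prop)
    · exact hm (by fun_prop) (by fun_prop)
    · exact hu.comp (by fun_prop)
  calc ∫⁻ s, (∫⁻ x, Q s x * u x ∂μ) ^ 2 ∂ν
      = ∫⁻ s, ∫⁻ x, ∫⁻ t, Q s x * u x * (Q s t * u t) ∂μ ∂μ ∂ν := lintegral_congr e1
    _ = ∫⁻ x, ∫⁻ s, ∫⁻ t, Q s x * u x * (Q s t * u t) ∂μ ∂ν ∂μ := by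
      refine lintegral_lintegral_swap (Measurable.aemeasurable ?_)
      exact Measurable.lintegral_prod_right'
        (f := fun q : (α × α) × α => Q q.1.1 q.1.2 * u q.1.2 * (Q q.1.1 q.2 * u q.2))
        (m3.comp (g := fun q : α × α × α => Q q.1 q.2.1 * u q.2.1 * (Q q.1 q.2.2 * u q.2.2))
          (f := fun q : (α × α) × α => (q.1.1, q.1.2, q.2)) (by fun_prop))
    _ = ∫⁻ x, ∫⁻ t, ∫⁻ s, Q s x * u x * (Q s t * u t) ∂ν ∂μ ∂μ := by
      refine lintegral_congr fun x => lintegral_lintegral_swap (Measurable.aemeasurable ?_)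
      exact m3.comp (g := fun q : α × α × α => Q q.1 q.2.1 * u q.2.1 * (Q q.1 q.2.2 * u q.2.2))
          (f := fun q : α × α => (q.1, x, q.2)) (by fun_prop)
    _ ≤ ∫⁻ x, ∫⁻ t, A * (Q x t * (u x * u t) + Q t x * (u x * u t)) ∂μ ∂μ := by
      refine lintegral_mono_ae ?_
      filter_upwards [hB] with x hx
      refine lintegral_mono_ae ?_
      filter_upwards [hB] with t ht
      calc ∫⁻ s, Q s x * u x * (Q s t * u t) ∂ν
          = ∫⁻ s, (u x * u t) * (Q s x * Q s t) ∂ν := lintegral_congr fun s => by ring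
        _ = (u x * u t) * ∫⁻ s, Q s x * Q s t ∂ν := lintegral_const_mul _
            ((hm measurable_id measurable_const).mul (hm measurable_id measurable_const))
        _ ≤ (u x * u t) * (A * (Q x t + Q t x)) := by gcongr; exact hQQ x hx t ht
        _ = _ := by ring
    _ = 2 * A * ∫⁻ x, ∫⁻ t, Q x t * (u x * u t) ∂μ ∂μ := by
      have m2 : Measurable fun q : α × α => Q q.1 q.2 * (u q.1 * u q.2) :=
        (hm measurable_fst measurable_snd).mul
          ((hu.comp measurable_fst).mul (hu.comp measurable_snd))
      have m2' : Measurable fun q : α × α => Q q.2 q.1 * (u q.1 * u q.2) :=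
        (hm measurable_snd measurable_fst).mul
          ((hu.comp measurable_fst).mul (hu.comp measurable_snd))
      have e2 : ∀ x, ∫⁻ t, A * (Q x t * (u x * u t) + Q t x * (u x * u t)) ∂μ =
          A * (∫⁻ t, Q x t * (u x * u t) ∂μ + ∫⁻ t, Q t x * (u x * u t) ∂μ) := by
        intro x
        have a1 : Measurable fun t => Q x t * (u x * u t) := m2.comp measurable_prodMk_left
        have a2 : Measurable fun t => Q t x * (u x * u t) := m2'.comp measurable_prodMk_left
        rw [← lintegral_add_left a1]
        exact lintegral_const_mul A (a1.add a2)
      simp only [e2]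
      have b1 : Measurable fun x => ∫⁻ t, Q x t * (u x * u t) ∂μ := m2.lintegral_prod_right'
      have b2 : Measurable fun x => ∫⁻ t, Q t x * (u x * u t) ∂μ := m2'.lintegral_prod_right'
      refine (lintegral_const_mul A (b1.add b2)).trans ?_
      simp only [Pi.add_apply]
      rw [lintegral_add_left b1, hI]
      ring

variable {n : ℕ}

lemma measurable_kerQ : Measurable fun q : En n × En n => kerQ q.1 q.2 := by
  unfold kerQ
  refine Measurable.div ?_ ?_
  · fun_prop
  · refine Continuous.measurable ?_
    unfold dI; simp only [herm_eq_inner]; fun_prop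

/-- Composition estimate for the kernel `kerQ` against a Carleson measure. -/
lemma lintegral_kerQ_mul_kerQ_le (hn : 1 ≤ n) {ν : Measure (En n)} (hν : ∀ᵐ s ∂ν, ‖s‖ ≤ 1)
    {K : ℝ≥0∞} (hK : ∀ ζ ∈ Sn n, ∀ δ > (0 : ℝ), ν {s | dI s ζ < δ} ≤ K * ENNReal.ofReal (δ ^ n))
    {x t : En n} (hx : x ∈ Bn n) (ht : t ∈ Bn n) :
    ∫⁻ s, ENNReal.ofReal (kerQ s x) * ENNReal.ofReal (kerQ s t) ∂ν ≤
      ENNReal.ofReal (36 ^ n * (2 * 8 ^ n)) * K *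
        (ENNReal.ofReal (kerQ x t) + ENNReal.ofReal (kerQ t x)) := by
  rw [Bn, mem_ball_zero_iff] at hx ht
  have hpt : ∀ s : En n, ‖s‖ ≤ 1 → kerQ s x * kerQ s t ≤
      36 ^ n * kerQ t x * kerQ s t + 36 ^ n * kerQ x t * kerQ s x := by
    intro s hs
    have d1 : 0 < dI x t := dI_pos hx ht.le
    have d2 : 0 < dI s x := by rw [dI_comm]; exact dI_pos hx hs
    have d3 : 0 < dI s t := by rw [dI_comm]; exact dI_pos ht hs
    have htri := dI_triangle (x := x) (s := s) (t := t) hx.le hs ht.le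
    have k1 := kerQ_nonneg (n := n) s hx.le
    have k2 := kerQ_nonneg (n := n) s ht.le
    have k3 := kerQ_nonneg (n := n) t hx.le
    have k4 := kerQ_nonneg (n := n) x ht.le
    have hcmp : ∀ y w : En n, ‖y‖ ≤ 1 → 0 < dI w y → 0 < dI s y → dI w y ≤ 6 * dI s y →
        kerQ s y ≤ 36 ^ n * kerQ w y := by
      intro y w hy h1 h2 h
      have h0 : 0 ≤ 1 - ‖y‖ ^ 2 := by nlinarith [norm_nonneg y]
      unfold kerQ
      rw [← mul_div_assoc, div_le_div_iff₀ (by positivity) (by positivity), mul_comm (36 ^ n),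
        mul_assoc]
      gcongr
      calc dI w y ^ (2 * n) ≤ (6 * dI s y) ^ (2 * n) := by gcongr
        _ = 36 ^ n * dI s y ^ (2 * n) := by rw [mul_pow, pow_mul 6]; norm_num
    rcases le_total (dI x t) (6 * dI s x) with h | h
    · have := hcmp x t hx.le (by rwa [dI_comm]) d2 (by rwa [dI_comm t x])
      have h' := mul_le_mul_of_nonneg_right this k2
      have : 0 ≤ 36 ^ n * kerQ x t * kerQ s x := by positivity
      linarith
    · have := hcmp t x ht.le d1 d3 (by rw [dI_comm x s] at htri; linarith)
      have h' := mul_le_mul_of_nonneg_right this k1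
      have : 0 ≤ 36 ^ n * kerQ t x * kerQ s t := by positivity
      linarith
  have m1 : ∀ y : En n, Measurable fun s : En n => ENNReal.ofReal (kerQ s y) := fun y =>
    (measurable_kerQ.comp (measurable_id.prodMk measurable_const)).ennreal_ofReal
  calc ∫⁻ s, ENNReal.ofReal (kerQ s x) * ENNReal.ofReal (kerQ s t) ∂ν
      ≤ ∫⁻ s, (ENNReal.ofReal (36 ^ n * kerQ t x) * ENNReal.ofReal (kerQ s t) +
          ENNReal.ofReal (36 ^ n * kerQ x t) * ENNReal.ofReal (kerQ s x)) ∂ν := by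
        refine lintegral_mono_ae ?_
        filter_upwards [hν] with s hs
        have k1 := kerQ_nonneg (n := n) s hx.le
        have k2 := kerQ_nonneg (n := n) s ht.le
        have k3 := kerQ_nonneg (n := n) t hx.le
        have k4 := kerQ_nonneg (n := n) x ht.le
        rw [← ENNReal.ofReal_mul k1, ← ENNReal.ofReal_mul (by positivity),
          ← ENNReal.ofReal_mul (by positivity), ← ENNReal.ofReal_add (by positivity) (by positivity)]
        exact ENNReal.ofReal_le_ofReal (hpt s hs)
    _ = ENNReal.ofReal (36 ^ n * kerQ t x) * ∫⁻ s, ENNReal.ofReal (kerQ s t) ∂ν +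
          ENNReal.ofReal (36 ^ n * kerQ x t) * ∫⁻ s, ENNReal.ofReal (kerQ s x) ∂ν := by
        rw [lintegral_add_left ((m1 t).const_mul _), lintegral_const_mul _ (m1 t),
          lintegral_const_mul _ (m1 x)]
    _ ≤ ENNReal.ofReal (36 ^ n * kerQ t x) * (ENNReal.ofReal (2 * 8 ^ n) * K) +
          ENNReal.ofReal (36 ^ n * kerQ x t) * (ENNReal.ofReal (2 * 8 ^ n) * K) := by
        gcongr
        · exact lintegral_kernel_le hn hν hK ht
        · exact lintegral_kernel_le hn hν hK hx
    _ = _ := by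
        simp only [ENNReal.ofReal_mul (p := (36 : ℝ) ^ n) (by positivity)]
        ring

/-- `L²` Carleson embedding for Poisson integrals. -/
lemma exists_lintegral_poisson_sq_le (hn : 1 ≤ n) : ∃ C : ℝ≥0∞, C ≠ ⊤ ∧
    ∀ μ : Measure (En n), ∀ K : ℝ≥0∞, K ≠ ⊤ → (∀ᵐ s ∂μ, s ∈ Bn n) →
      (∀ ζ ∈ Sn n, ∀ δ > (0 : ℝ), μ {s | dI s ζ < δ} ≤ K * ENNReal.ofReal (δ ^ n)) →
      ∀ φ : En n → ℝ≥0∞, Measurable φ →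
        ∫⁻ z, (∫⁻ ζ, ENNReal.ofReal (kerQ ζ z) * φ ζ ∂(sigmaS n)) ^ 2 ∂μ ≤
          C * K * ∫⁻ ζ, φ ζ ^ 2 ∂(sigmaS n) := by
  obtain ⟨C₀, hC₀, hcap⟩ := exists_sigmaS_cap_le hn
  have := isProbabilityMeasure_sigmaS hn
  have := nontrivial_En hn
  set c := ENNReal.ofReal (36 ^ n * (2 * 8 ^ n)) with hc
  have hct : c ≠ ⊤ := ENNReal.ofReal_ne_top
  refine ⟨2 * (c * C₀) * (2 * c), by finiteness, fun μ K hK hμ hμK φ hφ => ?_⟩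
  obtain ⟨e, he⟩ : ∃ e : En n, ‖e‖ = 1 := exists_norm_eq _ zero_le_one
  have hfin : IsFiniteMeasure μ := by
    refine ⟨?_⟩
    have h1 := hμK e (by simpa [Sn] using he) 3 (by norm_num)
    have h2 : μ univ ≤ μ {s | dI s e < 3} := by
      refine measure_mono_ae ?_
      filter_upwards [hμ] with s hs _
      have hs' : ‖s‖ < 1 := mem_ball_zero_iff.1 hs
      exact (dI_le_two hs'.le he.le).trans_lt (by norm_num)
    exact (h2.trans h1).trans_lt (ENNReal.mul_lt_top hK.lt_top ENNReal.ofReal_lt_top)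
  set Q : En n → En n → ℝ≥0∞ := fun s x => ENNReal.ofReal (kerQ s x) with hQdef
  have hQ : Measurable (Function.uncurry Q) := measurable_kerQ.ennreal_ofReal
  set T : En n → ℝ≥0∞ := fun z => ∫⁻ ζ, Q ζ z * φ ζ ∂(sigmaS n) with hT
  have hTm : Measurable T := by
    refine Measurable.lintegral_prod_right' (f := fun q : En n × En n => Q q.2 q.1 * φ q.2) ?_
    exact (hQ.comp measurable_swap).mul (hφ.comp measurable_snd)
  set ρ : ℕ → ℝ := fun N => 1 - 1 / ((N : ℝ) + 1) with hρ
  set u : ℕ → En n → ℝ≥0∞ := fun N => (ball (0 : En n) (ρ N)).indicator fun z => min (T z) N with hu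
  have hum : ∀ N, Measurable (u N) := fun N =>
    (hTm.min measurable_const).indicator measurableSet_ball
  have huT : ∀ N z, u N z ≤ T z := fun N z => by
    by_cases hz : z ∈ ball (0 : En n) (ρ N)
    · rw [hu]; simp only [indicator_of_mem hz]; exact min_le_left _ _
    · rw [hu]; simp only [indicator_of_notMem hz]; exact zero_le
  have huN : ∀ N z, u N z ≤ N := fun N z => by
    by_cases hz : z ∈ ball (0 : En n) (ρ N)
    · rw [hu]; simp only [indicator_of_mem hz]; exact min_le_right _ _
    · rw [hu]; simp only [indicator_of_notMem hz]; exact zero_le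
  have hσ1 : ∀ᵐ s ∂(sigmaS n), ‖s‖ ≤ 1 := by
    filter_upwards [ae_sigmaS (n := n)] with s hs
    exact (mem_sphere_zero_iff_norm.1 hs).le
  have hμ1 : ∀ᵐ s ∂μ, ‖s‖ ≤ 1 := by
    filter_upwards [hμ] with s hs
    exact (mem_ball_zero_iff.1 hs).le
  have key : ∀ N, ∫⁻ z, u N z ^ 2 ∂μ ≤
      2 * (c * C₀) * (2 * c) * K * ∫⁻ ζ, φ ζ ^ 2 ∂(sigmaS n) := by
    intro N
    set I := ∫⁻ x, ∫⁻ t, Q x t * (u N x * u N t) ∂μ ∂μ with hI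
    have hIfin : I ≠ ⊤ := by
      have hb : ∀ᵐ x ∂μ, ∀ t, Q x t * (u N x * u N t) ≤
          ENNReal.ofReal (((N : ℝ) + 1) ^ (2 * n)) * (N * N) := by
        filter_upwards [hμ1] with x hx t
        by_cases ht : t ∈ ball (0 : En n) (ρ N)
        · gcongr
          · rw [mem_ball_zero_iff] at ht
            refine ENNReal.ofReal_le_ofReal ?_
            have hN : (0 : ℝ) < 1 / ((N : ℝ) + 1) := by positivity
            have h1 : 1 / ((N : ℝ) + 1) ≤ dI x t := by
              rw [dI_comm]
              refine le_trans ?_ (one_sub_norm_le_dI (y := x) hx)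
              simp only [hρ] at ht; linarith
            have ht1 : ‖t‖ < 1 := by simp only [hρ] at ht; linarith
            have h0 : 0 ≤ 1 - ‖t‖ ^ 2 := by nlinarith [norm_nonneg t]
            have h3 : (1 - ‖t‖ ^ 2) ^ n ≤ 1 := pow_le_one₀ h0 (by nlinarith [norm_nonneg t])
            unfold kerQ
            calc (1 - ‖t‖ ^ 2) ^ n / dI x t ^ (2 * n)
                ≤ 1 / (1 / ((N : ℝ) + 1)) ^ (2 * n) := by gcongr
              _ = _ := by rw [one_div_pow, one_div_one_div]
          · exact huN N x
          · exact huN N t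
        · rw [hu]; simp only [indicator_of_notMem ht, mul_zero]; exact zero_le
      have : I ≤ ∫⁻ _x, ∫⁻ _t, ENNReal.ofReal (((N : ℝ) + 1) ^ (2 * n)) * (N * N) ∂μ ∂μ := by
        refine lintegral_mono_ae ?_
        filter_upwards [hb] with x hx
        exact lintegral_mono hx
      refine (this.trans_lt ?_).ne
      simp only [lintegral_const]
      have := measure_ne_top μ univ
      finiteness
    have hS : ∫⁻ s, (∫⁻ x, Q s x * u N x ∂μ) ^ 2 ∂μ ≤ 2 * (c * K) * I :=
      lintegral_kernel_sq_le hQ (hum N) hμ fun x hx t ht =>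
        lintegral_kerQ_mul_kerQ_le hn hμ1 hμK hx ht
    have hSσ : ∫⁻ s, (∫⁻ x, Q s x * u N x ∂μ) ^ 2 ∂(sigmaS n) ≤ 2 * (c * C₀) * I :=
      lintegral_kernel_sq_le hQ (hum N) hμ fun x hx t ht =>
        lintegral_kerQ_mul_kerQ_le hn hσ1 hcap hx ht
    have hSm : Measurable fun s => ∫⁻ x, Q s x * u N x ∂μ :=
      Measurable.lintegral_prod_right' (f := fun q : En n × En n => Q q.1 q.2 * u N q.2)
        (hQ.mul ((hum N).comp measurable_snd))
    set U := ∫⁻ z, u N z ^ 2 ∂μ with hU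
    have hIle : I ≤ 2 * (c * K) * U := by
      refine le_of_sq_le_mul hIfin ?_
      have e : I = ∫⁻ s, u N s * ∫⁻ x, Q s x * u N x ∂μ ∂μ := by
        refine lintegral_congr fun s => ?_
        rw [← lintegral_const_mul]
        · exact lintegral_congr fun t => by ring
        · exact (hQ.comp measurable_prodMk_left).mul (hum N)
      calc I ^ 2 ≤ U * ∫⁻ s, (∫⁻ x, Q s x * u N x ∂μ) ^ 2 ∂μ := by
            rw [e]; exact lintegral_mul_sq_le μ (hum N).aemeasurable hSm.aemeasurable
        _ ≤ U * (2 * (c * K) * I) := by gcongr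
        _ = _ := by ring
    have hUfin : U ≠ ⊤ := by
      have : U ≤ ∫⁻ _z, (N : ℝ≥0∞) ^ 2 ∂μ := lintegral_mono fun z => by
        have := huN N z
        gcongr
      refine (this.trans_lt ?_).ne
      simp only [lintegral_const]
      have := measure_ne_top μ univ
      finiteness
    refine le_of_sq_le_mul hUfin ?_
    have hUφ : U ≤ ∫⁻ s, φ s * ∫⁻ x, Q s x * u N x ∂μ ∂(sigmaS n) := by
      calc U ≤ ∫⁻ z, T z * u N z ∂μ := lintegral_mono fun z => by
            rw [pow_two]; gcongr; exact huT N z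
        _ = ∫⁻ z, ∫⁻ ζ, Q ζ z * φ ζ * u N z ∂(sigmaS n) ∂μ := by
            refine lintegral_congr fun z => (lintegral_mul_const _ ?_).symm
            exact ((hQ.comp measurable_prodMk_right)).mul hφ
        _ = ∫⁻ ζ, ∫⁻ z, Q ζ z * φ ζ * u N z ∂μ ∂(sigmaS n) := by
            refine lintegral_lintegral_swap (Measurable.aemeasurable ?_)
            exact ((hQ.comp measurable_swap).mul (hφ.comp measurable_snd)).mul
              ((hum N).comp measurable_fst)
        _ = _ := by
            refine lintegral_congr fun ζ => ?_
            rw [← lintegral_const_mul]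
            · exact lintegral_congr fun t => by ring
            · exact (hQ.comp measurable_prodMk_left).mul (hum N)
    calc U ^ 2 ≤ (∫⁻ s, φ s * ∫⁻ x, Q s x * u N x ∂μ ∂(sigmaS n)) ^ 2 := by gcongr
      _ ≤ (∫⁻ ζ, φ ζ ^ 2 ∂(sigmaS n)) * ∫⁻ s, (∫⁻ x, Q s x * u N x ∂μ) ^ 2 ∂(sigmaS n) :=
          lintegral_mul_sq_le _ hφ.aemeasurable hSm.aemeasurable
      _ ≤ (∫⁻ ζ, φ ζ ^ 2 ∂(sigmaS n)) * (2 * (c * C₀) * (2 * (c * K) * U)) := by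
          gcongr
          exact hSσ.trans (by gcongr)
      _ = _ := by ring
  have hlim : ∀ z ∈ Bn n, Tendsto (fun N => u N z ^ 2) atTop (𝓝 (T z ^ 2)) := by
    intro z hz
    rw [Bn, mem_ball_zero_iff] at hz
    have h1 : Tendsto ρ atTop (𝓝 1) := by
      have := (tendsto_const_nhds (x := (1 : ℝ))).sub
        (tendsto_one_div_add_atTop_nhds_zero_nat (𝕜 := ℝ))
      rwa [sub_zero] at this
    have h2 : Tendsto (fun N : ℕ => min (T z) (N : ℝ≥0∞)) atTop (𝓝 (T z)) := by
      simpa using tendsto_const_nhds.min ENNReal.tendsto_nat_nhds_top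
    refine (((ENNReal.continuous_pow 2).tendsto _).comp h2).congr' ?_
    filter_upwards [h1.eventually (lt_mem_nhds hz)] with N hN
    simp only [Function.comp, hu, indicator_of_mem (mem_ball_zero_iff.2 hN)]
  calc ∫⁻ z, T z ^ 2 ∂μ = ∫⁻ z, liminf (fun N => u N z ^ 2) atTop ∂μ := by
        refine lintegral_congr_ae ?_
        filter_upwards [hμ] with z hz
        exact (hlim z hz).liminf_eq.symm
    _ ≤ liminf (fun N => ∫⁻ z, u N z ^ 2 ∂μ) atTop :=
        lintegral_liminf_le fun N => (hum N).pow_const 2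
    _ ≤ _ := by
        refine liminf_le_of_frequently_le' (Frequently.of_forall key)

end Carleson

section Local

variable {n : ℕ}

/-- `μ` is carried by the ball and has Carleson constant at most `K`. -/
structure CarlesonBound (n : ℕ) (μ : Measure (En n)) (K : ℝ≥0∞) : Prop where
  ae_mem : ∀ᵐ s ∂μ, s ∈ Bn n
  box_le : ∀ ζ ∈ Sn n, ∀ δ > (0 : ℝ), μ {s | dI s ζ < δ} ≤ K * ENNReal.ofReal (δ ^ n)

/-- The `p`-th power means of `f` over spheres are at most `M`. -/
def HardyBound (n : ℕ) (p : ℝ) (f : En n → ℂ) (M : ℝ≥0∞) : Prop :=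
  ∀ r ∈ Ioo (0 : ℝ) 1, ∫⁻ ζ, ‖f (r • ζ)‖ₑ ^ p ∂(sigmaS n) ≤ M

lemma CarlesonBound.measure_univ_le (hn : 1 ≤ n) {μ : Measure (En n)} {K : ℝ≥0∞}
    (h : CarlesonBound n μ K) : μ univ ≤ K * ENNReal.ofReal (3 ^ n) := by
  have := nontrivial_En hn
  obtain ⟨e, he⟩ : ∃ e : En n, ‖e‖ = 1 := exists_norm_eq _ zero_le_one
  refine le_trans ?_ (h.box_le e (by simpa [Sn] using he) 3 (by norm_num))
  refine measure_mono_ae ?_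
  filter_upwards [h.ae_mem] with s hs _
  have hs' : ‖s‖ < 1 := mem_ball_zero_iff.1 hs
  exact (dI_le_two hs'.le he.le).trans_lt (by norm_num)

lemma CarlesonBound.mono {μ ν : Measure (En n)} {K L : ℝ≥0∞} (h : CarlesonBound n μ K)
    (hν : ν ≤ μ) (hL : K ≤ L) : CarlesonBound n ν L :=
  ⟨(Measure.absolutelyContinuous_of_le hν).ae_le h.ae_mem, fun ζ hζ δ hδ => (hν _).trans ((h.box_le ζ hζ δ hδ).trans (by gcongr))⟩

lemma ofReal_norm_rpow {p : ℝ} (hp : 0 ≤ p) (w : ℂ) : ENNReal.ofReal (‖w‖ ^ p) = ‖w‖ₑ ^ p := by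
  rw [← ENNReal.ofReal_rpow_of_nonneg (norm_nonneg _) hp, ofReal_norm]

lemma smul_mem_Bn {r : ℝ} (hr : r ∈ Ioo (0 : ℝ) 1) {z : En n} (hz : ‖z‖ ≤ 1) : r • z ∈ Bn n := by
  rw [Bn, mem_ball_zero_iff, norm_smul, Real.norm_of_nonneg hr.1.le]
  nlinarith [hr.1, hr.2, norm_nonneg z]

lemma differentiableOn_dilate {f : En n → ℂ} (hf : DifferentiableOn ℂ f (Bn n)) {r : ℝ}
    (hr : 0 < r) : DifferentiableOn ℂ (fun w => f (r • w)) (ball 0 r⁻¹) := by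
  refine hf.comp (g := f) (f := fun w => r • w)
    ((differentiable_id.const_smul r).differentiableOn) fun w hw => ?_
  rw [mem_ball_zero_iff] at hw
  rw [Bn, mem_ball_zero_iff, norm_smul, Real.norm_of_nonneg hr.le]
  calc r * ‖w‖ < r * r⁻¹ := by gcongr
    _ = 1 := mul_inv_cancel₀ hr.ne'

lemma measurable_radD (g : En n → ℂ) : Measurable (radD g) := by
  have h := measurable_fderiv ℂ g
  have : Continuous fun q : (En n →L[ℂ] ℂ) × En n => q.1 q.2 := by fun_prop
  exact this.measurable.comp (h.prodMk measurable_id)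

lemma setLIntegral_muJ (g : En n → ℂ) (h : En n → ℝ≥0∞) {s : Set (En n)} (hs : MeasurableSet s) :
    ∫⁻ z in s, h z ∂(muJ n g) =
      ∫⁻ z in s, ‖radD g z‖ₑ ^ 2 * ENNReal.ofReal (1 - ‖z‖ ^ 2) * h z ∂(volN n) := by
  refine setLIntegral_withDensity_eq_setLIntegral_mul_non_measurable _ ?_ _ hs ?_
  · exact ((measurable_radD g).nnnorm.coe_nnreal_ennreal.pow_const 2).mul (by fun_prop)
  · exact Eventually.of_forall fun z => by finiteness

instance sFinite_muJ (g : En n → ℂ) : SFinite (muJ n g) := by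
  unfold muJ; infer_instance

lemma ae_muJ (g : En n → ℂ) : ∀ᵐ z ∂(muJ n g), z ∈ Bn n :=
  (withDensity_absolutelyContinuous _ _).ae_le ae_volN

lemma aemeasurable_of_continuousOn {X F : Type*} [TopologicalSpace X] [MeasurableSpace X]
    [BorelSpace X] [TopologicalSpace F] [MeasurableSpace F] [BorelSpace F] [Zero F]
    {s : Set X} (hs : MeasurableSet s) {φ : X → F} (h : ContinuousOn φ s) {μ : Measure X}
    (hμ : ∀ᵐ x ∂μ, x ∈ s) : AEMeasurable φ μ := by
  refine ⟨s.indicator φ, measurable_indicator_of_continuousOn hs h, ?_⟩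
  filter_upwards [hμ] with x hx
  rw [indicator_of_mem hx]

lemma exists_local_bound (hn : 1 ≤ n) : ∃ C : ℝ≥0∞, C ≠ ⊤ ∧ ∀ q : ℝ, 0 < q → ∀ f : En n → ℂ,
    DifferentiableOn ℂ f (Bn n) → ∀ z, ‖z‖ ≤ 7 / 8 →
      ‖f z‖ₑ ^ q ≤ C * ∫⁻ ζ, ‖f ((15 / 16 : ℝ) • ζ)‖ₑ ^ q ∂(sigmaS n) := by
  obtain ⟨C, hC, h⟩ := exists_growth hn
  refine ⟨ENNReal.ofReal (15 ^ n) * C, by finiteness, fun q hq f hf z hz => ?_⟩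
  have hz' : ‖(16 / 15 : ℝ) • z‖ ≤ 14 / 15 := by
    rw [norm_smul, Real.norm_of_nonneg (by norm_num)]; linarith
  have h1 := h q hq _ _ (by norm_num) (differentiableOn_dilate hf (r := 15 / 16) (by norm_num))
    ((16 / 15 : ℝ) • z) (by rw [Bn, mem_ball_zero_iff]; linarith)
  rw [smul_smul] at h1
  norm_num at h1
  have h2 : (1 : ℝ≥0∞) ≤ ENNReal.ofReal (15 ^ n) *
      ENNReal.ofReal ((1 - ‖(16 / 15 : ℝ) • z‖ ^ 2) ^ n) := by
    rw [← ENNReal.ofReal_mul (by positivity), ← mul_pow, ← ENNReal.ofReal_one]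
    refine ENNReal.ofReal_le_ofReal (one_le_pow₀ ?_)
    nlinarith [norm_nonneg ((16 / 15 : ℝ) • z)]
  calc ‖f z‖ₑ ^ q ≤ ENNReal.ofReal (15 ^ n) *
      ENNReal.ofReal ((1 - ‖(16 / 15 : ℝ) • z‖ ^ 2) ^ n) * ‖f z‖ₑ ^ q := le_mul_of_one_le_left' h2
    _ ≤ _ := by rw [mul_assoc, mul_assoc]; gcongr

lemma exists_radD_le (hn : 1 ≤ n) : ∃ C : ℝ≥0∞, C ≠ ⊤ ∧ ∀ g : En n → ℂ,
    DifferentiableOn ℂ g (Bn n) → ∀ z, ‖z‖ ≤ 7 / 8 →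
      ‖radD g z‖ₑ ^ 2 ≤ C * muJ n g (shell n) := by
  obtain ⟨C, hC, h⟩ := exists_local_bound hn
  obtain ⟨c, hc0, hct, hc⟩ := exists_polar hn
  set b := c * (ENNReal.ofReal ((15 / 16) ^ (2 * n - 1)) * ENNReal.ofReal (1 / 32) *
    ENNReal.ofReal (1 / 32)) with hb
  have hb0 : b ≠ 0 := by
    refine mul_ne_zero hc0 (mul_ne_zero (mul_ne_zero ?_ ?_) ?_) <;>
    · rw [Ne, ENNReal.ofReal_eq_zero, not_le]; positivity
  have hbt : b ≠ ⊤ := by rw [hb]; finiteness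
  refine ⟨C * b⁻¹, ENNReal.mul_ne_top hC (ENNReal.inv_ne_top.2 hb0), fun g hg z hz => ?_⟩
  have hR := differentiableOn_radD isOpen_ball hg
  have h1 := h 2 (by norm_num) _ hR z hz
  simp only [ENNReal.rpow_two] at h1
  set A := ∫⁻ ζ, ‖radD g ((15 / 16 : ℝ) • ζ)‖ₑ ^ 2 ∂(sigmaS n) with hA
  suffices hs : b * A ≤ muJ n g (shell n) by
    refine h1.trans ?_
    rw [mul_assoc]
    gcongr
    rw [← ENNReal.div_eq_inv_mul, ENNReal.le_div_iff_mul_le (Or.inl hb0) (Or.inl hbt), mul_comm]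
    exact hs
  have hmS : MeasurableSet (shell n) := isOpen_shell.measurableSet
  have e : muJ n g (shell n) = ∫⁻ z, (shell n).indicator
      (fun z => ‖radD g z‖ₑ ^ 2 * ENNReal.ofReal (1 - ‖z‖ ^ 2)) z ∂(volN n) := by
    rw [lintegral_indicator hmS]
    have := setLIntegral_muJ g (fun _ => 1) hmS
    simpa using this
  rw [e, hc _ (Measurable.indicator (by have := measurable_radD g; fun_prop) hmS), hb, mul_assoc]
  gcongr c * ?_
  calc ENNReal.ofReal ((15 / 16) ^ (2 * n - 1)) * ENNReal.ofReal (1 / 32) *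
        ENNReal.ofReal (1 / 32) * A
      = ∫⁻ _t in Ioo (15 / 16 : ℝ) (31 / 32), ENNReal.ofReal ((15 / 16) ^ (2 * n - 1)) *
          (A * ENNReal.ofReal (1 / 32)) := by
        rw [setLIntegral_const, Real.volume_Ioo]; norm_num; ring
    _ ≤ ∫⁻ t in Ioo (15 / 16 : ℝ) (31 / 32), ENNReal.ofReal (t ^ (2 * n - 1)) *
          ∫⁻ ζ, (shell n).indicator (fun z => ‖radD g z‖ₑ ^ 2 * ENNReal.ofReal (1 - ‖z‖ ^ 2))
            (t • ζ) ∂(sigmaS n) := by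
        refine setLIntegral_mono' measurableSet_Ioo fun t ht => ?_
        have ht0 : 0 < t := lt_trans (by norm_num) ht.1
        have ht1 : t < 1 := ht.2.trans (by norm_num)
        gcongr
        · exact ht.1.le
        have hm := lintegral_sphere_mono hn (p := 2) (by norm_num) (R := 1) hR
          (s := 15 / 16) (r := t) (by norm_num) ht.1.le ht1
        simp only [ENNReal.rpow_two] at hm
        calc A * ENNReal.ofReal (1 / 32)
            ≤ (∫⁻ ζ, ‖radD g (t • ζ)‖ₑ ^ 2 ∂(sigmaS n)) * ENNReal.ofReal (1 / 32) := by gcongr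
          _ = ∫⁻ ζ, ‖radD g (t • ζ)‖ₑ ^ 2 * ENNReal.ofReal (1 / 32) ∂(sigmaS n) := by
              refine (lintegral_mul_const _ ?_).symm
              have := (measurable_radD g).comp (measurable_const_smul t)
              exact this.enorm.pow_const 2
          _ ≤ _ := by
              refine lintegral_mono_ae ?_
              filter_upwards [ae_sigmaS (n := n)] with ζ hζ
              have hζ1 : ‖t • ζ‖ = t := by
                rw [norm_smul, Real.norm_of_nonneg ht0.le, mem_sphere_zero_iff_norm.1 hζ, mul_one]
              rw [indicator_of_mem (show t • ζ ∈ shell n from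
                ⟨by rw [hζ1]; linarith [ht.1], by rw [hζ1]; exact ht1⟩), hζ1]
              gcongr
              nlinarith [ht.2]
    _ ≤ _ := lintegral_mono_set (Ioo_subset_Ioo (by norm_num) (by norm_num))

/-- Bounds for `J g f` and `f` on a compact subset of the ball. -/
lemma exists_J_local_bound (hn : 1 ≤ n) {p : ℝ} (hp : 0 < p) : ∃ C : ℝ≥0∞, C ≠ ⊤ ∧
    ∀ g : En n → ℂ, DifferentiableOn ℂ g (Bn n) → CarlesonBound n (muJ n g) 1 →
      ∀ f : En n → ℂ, DifferentiableOn ℂ f (Bn n) → ∀ M, HardyBound n p f M →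
        ∀ z, ‖z‖ ≤ 3 / 4 → ‖J g f z‖ₑ ^ p ≤ C * M ∧ ‖f z‖ₑ ^ p ≤ C * M := by
  obtain ⟨C₁, hC₁, h₁⟩ := exists_local_bound hn
  obtain ⟨C₂, hC₂, h₂⟩ := exists_radD_le hn
  set D := C₂ * ENNReal.ofReal (3 ^ n) with hD
  have hDt : D ≠ ⊤ := by rw [hD]; finiteness
  set B := Real.sqrt D.toReal with hB
  set E := ENNReal.ofReal (B / (7 / 8)) with hE
  refine ⟨C₁ * E ^ p + C₁, ?_, fun g hg hK f hf M hM z hz => ⟨?_, ?_⟩⟩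
  · have : E ^ p ≠ ⊤ := ENNReal.rpow_ne_top_of_nonneg hp.le ENNReal.ofReal_ne_top
    finiteness
  swap
  · exact ((h₁ p hp f hf z (by linarith)).trans (mul_le_mul_right (hM _ (by norm_num)) _)).trans
      (by gcongr; exact le_add_self)
  have hRg : ∀ w : En n, ‖w‖ ≤ 7 / 8 → ‖radD g w‖ ≤ B := by
    intro w hw
    have h := h₂ g hg w hw
    have h' : ‖radD g w‖ₑ ^ 2 ≤ D := h.trans (by
      rw [hD]; gcongr
      have := hK.measure_univ_le hn
      rw [one_mul] at this
      exact (measure_mono (subset_univ _)).trans this)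
    refine Real.le_sqrt_of_sq_le ?_
    have h3 := ENNReal.toReal_mono hDt h'
    simpa using h3
  have hS : ∀ w : En n, ‖w‖ < 7 / 8 → ‖radD g w‖ ≤ B / (7 / 8) * ‖w‖ := by
    intro w hw
    have h0 : radD g 0 = 0 := by simp [radD]
    have hR := (differentiableOn_radD isOpen_ball hg).mono
      (ball_subset_ball (show (7 / 8 : ℝ) ≤ 1 by norm_num))
    have := Complex.dist_le_div_mul_dist_of_mapsTo_ball hR (R₂ := B) (fun u hu => by
      rw [h0, mem_closedBall_zero_iff]
      exact hRg u (mem_ball_zero_iff.1 hu).le) (mem_ball_zero_iff.2 hw)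
    simpa [h0] using this
  have hJ : ‖J g f z‖ₑ ≤ (C₁ * M) ^ (1 / p) * E := by
    calc ‖J g f z‖ₑ ≤ ∫⁻ t in Ioo (0 : ℝ) 1, ‖f (t • z) * radD g (t • z) / (t : ℂ)‖ₑ :=
          enorm_integral_le_lintegral_enorm _
      _ ≤ ∫⁻ _t in Ioo (0 : ℝ) 1, (C₁ * M) ^ (1 / p) * E := by
          refine setLIntegral_mono' measurableSet_Ioo fun t ht => ?_
          have htz : ‖t • z‖ ≤ 3 / 4 := by
            rw [norm_smul, Real.norm_of_nonneg ht.1.le]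
            nlinarith [ht.1, ht.2, norm_nonneg z]
          rw [mul_div_assoc, enorm_mul]
          gcongr
          · rw [← ENNReal.rpow_le_rpow_iff hp, ← ENNReal.rpow_mul, one_div_mul_cancel hp.ne',
              ENNReal.rpow_one]
            exact (h₁ p hp f hf _ (by linarith)).trans (mul_le_mul_right (hM _ (by norm_num)) _)
          · rw [← ofReal_norm]
            refine ENNReal.ofReal_le_ofReal ?_
            rw [norm_div, Complex.norm_real, Real.norm_of_nonneg ht.1.le, div_le_iff₀ ht.1]
            refine (hS _ (by linarith)).trans ?_
            rw [norm_smul, Real.norm_of_nonneg ht.1.le]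
            have : 0 ≤ B / (7 / 8) := by positivity
            refine mul_le_mul_of_nonneg_left ?_ this
            nlinarith [ht.1, norm_nonneg z]
      _ = _ := by rw [setLIntegral_const, Real.volume_Ioo]; simp
  calc ‖J g f z‖ₑ ^ p ≤ ((C₁ * M) ^ (1 / p) * E) ^ p := by gcongr
    _ = C₁ * E ^ p * M := by
      rw [ENNReal.mul_rpow_of_nonneg _ _ hp.le, ← ENNReal.rpow_mul, one_div_mul_cancel hp.ne',
        ENNReal.rpow_one]; ring
    _ ≤ _ := by gcongr; exact le_self_add

/-- Carleson embedding theorem. -/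
lemma exists_carleson_embedding (hn : 1 ≤ n) : ∃ C : ℝ≥0∞, C ≠ ⊤ ∧ ∀ p : ℝ, 0 < p →
    ∀ μ : Measure (En n), ∀ K : ℝ≥0∞, K ≠ ⊤ → CarlesonBound n μ K →
      ∀ f : En n → ℂ, DifferentiableOn ℂ f (Bn n) → ∀ M, HardyBound n p f M →
        ∫⁻ z, ‖f z‖ₑ ^ p ∂μ ≤ C * K * M := by
  obtain ⟨C₁, hC₁, h₁⟩ := exists_subPoisson hn
  obtain ⟨C₂, hC₂, h₂⟩ := exists_lintegral_poisson_sq_le hn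
  refine ⟨C₁ ^ 2 * C₂, by finiteness, fun p hp μ K hK hμ f hf M hM => ?_⟩
  have hsq : ∀ w : ℂ, ‖w‖ₑ ^ p = (‖w‖ₑ ^ (p / 2)) ^ 2 := fun w => by
    rw [← ENNReal.rpow_two, ← ENNReal.rpow_mul]; congr 1; ring
  have hmB : MeasurableSet (Bn n) := measurableSet_ball
  have hmS : MeasurableSet (Sn n) := isClosed_sphere.measurableSet
  have hcontr : ∀ r ∈ Ioo (0 : ℝ) 1, ContinuousOn (fun z => f (r • z)) (closedBall 0 1) := by
    intro r hr
    refine (differentiableOn_dilate hf hr.1).continuousOn.mono fun z hz => ?_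
    rw [mem_closedBall_zero_iff] at hz
    exact mem_ball_zero_iff.2 (hz.trans_lt (one_lt_inv_iff₀.2 hr))
  have key : ∀ r ∈ Ioo (0 : ℝ) 1, ∫⁻ z, ‖f (r • z)‖ₑ ^ p ∂μ ≤ C₁ ^ 2 * C₂ * K * M := by
    intro r hr
    set φ : En n → ℝ≥0∞ := (Sn n).indicator fun ζ => ‖f (r • ζ)‖ₑ ^ (p / 2) with hφ
    have hφm : Measurable φ := measurable_indicator_of_continuousOn hmS
      (enorm_rpow_continuousOn ((hcontr r hr).mono sphere_subset_closedBall) _)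
    have hφe : ∀ᵐ ζ ∂(sigmaS n), φ ζ = ‖f (r • ζ)‖ₑ ^ (p / 2) := by
      filter_upwards [ae_sigmaS (n := n)] with ζ hζ
      rw [hφ, indicator_of_mem hζ]
    have hTm : Measurable fun z => ∫⁻ ζ, ENNReal.ofReal (kerQ ζ z) * φ ζ ∂(sigmaS n) := by
      have := isProbabilityMeasure_sigmaS hn
      refine Measurable.lintegral_prod_right'
        (f := fun q : En n × En n => ENNReal.ofReal (kerQ q.2 q.1) * φ q.2) ?_
      exact (measurable_kerQ.ennreal_ofReal.comp measurable_swap).mul (hφm.comp measurable_snd)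
    calc ∫⁻ z, ‖f (r • z)‖ₑ ^ p ∂μ
        ≤ ∫⁻ z, C₁ ^ 2 * (∫⁻ ζ, ENNReal.ofReal (kerQ ζ z) * φ ζ ∂(sigmaS n)) ^ 2 ∂μ := by
          refine lintegral_mono_ae ?_
          filter_upwards [hμ.ae_mem] with z hz
          rw [hsq, ← mul_pow]
          gcongr
          refine (h₁ (p / 2) (by positivity) f hf r hr z hz).trans_eq ?_
          congr 1
          refine lintegral_congr_ae ?_
          filter_upwards [hφe] with ζ hζ
          rw [hζ]
      _ = C₁ ^ 2 * ∫⁻ z, (∫⁻ ζ, ENNReal.ofReal (kerQ ζ z) * φ ζ ∂(sigmaS n)) ^ 2 ∂μ :=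
          lintegral_const_mul _ (hTm.pow_const 2)
      _ ≤ C₁ ^ 2 * (C₂ * K * ∫⁻ ζ, φ ζ ^ 2 ∂(sigmaS n)) := by
          gcongr; exact h₂ μ K hK hμ.ae_mem hμ.box_le φ hφm
      _ = C₁ ^ 2 * (C₂ * K * ∫⁻ ζ, ‖f (r • ζ)‖ₑ ^ p ∂(sigmaS n)) := by
          congr 2
          refine lintegral_congr_ae ?_
          filter_upwards [hφe] with ζ hζ
          rw [hζ, ← hsq]
      _ ≤ C₁ ^ 2 * (C₂ * K * M) := by gcongr; exact hM r hr
      _ = _ := by ring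
  obtain ⟨ρ, -, hρm, hρl⟩ := exists_seq_strictMono_tendsto' (zero_lt_one (α := ℝ))
  calc ∫⁻ z, ‖f z‖ₑ ^ p ∂μ = ∫⁻ z, liminf (fun N => ‖f (ρ N • z)‖ₑ ^ p) atTop ∂μ := by
        refine lintegral_congr_ae ?_
        filter_upwards [hμ.ae_mem] with z hz
        have h1 : Tendsto (fun N => ρ N • z) atTop (𝓝 z) := by
          have := hρl.smul_const z
          rwa [one_smul] at this
        have h2 := (enorm_rpow_continuousOn hf.continuousOn p).continuousAt (isOpen_ball.mem_nhds hz)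
        exact (h2.tendsto.comp h1).liminf_eq.symm
    _ ≤ liminf (fun N => ∫⁻ z, ‖f (ρ N • z)‖ₑ ^ p ∂μ) atTop :=
        lintegral_liminf_le' fun N => aemeasurable_of_continuousOn hmB
          (enorm_rpow_continuousOn ((hcontr _ (hρm N)).mono ball_subset_closedBall) p) hμ.ae_mem
    _ ≤ _ := liminf_le_of_frequently_le' (Frequently.of_forall fun N => key _ (hρm N))

end Local

section Sufficiency

variable {n : ℕ}

lemma sq_rpow_half {x : ℝ} (hx : 0 ≤ x) (p : ℝ) : (x ^ 2) ^ (p / 2) = x ^ p := by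
  rw [← Real.rpow_natCast, ← Real.rpow_mul hx]; congr 1; push_cast; ring

lemma ofReal_hsW_rpow_le {p ε : ℝ} (hp : 0 ≤ p) (hε : 0 < ε) (f₁ f₂ : En n → ℂ) (z : En n) :
    ENNReal.ofReal (hsW ε f₁ f₂ z ^ (p / 2)) ≤ ENNReal.ofReal (3 ^ (p / 2)) *
      (ENNReal.ofReal (ε ^ (p / 2)) + ‖f₁ z‖ₑ ^ p + ‖f₂ z‖ₑ ^ p) := by
  have hs : 0 ≤ p / 2 := by positivity
  have key : ∀ a b c : ℝ, 0 ≤ a → 0 ≤ b → 0 ≤ c →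
      (a + b + c) ^ (p / 2) ≤ 3 ^ (p / 2) * (a ^ (p / 2) + b ^ (p / 2) + c ^ (p / 2)) := by
    intro a b c ha hb hc
    set m := max a (max b c) with hm
    have h0 : 0 ≤ m := le_max_of_le_left ha
    have h1 : a ≤ m := le_max_left _ _
    have h2 : b ≤ m := (le_max_left _ _).trans (le_max_right _ _)
    have h3 : c ≤ m := (le_max_right _ _).trans (le_max_right _ _)
    have h4 : m ^ (p / 2) ≤ a ^ (p / 2) + b ^ (p / 2) + c ^ (p / 2) := by
      have ha' := Real.rpow_nonneg ha (p / 2)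
      have hb' := Real.rpow_nonneg hb (p / 2)
      have hc' := Real.rpow_nonneg hc (p / 2)
      rcases max_choice a (max b c) with h | h
      · rw [hm, h]; linarith
      · rcases max_choice b c with h' | h' <;> rw [hm, h, h'] <;> linarith
    calc (a + b + c) ^ (p / 2) ≤ (3 * m) ^ (p / 2) := by gcongr; linarith
      _ = 3 ^ (p / 2) * m ^ (p / 2) := Real.mul_rpow (by norm_num) h0
      _ ≤ _ := by gcongr
  have h := key ε (‖f₁ z‖ ^ 2) (‖f₂ z‖ ^ 2) hε.le (by positivity) (by positivity)
  rw [sq_rpow_half (norm_nonneg _), sq_rpow_half (norm_nonneg _)] at h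
  refine (ENNReal.ofReal_le_ofReal h).trans_eq ?_
  rw [ENNReal.ofReal_mul (by positivity), ENNReal.ofReal_add (by positivity) (by positivity),
    ENNReal.ofReal_add (by positivity) (by positivity), ofReal_norm_rpow hp, ofReal_norm_rpow hp]

lemma enorm_rpow_le_hsW {p ε : ℝ} (hp : 0 ≤ p) (hε : 0 < ε) (f₁ f₂ : En n → ℂ) (z : En n) :
    ‖f₁ z‖ₑ ^ p ≤ ENNReal.ofReal (hsW ε f₁ f₂ z ^ (p / 2)) := by
  rw [← ofReal_norm_rpow hp, ← sq_rpow_half (norm_nonneg _)]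
  refine ENNReal.ofReal_le_ofReal (Real.rpow_le_rpow (by positivity) ?_ (by positivity))
  unfold hsW; nlinarith [sq_nonneg ‖f₂ z‖]

lemma le_of_forall_pos_le_mul_rpow_add {x a b : ℝ≥0∞} {s : ℝ} (hs : 0 < s) (ha : a ≠ ⊤)
    (h : ∀ ε : ℝ, 0 < ε → x ≤ a * ENNReal.ofReal (ε ^ s) + b) : x ≤ b := by
  have h1 : Tendsto (fun ε : ℝ => ENNReal.ofReal (ε ^ s)) (𝓝[>] 0) (𝓝 0) := by
    have h2 : ContinuousAt (fun ε : ℝ => ENNReal.ofReal (ε ^ s)) 0 :=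
      ENNReal.continuous_ofReal.continuousAt.comp
        (Real.continuousAt_rpow_const 0 s (Or.inr hs.le))
    have h3 := h2.tendsto
    rw [Real.zero_rpow hs.ne', ENNReal.ofReal_zero] at h3
    exact h3.mono_left nhdsWithin_le_nhds
  have h2 := (ENNReal.Tendsto.const_mul h1 (Or.inr ha)).add_const b
  rw [mul_zero, zero_add] at h2
  refine ge_of_tendsto h2 ?_
  filter_upwards [self_mem_nhdsWithin] with ε hε using h ε hε

lemma hardyBound_of_gt (hn : 1 ≤ n) {p : ℝ} (hp : 0 < p) {F : En n → ℂ} {M : ℝ≥0∞}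
    (hF : DifferentiableOn ℂ F (Bn n))
    (h : ∀ r ∈ Ioo (3 / 4 : ℝ) 1, ∫⁻ ζ, ‖F (r • ζ)‖ₑ ^ p ∂(sigmaS n) ≤ M) :
    HardyBound n p F M := fun r hr => by
  have h1 : max r (7 / 8) ∈ Ioo (3 / 4 : ℝ) 1 :=
    ⟨lt_max_of_lt_right (by norm_num), max_lt hr.2 (by norm_num)⟩
  exact (lintegral_sphere_mono hn hp hF hr.1.le (le_max_left _ _) h1.2).trans (h _ h1)

lemma lintegral_shell_le (g : En n → ℂ) {X : En n → ℝ≥0∞} {h : En n → ℝ≥0∞}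
    (hX : ∀ z ∈ shell n, X z ≤ ‖radD g z‖ₑ ^ 2 * ENNReal.ofReal (1 - ‖z‖ ^ 2) * h z) :
    ∫⁻ z in shell n, X z ∂(volN n) ≤ ∫⁻ z, h z ∂(muJ n g) :=
  calc ∫⁻ z in shell n, X z ∂(volN n)
      ≤ ∫⁻ z in shell n, ‖radD g z‖ₑ ^ 2 * ENNReal.ofReal (1 - ‖z‖ ^ 2) * h z ∂(volN n) :=
        setLIntegral_mono' isOpen_shell.measurableSet hX
    _ = ∫⁻ z in shell n, h z ∂(muJ n g) := (setLIntegral_muJ g h isOpen_shell.measurableSet).symm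
    _ ≤ _ := setLIntegral_le_lintegral _ _

lemma lintegral_hsW_base_le (hn : 1 ≤ n) {p ε : ℝ} (hp : 0 ≤ p) (hε : 0 < ε) {f₁ f₂ : En n → ℂ}
    {A : ℝ≥0∞} (h₁ : ∀ z, ‖z‖ ≤ 3 / 4 → ‖f₁ z‖ₑ ^ p ≤ A) (h₂ : ∀ z, ‖z‖ ≤ 3 / 4 → ‖f₂ z‖ₑ ^ p ≤ A) :
    ∫⁻ ζ, ENNReal.ofReal (hsW ε f₁ f₂ ((3 / 4 : ℝ) • ζ) ^ (p / 2)) ∂(sigmaS n) ≤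
      ENNReal.ofReal (3 ^ (p / 2)) * (ENNReal.ofReal (ε ^ (p / 2)) + A + A) := by
  have := isProbabilityMeasure_sigmaS hn
  calc _ ≤ ∫⁻ _ζ, ENNReal.ofReal (3 ^ (p / 2)) * (ENNReal.ofReal (ε ^ (p / 2)) + A + A)
          ∂(sigmaS n) := by
        refine lintegral_mono_ae ?_
        filter_upwards [ae_sigmaS (n := n)] with ζ hζ
        have hζ1 : ‖(3 / 4 : ℝ) • ζ‖ ≤ 3 / 4 := by
          rw [norm_smul, Real.norm_of_nonneg (by norm_num), mem_sphere_zero_iff_norm.1 hζ, mul_one]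
        refine (ofReal_hsW_rpow_le hp hε f₁ f₂ _).trans ?_
        gcongr
        exacts [h₁ _ hζ1, h₂ _ hζ1]
    _ = _ := by simp

lemma rpow_mul_sq_le_of_le_two {p W x : ℝ} (hp : p ≤ 2) (hx : 0 ≤ x) (hxW : x ^ 2 ≤ W) :
    W ^ (p / 2 - 1) * x ^ 2 ≤ x ^ p := by
  rcases hx.eq_or_lt with rfl | hx0
  · simpa using Real.rpow_nonneg le_rfl p
  calc W ^ (p / 2 - 1) * x ^ 2 ≤ (x ^ 2) ^ (p / 2 - 1) * x ^ 2 := by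
        gcongr ?_ * _
        exact Real.rpow_le_rpow_of_nonpos (by positivity) hxW (by linarith)
    _ = (x ^ 2) ^ (p / 2) := by rw [Real.rpow_sub_one (by positivity)]; field_simp
    _ = x ^ p := sq_rpow_half hx p

lemma rpow_mul_sq_le_of_two_le {p W x κ : ℝ} (hp : 2 ≤ p) (hx : 0 ≤ x) (hW : 0 < W) (hκ : 0 < κ) :
    W ^ (p / 2 - 1) * x ^ 2 ≤ κ * W ^ (p / 2) + κ⁻¹ ^ (p / 2 - 1) * x ^ p := by
  have h1 : 0 ≤ κ * W ^ (p / 2) := by positivity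
  have h2 : 0 ≤ κ⁻¹ ^ (p / 2 - 1) * x ^ p := by positivity
  rcases le_total (x ^ 2) (κ * W) with h | h
  · calc W ^ (p / 2 - 1) * x ^ 2 ≤ W ^ (p / 2 - 1) * (κ * W) := by gcongr
      _ = κ * W ^ (p / 2) := by rw [Real.rpow_sub_one hW.ne']; field_simp
      _ ≤ _ := by linarith
  · have hx0 : 0 < x := by
      rcases hx.eq_or_lt with rfl | h0
      · nlinarith
      · exact h0
    calc W ^ (p / 2 - 1) * x ^ 2 ≤ (κ⁻¹ * x ^ 2) ^ (p / 2 - 1) * x ^ 2 := by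
          gcongr
          · linarith
          · rw [inv_mul_eq_div, le_div_iff₀ hκ]; linarith
      _ = κ⁻¹ ^ (p / 2 - 1) * (x ^ 2) ^ (p / 2) := by
          rw [Real.mul_rpow (by positivity) (by positivity), Real.rpow_sub_one (x := x ^ 2) (by positivity)]
          field_simp
      _ = κ⁻¹ ^ (p / 2 - 1) * x ^ p := by rw [sq_rpow_half hx]
      _ ≤ _ := by linarith

lemma HardyBound.ofReal_hsW {p ε : ℝ} (hn : 1 ≤ n) (hp : 0 < p) (hε : 0 < ε) {f₁ f₂ : En n → ℂ}
    {M₁ M₂ : ℝ≥0∞} (hf₁ : DifferentiableOn ℂ f₁ (Bn n)) (hf₂ : DifferentiableOn ℂ f₂ (Bn n))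
    (h₁ : HardyBound n p f₁ M₁) (h₂ : HardyBound n p f₂ M₂) : ∀ r ∈ Ioo (0 : ℝ) 1,
      ∫⁻ ζ, ENNReal.ofReal (hsW ε f₁ f₂ (r • ζ) ^ (p / 2)) ∂(sigmaS n) ≤
        ENNReal.ofReal (3 ^ (p / 2)) * (ENNReal.ofReal (ε ^ (p / 2)) + M₁ + M₂) := by
  intro r hr
  have := isProbabilityMeasure_sigmaS hn
  have hm : ∀ f : En n → ℂ, DifferentiableOn ℂ f (Bn n) →
      AEMeasurable (fun ζ => ‖f (r • ζ)‖ₑ ^ p) (sigmaS n) := fun f hf =>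
    aemeasurable_of_continuousOn isClosed_sphere.measurableSet
      (enorm_rpow_continuousOn (hf.continuousOn.comp (by fun_prop) fun ζ hζ =>
        smul_mem_Bn hr (mem_sphere_zero_iff_norm.1 hζ).le) p) ae_sigmaS
  calc _ ≤ ∫⁻ ζ, ENNReal.ofReal (3 ^ (p / 2)) * (ENNReal.ofReal (ε ^ (p / 2)) +
          ‖f₁ (r • ζ)‖ₑ ^ p + ‖f₂ (r • ζ)‖ₑ ^ p) ∂(sigmaS n) :=
        lintegral_mono fun ζ => ofReal_hsW_rpow_le hp.le hε f₁ f₂ _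
    _ = ENNReal.ofReal (3 ^ (p / 2)) * (ENNReal.ofReal (ε ^ (p / 2)) +
          ∫⁻ ζ, ‖f₁ (r • ζ)‖ₑ ^ p ∂(sigmaS n) + ∫⁻ ζ, ‖f₂ (r • ζ)‖ₑ ^ p ∂(sigmaS n)) := by
        rw [lintegral_const_mul' _ _ ENNReal.ofReal_ne_top, lintegral_add_right' _ (hm f₂ hf₂),
          lintegral_add_right' _ (hm f₁ hf₁), lintegral_const, measure_univ, mul_one]
    _ ≤ _ := by gcongr; exacts [h₁ r hr, h₂ r hr]

lemma hardyBound_zero {p : ℝ} (hp : 0 < p) : HardyBound n p (fun _ => 0) 0 := fun r _ => by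
  simp [hp]

lemma aemeasurable_enorm_rpow {f : En n → ℂ} (hf : DifferentiableOn ℂ f (Bn n)) (p : ℝ)
    {μ : Measure (En n)} (hμ : ∀ᵐ z ∂μ, z ∈ Bn n) : AEMeasurable (fun z => ‖f z‖ₑ ^ p) μ :=
  aemeasurable_of_continuousOn (show MeasurableSet (Bn n) from measurableSet_ball)
    (enorm_rpow_continuousOn hf.continuousOn p) hμ

/-- Boundedness of `J g` on `H^p`, `p ≤ 2`. -/
lemma exists_J_bound_of_le_two (hn : 1 ≤ n) {p : ℝ} (hp : 0 < p) (hp2 : p ≤ 2) :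
    ∃ C : ℝ≥0∞, C ≠ ⊤ ∧ ∀ g : En n → ℂ, DifferentiableOn ℂ g (Bn n) → CarlesonBound n (muJ n g) 1 →
      ∀ f : En n → ℂ, DifferentiableOn ℂ f (Bn n) → ∀ M, HardyBound n p f M →
        HardyBound n p (J g f) (C * M) := by
  obtain ⟨C₁, hC₁, h₁⟩ := exists_hardyStein_upper hn hp
  obtain ⟨C₂, hC₂, h₂⟩ := exists_hardyStein_lower hn hp
  obtain ⟨C₃, hC₃, h₃⟩ := exists_J_local_bound hn hp
  obtain ⟨C₄, hC₄, h₄⟩ := exists_carleson_embedding hn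
  set T := ENNReal.ofReal (3 ^ (p / 2)) with hT
  refine ⟨C₁ * (T * (C₃ + C₃)) + C₁ * (C₄ + C₂ * T), by finiteness, fun g hg hK f hf M hM => ?_⟩
  have hF := differentiableOn_J hg hf
  refine hardyBound_of_gt hn hp hF fun r hr => ?_
  refine le_of_forall_pos_le_mul_rpow_add (s := p / 2) (a := C₁ * T + C₁ * (C₂ * T))
    (by positivity) (by finiteness) fun ε hε => ?_
  have hshell : ∫⁻ z in shell n, ENNReal.ofReal
      (hsW ε (J g f) f z ^ (p / 2 - 1) * hsY (J g f) f z * (1 - ‖z‖ ^ 2)) ∂(volN n) ≤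
      C₄ * M + C₂ * (T * (ENNReal.ofReal (ε ^ (p / 2)) + M)) := by
    have hlow := h₂ f (fun _ => 0) hf (differentiableOn_const _) ε hε _
      (HardyBound.ofReal_hsW hn hp hε hf (differentiableOn_const _) hM (hardyBound_zero hp))
    rw [add_zero] at hlow
    have hemb : ∫⁻ z in shell n, ‖radD g z‖ₑ ^ 2 * ENNReal.ofReal (1 - ‖z‖ ^ 2) * ‖f z‖ₑ ^ p
        ∂(volN n) ≤ C₄ * M :=
      (lintegral_shell_le g fun z _ => le_rfl).trans
        (by simpa using h₄ p hp _ 1 ENNReal.one_ne_top hK f hf M hM)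
    refine le_trans ?_ (add_le_add hemb hlow)
    rw [← lintegral_add_left']
    · refine setLIntegral_mono' isOpen_shell.measurableSet fun z hz => ?_
      have hρ : 0 ≤ 1 - ‖z‖ ^ 2 := by nlinarith [norm_nonneg z, hz.2]
      have hW := hsW_pos hε (J g f) f z
      have hW' := hsW_pos hε f (fun _ => 0) z
      have e1 : ‖radD g z‖ₑ ^ 2 * ENNReal.ofReal (1 - ‖z‖ ^ 2) * ‖f z‖ₑ ^ p =
          ENNReal.ofReal (‖radD g z‖ ^ 2 * (1 - ‖z‖ ^ 2) * ‖f z‖ ^ p) := by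
        rw [ENNReal.ofReal_mul (by positivity), ENNReal.ofReal_mul (by positivity),
          ofReal_norm_rpow hp.le, ENNReal.ofReal_pow (norm_nonneg _), ofReal_norm]
      rw [e1, ← ENNReal.ofReal_add (by positivity)
        (mul_nonneg (mul_nonneg (by positivity) (hsY_nonneg _ _ _)) hρ)]
      refine ENNReal.ofReal_le_ofReal ?_
      have hY : hsY (J g f) f z = ‖f z‖ ^ 2 * ‖radD g z‖ ^ 2 + ‖radD f z‖ ^ 2 := by
        rw [hsY, radD_J hg hf (shell_subset_Bn hz), norm_mul, mul_pow]
      have hY' : hsY f (fun _ => 0) z = ‖radD f z‖ ^ 2 := by simp [hsY, radD]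
      have a1 : hsW ε (J g f) f z ^ (p / 2 - 1) * ‖f z‖ ^ 2 ≤ ‖f z‖ ^ p :=
        rpow_mul_sq_le_of_le_two hp2 (norm_nonneg _) (by
          unfold hsW; nlinarith [sq_nonneg ‖J g f z‖])
      have a2 : hsW ε (J g f) f z ^ (p / 2 - 1) ≤ hsW ε f (fun _ => 0) z ^ (p / 2 - 1) :=
        Real.rpow_le_rpow_of_nonpos hW' (by
          unfold hsW; simp) (by linarith)
      rw [hY, hY']
      have b1 := mul_le_mul_of_nonneg_right a1
        (show 0 ≤ ‖radD g z‖ ^ 2 * (1 - ‖z‖ ^ 2) by positivity)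
      have b2 := mul_le_mul_of_nonneg_right a2
        (show 0 ≤ ‖radD f z‖ ^ 2 * (1 - ‖z‖ ^ 2) by positivity)
      linarith
    · refine (AEMeasurable.mul ?_ (aemeasurable_enorm_rpow hf p ae_volN)).restrict
      have := measurable_radD g
      fun_prop
  have hbase := lintegral_hsW_base_le hn hp.le hε (fun z hz => (h₃ g hg hK f hf M hM z hz).1)
    (fun z hz => (h₃ g hg hK f hf M hM z hz).2)
  calc ∫⁻ ζ, ‖J g f (r • ζ)‖ₑ ^ p ∂(sigmaS n)
      ≤ ∫⁻ ζ, ENNReal.ofReal (hsW ε (J g f) f (r • ζ) ^ (p / 2)) ∂(sigmaS n) :=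
        lintegral_mono fun ζ => enorm_rpow_le_hsW hp.le hε _ _ _
    _ ≤ _ := h₁ _ _ hF hf ε hε r hr
    _ ≤ C₁ * (T * (ENNReal.ofReal (ε ^ (p / 2)) + C₃ * M + C₃ * M)) +
        C₁ * (C₄ * M + C₂ * (T * (ENNReal.ofReal (ε ^ (p / 2)) + M))) := by gcongr
    _ = _ := by ring

/-- For `2 ≤ q`, the `H^q` means of `J g f` are controlled by integrals against `muJ n g`. -/
lemma exists_J_hardyStein (hn : 1 ≤ n) {q : ℝ} (hq : 2 ≤ q) : ∃ C : ℝ≥0∞, C ≠ ⊤ ∧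
    ∀ g : En n → ℂ, DifferentiableOn ℂ g (Bn n) → CarlesonBound n (muJ n g) 1 →
      ∀ f : En n → ℂ, DifferentiableOn ℂ f (Bn n) → ∀ M, HardyBound n q f M →
        ∀ ε : ℝ, 0 < ε → HardyBound n q (J g f) (C * (ENNReal.ofReal (ε ^ (q / 2)) + M) +
          C * ∫⁻ z, ENNReal.ofReal
            (hsW ε (J g f) (fun _ => 0) z ^ (q / 2 - 1) * ‖f z‖ ^ 2) ∂(muJ n g)) := by
  have hq0 : 0 < q := by linarith
  obtain ⟨C₁, hC₁, h₁⟩ := exists_hardyStein_upper hn hq0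
  obtain ⟨C₃, hC₃, h₃⟩ := exists_J_local_bound hn hq0
  set T := ENNReal.ofReal (3 ^ (q / 2)) with hT
  refine ⟨C₁ * T * (1 + C₃ + C₃) + C₁, by finiteness, fun g hg hK f hf M hM ε hε => ?_⟩
  have hF := differentiableOn_J hg hf
  refine hardyBound_of_gt hn hq0 hF fun r hr => ?_
  set I := ∫⁻ z, ENNReal.ofReal
    (hsW ε (J g f) (fun _ => 0) z ^ (q / 2 - 1) * ‖f z‖ ^ 2) ∂(muJ n g) with hI
  have hshell : ∫⁻ z in shell n, ENNReal.ofReal (hsW ε (J g f) (fun _ => 0) z ^ (q / 2 - 1) *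
      hsY (J g f) (fun _ => 0) z * (1 - ‖z‖ ^ 2)) ∂(volN n) ≤ I := by
    refine lintegral_shell_le g fun z hz => le_of_eq ?_
    have hρ : 0 ≤ 1 - ‖z‖ ^ 2 := by nlinarith [norm_nonneg z, hz.2]
    have hW := hsW_pos hε (J g f) (fun _ => 0) z
    have hY : hsY (J g f) (fun _ => 0) z = ‖f z‖ ^ 2 * ‖radD g z‖ ^ 2 := by
      rw [hsY, radD_J hg hf (shell_subset_Bn hz), norm_mul, mul_pow]; simp [radD]
    rw [hY, ← ofReal_norm, ← ENNReal.ofReal_pow (norm_nonneg _),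
      ← ENNReal.ofReal_mul (by positivity), ← ENNReal.ofReal_mul (by positivity)]
    congr 1; ring
  have hbase := lintegral_hsW_base_le (f₂ := fun _ : En n => (0 : ℂ)) hn hq0.le hε
    (fun z hz => (h₃ g hg hK f hf M hM z hz).1)
    (fun z _ => by simp [hq0])
  calc ∫⁻ ζ, ‖J g f (r • ζ)‖ₑ ^ q ∂(sigmaS n)
      ≤ ∫⁻ ζ, ENNReal.ofReal (hsW ε (J g f) (fun _ => 0) (r • ζ) ^ (q / 2)) ∂(sigmaS n) :=
        lintegral_mono fun ζ => enorm_rpow_le_hsW hq0.le hε _ _ _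
    _ ≤ _ := h₁ _ _ hF (differentiableOn_const _) ε hε r hr
    _ ≤ C₁ * (T * (ENNReal.ofReal (ε ^ (q / 2)) + C₃ * M + C₃ * M)) + C₁ * I := by gcongr
    _ = C₁ * T * ENNReal.ofReal (ε ^ (q / 2)) + C₁ * T * (C₃ + C₃) * M + C₁ * I := by ring
    _ ≤ (C₁ * T * (1 + C₃ + C₃) + C₁) * ENNReal.ofReal (ε ^ (q / 2)) +
        (C₁ * T * (1 + C₃ + C₃) + C₁) * M + (C₁ * T * (1 + C₃ + C₃) + C₁) * I := by
        gcongr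
        · refine le_trans ?_ le_self_add
          refine le_mul_of_one_le_right' ?_
          rw [add_assoc]; exact le_self_add
        · refine le_trans ?_ le_self_add
          gcongr
          exact le_add_self
        · exact le_add_self
    _ = _ := by ring

/-- `J g f` lies in every Hardy space when `f` is bounded. -/
lemma exists_hardyBound_J_of_bounded (hn : 1 ≤ n) {g f : En n → ℂ}
    (hg : DifferentiableOn ℂ g (Bn n)) (hK : CarlesonBound n (muJ n g) 1)
    (hf : DifferentiableOn ℂ f (Bn n)) {b : ℝ} (hb : ∀ z ∈ Bn n, ‖f z‖ ≤ b) (m : ℕ) :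
    ∀ q : ℝ, 0 < q → q < m + 2 → ∃ M : ℝ≥0∞, M ≠ ⊤ ∧ HardyBound n q (J g f) M := by
  have := isProbabilityMeasure_sigmaS hn
  have hfb : ∀ q : ℝ, 0 < q → HardyBound n q f (ENNReal.ofReal b ^ q) := by
    intro q hq r hr
    calc _ ≤ ∫⁻ _ζ, ENNReal.ofReal b ^ q ∂(sigmaS n) := by
          refine lintegral_mono_ae ?_
          filter_upwards [ae_sigmaS (n := n)] with ζ hζ
          gcongr
          rw [← ofReal_norm]
          exact ENNReal.ofReal_le_ofReal
            (hb _ (smul_mem_Bn hr (mem_sphere_zero_iff_norm.1 hζ).le))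
      _ = _ := by simp
  have hbt : ∀ q : ℝ, 0 < q → ENNReal.ofReal b ^ q ≠ ⊤ := fun q hq =>
    ENNReal.rpow_ne_top_of_nonneg hq.le ENNReal.ofReal_ne_top
  have hle : ∀ q : ℝ, 0 < q → q ≤ 2 → ∃ M : ℝ≥0∞, M ≠ ⊤ ∧ HardyBound n q (J g f) M := by
    intro q hq hq2
    obtain ⟨C, hC, h⟩ := exists_J_bound_of_le_two hn hq hq2
    exact ⟨_, ENNReal.mul_ne_top hC (hbt q hq), h g hg hK f hf _ (hfb q hq)⟩
  induction m with
  | zero => exact fun q hq hq2 => hle q hq (by simpa using hq2.le)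
  | succ m ih =>
    intro q hq hqm
    push_cast at hqm
    rcases le_total q 2 with hq2 | hq2
    · exact hle q hq hq2
    obtain ⟨M, hM, hJM⟩ := ih (q - 1) (by linarith) (by linarith)
    obtain ⟨C, hC, h⟩ := exists_J_hardyStein hn hq2
    obtain ⟨C₄, hC₄, h₄⟩ := exists_carleson_embedding hn
    have hF := differentiableOn_J hg hf
    refine ⟨_, ?_, h g hg hK f hf _ (hfb q hq) 1 one_pos⟩
    have hq1 : 0 < q - 1 := by linarith
    have hI : ∫⁻ z, ENNReal.ofReal
        (hsW 1 (J g f) (fun _ => 0) z ^ (q / 2 - 1) * ‖f z‖ ^ 2) ∂(muJ n g) ≠ ⊤ := by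
      refine ne_top_of_le_ne_top (b := ENNReal.ofReal (b ^ 2) * (ENNReal.ofReal (3 ^ ((q - 1) / 2)) *
        (1 * ENNReal.ofReal (3 ^ n) + C₄ * 1 * M))) (by finiteness) ?_
      calc _ ≤ ∫⁻ z, ENNReal.ofReal (b ^ 2) * (ENNReal.ofReal (3 ^ ((q - 1) / 2)) *
            (1 + ‖J g f z‖ₑ ^ (q - 1))) ∂(muJ n g) := by
            refine lintegral_mono_ae ?_
            filter_upwards [ae_muJ g] with z hz
            have hW : 1 ≤ hsW 1 (J g f) (fun _ => 0) z := by
              unfold hsW; nlinarith [sq_nonneg ‖J g f z‖, sq_nonneg ‖(0 : ℂ)‖]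
            have h1 := ofReal_hsW_rpow_le hq1.le one_pos (J g f) (fun _ => 0) z
            rw [mul_comm, ENNReal.ofReal_mul (by positivity)]
            gcongr
            · exact hb z hz
            · calc _ ≤ ENNReal.ofReal (hsW 1 (J g f) (fun _ => 0) z ^ ((q - 1) / 2)) := by
                    refine ENNReal.ofReal_le_ofReal
                      (Real.rpow_le_rpow_of_exponent_le hW (by linarith))
                _ ≤ _ := by simpa [hq1] using h1
        _ = ENNReal.ofReal (b ^ 2) * (ENNReal.ofReal (3 ^ ((q - 1) / 2)) *
            (muJ n g univ + ∫⁻ z, ‖J g f z‖ₑ ^ (q - 1) ∂(muJ n g))) := by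
            rw [lintegral_const_mul' _ _ ENNReal.ofReal_ne_top,
              lintegral_const_mul' _ _ ENNReal.ofReal_ne_top,
              lintegral_add_right' _ (aemeasurable_enorm_rpow hF _ (ae_muJ g)), lintegral_one]
        _ ≤ _ := by
            gcongr
            · exact hK.measure_univ_le hn
            · exact h₄ _ hq1 _ 1 ENNReal.one_ne_top hK _ hF M hJM
    have := hbt q hq
    finiteness

lemma le_of_le_add_half {x a : ℝ≥0∞} (hx : x ≠ ⊤) (h : x ≤ a + x / 2) : x ≤ 2 * a := by
  have h2 : x / 2 ≠ ⊤ := ENNReal.div_ne_top hx (by norm_num)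
  have h3 : x / 2 ≤ a := by
    have h' : x / 2 + x / 2 ≤ a + x / 2 := by rwa [ENNReal.add_halves]
    exact (ENNReal.add_le_add_iff_right h2).1 h'
  calc x = 2 * (x / 2) := by rw [ENNReal.mul_div_cancel (by norm_num) (by norm_num)]
    _ ≤ _ := by gcongr

/-- A priori estimate for bounded functions, `2 ≤ p`. -/
lemma exists_J_bound_bounded (hn : 1 ≤ n) {p : ℝ} (hp : 2 ≤ p) :
    ∃ C : ℝ≥0∞, C ≠ ⊤ ∧ ∀ g : En n → ℂ, DifferentiableOn ℂ g (Bn n) → CarlesonBound n (muJ n g) 1 →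
      ∀ f : En n → ℂ, DifferentiableOn ℂ f (Bn n) → (∃ b : ℝ, ∀ z ∈ Bn n, ‖f z‖ ≤ b) →
        ∀ M, HardyBound n p f M → HardyBound n p (J g f) (C * M) := by
  have hp0 : 0 < p := by linarith
  obtain ⟨C₁, hC₁, h₁⟩ := exists_J_hardyStein hn hp
  obtain ⟨C₄, hC₄, h₄⟩ := exists_carleson_embedding hn
  set T := ENNReal.ofReal (3 ^ (p / 2)) with hT
  obtain ⟨κ, hκ, hκ1⟩ : ∃ κ : ℝ, 0 < κ ∧ C₁ * (ENNReal.ofReal κ * (T * C₄)) ≤ 1 / 2 := by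
    set D := (C₁ * (T * C₄)).toReal with hD
    have hDt : C₁ * (T * C₄) ≠ ⊤ := by finiteness
    refine ⟨(2 * (D + 1))⁻¹, by positivity, ?_⟩
    rw [mul_left_comm, ← ENNReal.ofReal_toReal hDt, ← hD, ← ENNReal.ofReal_mul (by positivity)]
    calc ENNReal.ofReal ((2 * (D + 1))⁻¹ * D) ≤ ENNReal.ofReal (1 / 2) := by
          refine ENNReal.ofReal_le_ofReal ?_
          have : 0 ≤ D := ENNReal.toReal_nonneg
          rw [inv_mul_le_iff₀ (by positivity)]; linarith
      _ = 1 / 2 := by rw [ENNReal.ofReal_div_of_pos (by norm_num)]; simp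
  set κ' := ENNReal.ofReal (κ⁻¹ ^ (p / 2 - 1)) with hκ'
  refine ⟨2 * (C₁ + C₁ * (κ' * C₄)), by finiteness, fun g hg hK f hf ⟨b, hb⟩ M hM => ?_⟩
  obtain ⟨m, hm⟩ := exists_nat_gt p
  obtain ⟨M₀, hM₀, hJM₀⟩ := exists_hardyBound_J_of_bounded hn hg hK hf hb m p hp0 (by linarith)
  have hF := differentiableOn_J hg hf
  set S := ⨆ r ∈ Ioo (0 : ℝ) 1, ∫⁻ ζ, ‖J g f (r • ζ)‖ₑ ^ p ∂(sigmaS n) with hS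
  have hSt : S ≠ ⊤ := ne_top_of_le_ne_top hM₀ (iSup₂_le hJM₀)
  have hJS : HardyBound n p (J g f) S := fun r hr =>
    le_iSup₂ (f := fun r (_ : r ∈ Ioo (0 : ℝ) 1) => ∫⁻ ζ, ‖J g f (r • ζ)‖ₑ ^ p ∂(sigmaS n)) r hr
  suffices h : S ≤ 2 * ((C₁ + C₁ * (κ' * C₄)) * M) from fun r hr =>
    (hJS r hr).trans (h.trans_eq (by ring))
  refine le_of_le_add_half hSt ?_
  refine iSup₂_le fun r hr => ?_
  refine le_of_forall_pos_le_mul_rpow_add (s := p / 2)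
    (a := C₁ + C₁ * (ENNReal.ofReal κ * (T * ENNReal.ofReal (3 ^ n))))
    (by positivity) (by finiteness) fun ε hε => ?_
  have hI : ∫⁻ z, ENNReal.ofReal
      (hsW ε (J g f) (fun _ => 0) z ^ (p / 2 - 1) * ‖f z‖ ^ 2) ∂(muJ n g) ≤
      ENNReal.ofReal κ * (T * (ENNReal.ofReal (ε ^ (p / 2)) * ENNReal.ofReal (3 ^ n) + C₄ * S)) +
        κ' * (C₄ * M) := by
    calc _ ≤ ∫⁻ z, (ENNReal.ofReal κ * (T * (ENNReal.ofReal (ε ^ (p / 2)) + ‖J g f z‖ₑ ^ p)) +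
            κ' * ‖f z‖ₑ ^ p) ∂(muJ n g) := by
          refine lintegral_mono fun z => ?_
          have h1 := ofReal_hsW_rpow_le hp0.le hε (J g f) (fun _ => 0) z
          have hW := hsW_pos hε (J g f) (fun _ => 0) z
          have h2 := rpow_mul_sq_le_of_two_le hp (norm_nonneg (f z)) hW hκ
          refine (ENNReal.ofReal_le_ofReal h2).trans ?_
          rw [ENNReal.ofReal_add (by positivity) (by positivity), ENNReal.ofReal_mul hκ.le,
            ENNReal.ofReal_mul (by positivity), ofReal_norm_rpow hp0.le]
          gcongr
          simpa [hp0] using h1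
      _ = ENNReal.ofReal κ * (T * (ENNReal.ofReal (ε ^ (p / 2)) * muJ n g univ +
            ∫⁻ z, ‖J g f z‖ₑ ^ p ∂(muJ n g))) + κ' * ∫⁻ z, ‖f z‖ₑ ^ p ∂(muJ n g) := by
          rw [lintegral_add_right' _ ((aemeasurable_enorm_rpow hf p (ae_muJ g)).const_mul _),
            lintegral_const_mul' _ _ ENNReal.ofReal_ne_top,
            lintegral_const_mul' _ _ ENNReal.ofReal_ne_top,
            lintegral_const_mul' _ _ ENNReal.ofReal_ne_top,
            lintegral_add_right' _ (aemeasurable_enorm_rpow hF p (ae_muJ g)), lintegral_const]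
      _ ≤ _ := by
          gcongr
          · simpa using hK.measure_univ_le hn
          · simpa using h₄ p hp0 _ 1 ENNReal.one_ne_top hK _ hF S hJS
          · simpa using h₄ p hp0 _ 1 ENNReal.one_ne_top hK f hf M hM
  calc ∫⁻ ζ, ‖J g f (r • ζ)‖ₑ ^ p ∂(sigmaS n)
      ≤ _ := h₁ g hg hK f hf M hM ε hε r hr
    _ ≤ C₁ * (ENNReal.ofReal (ε ^ (p / 2)) + M) + C₁ *
        (ENNReal.ofReal κ * (T * (ENNReal.ofReal (ε ^ (p / 2)) * ENNReal.ofReal (3 ^ n) + C₄ * S)) +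
        κ' * (C₄ * M)) := by gcongr
    _ = (C₁ + C₁ * (ENNReal.ofReal κ * (T * ENNReal.ofReal (3 ^ n)))) * ENNReal.ofReal (ε ^ (p / 2)) +
        ((C₁ + C₁ * (κ' * C₄)) * M + C₁ * (ENNReal.ofReal κ * (T * C₄)) * S) := by ring
    _ ≤ (C₁ + C₁ * (ENNReal.ofReal κ * (T * ENNReal.ofReal (3 ^ n)))) * ENNReal.ofReal (ε ^ (p / 2)) +
        ((C₁ + C₁ * (κ' * C₄)) * M + 1 / 2 * S) := by gcongr
    _ = _ := by rw [one_div, mul_comm (2⁻¹ : ℝ≥0∞) S, ← div_eq_mul_inv]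

lemma tendsto_J_dilate {g f : En n → ℂ} (hg : DifferentiableOn ℂ g (Bn n))
    (hf : DifferentiableOn ℂ f (Bn n)) {ρ : ℕ → ℝ} (hρ : ∀ N, ρ N ∈ Ioo (0 : ℝ) 1)
    (hρ1 : Tendsto ρ atTop (𝓝 1)) {z : En n} (hz : z ∈ Bn n) :
    Tendsto (fun N => J g (fun w => f (ρ N • w)) z) atTop (𝓝 (J g f z)) := by
  have hz1 : ‖z‖ < 1 := mem_ball_zero_iff.1 hz
  have hsub : closedBall (0 : En n) ‖z‖ ⊆ Bn n := closedBall_subset_ball hz1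
  have hg' : ContinuousOn (fun w => fderiv ℂ g w z) (closedBall 0 ‖z‖) :=
    (differentiableOn_fderiv_apply_const isOpen_ball hg z).continuousOn.mono hsub
  have hf' := hf.continuousOn.mono hsub
  obtain ⟨A, hA⟩ := (isCompact_closedBall (0 : En n) ‖z‖).exists_bound_of_continuousOn hg'
  obtain ⟨B, hB⟩ := (isCompact_closedBall (0 : En n) ‖z‖).exists_bound_of_continuousOn hf'
  have ht : ∀ t ∈ Ioc (0 : ℝ) 1, t • z ∈ closedBall (0 : En n) ‖z‖ := fun t ht => by
    rw [mem_closedBall_zero_iff, norm_smul, Real.norm_of_nonneg ht.1.le]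
    exact mul_le_of_le_one_left (norm_nonneg _) ht.2
  have htr : ∀ N, ∀ t ∈ Ioc (0 : ℝ) 1, ρ N • t • z ∈ closedBall (0 : En n) ‖z‖ := fun N t h => by
    have h1 := ht t h
    rw [mem_closedBall_zero_iff] at h1 ⊢
    rw [norm_smul, Real.norm_of_nonneg (hρ N).1.le]
    exact (mul_le_of_le_one_left (norm_nonneg _) (hρ N).2.le).trans h1
  simp only [J_eq_setIntegral_Ioc, radKernel]
  refine tendsto_integral_of_dominated_convergence (fun _ => B * A) (fun N => ?_)
    (integrable_const _) (fun N => ?_) ?_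
  · refine ContinuousOn.aestronglyMeasurable (ContinuousOn.mul ?_ ?_) measurableSet_Ioc
    · exact hf'.comp (by fun_prop) (htr N)
    · exact hg'.comp (f := fun t : ℝ => t • z) (by fun_prop) ht
  · filter_upwards [ae_restrict_mem measurableSet_Ioc] with t h
    rw [norm_mul]
    have := hB _ (htr N t h)
    gcongr
    · exact (norm_nonneg _).trans this
    · exact hA _ (ht t h)
  · filter_upwards [ae_restrict_mem measurableSet_Ioc] with t h
    refine Tendsto.mul_const _ ?_
    have hc := hf.continuousOn.continuousAt (isOpen_ball.mem_nhds (hsub (ht t h)))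
    refine hc.tendsto.comp ?_
    have := hρ1.smul_const (t • z)
    rwa [one_smul] at this

/-- Boundedness of `J g` on `H^p`. -/
lemma exists_J_bound (hn : 1 ≤ n) {p : ℝ} (hp : 0 < p) :
    ∃ C : ℝ≥0∞, C ≠ ⊤ ∧ ∀ g : En n → ℂ, DifferentiableOn ℂ g (Bn n) → CarlesonBound n (muJ n g) 1 →
      ∀ f : En n → ℂ, DifferentiableOn ℂ f (Bn n) → ∀ M, HardyBound n p f M →
        HardyBound n p (J g f) (C * M) := by
  rcases le_total p 2 with hp2 | hp2
  · exact exists_J_bound_of_le_two hn hp hp2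
  obtain ⟨C, hC, h⟩ := exists_J_bound_bounded hn hp2
  refine ⟨C, hC, fun g hg hK f hf M hM r hr => ?_⟩
  obtain ⟨ρ, -, hρ, hρ1⟩ := exists_seq_strictMono_tendsto' (zero_lt_one (α := ℝ))
  have hd : ∀ N, DifferentiableOn ℂ (fun w => f (ρ N • w)) (Bn n) := fun N =>
    (differentiableOn_dilate hf (hρ N).1).mono
      (ball_subset_ball (one_lt_inv_iff₀.2 (hρ N)).le)
  have hb : ∀ N, ∃ b : ℝ, ∀ z ∈ Bn n, ‖f (ρ N • z)‖ ≤ b := by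
    intro N
    obtain ⟨b, hb⟩ := (isCompact_closedBall (0 : En n) 1).exists_bound_of_continuousOn
      ((differentiableOn_dilate hf (hρ N).1).continuousOn.mono
        (closedBall_subset_ball (one_lt_inv_iff₀.2 (hρ N))))
    exact ⟨b, fun z hz => hb z (ball_subset_closedBall hz)⟩
  have hMN : ∀ N, HardyBound n p (fun w => f (ρ N • w)) M := fun N s hs => by
    simp only [smul_smul]
    exact hM _ ⟨mul_pos (hρ N).1 hs.1, mul_lt_one_of_nonneg_of_lt_one_left (hρ N).1.le (hρ N).2 hs.2.le⟩
  have key := fun N => h g hg hK _ (hd N) (hb N) M (hMN N) r hr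
  calc ∫⁻ ζ, ‖J g f (r • ζ)‖ₑ ^ p ∂(sigmaS n)
      = ∫⁻ ζ, liminf (fun N => ‖J g (fun w => f (ρ N • w)) (r • ζ)‖ₑ ^ p) atTop ∂(sigmaS n) := by
        refine lintegral_congr_ae ?_
        filter_upwards [ae_sigmaS (n := n)] with ζ hζ
        have h1 := tendsto_J_dilate hg hf hρ hρ1 (smul_mem_Bn hr (mem_sphere_zero_iff_norm.1 hζ).le)
        exact (((ENNReal.continuous_rpow_const (y := p)).tendsto _).comp h1.enorm).liminf_eq.symm
    _ ≤ liminf (fun N => ∫⁻ ζ, ‖J g (fun w => f (ρ N • w)) (r • ζ)‖ₑ ^ p ∂(sigmaS n)) atTop := by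
        refine lintegral_liminf_le' fun N => aemeasurable_of_continuousOn
          isClosed_sphere.measurableSet (enorm_rpow_continuousOn ?_ p) ae_sigmaS
        exact (differentiableOn_J hg (hd N)).continuousOn.comp (by fun_prop) fun ζ hζ =>
          smul_mem_Bn hr (mem_sphere_zero_iff_norm.1 hζ).le
    _ ≤ _ := liminf_le_of_frequently_le' (Frequently.of_forall key)

end Sufficiency

section Necessity

variable {n : ℕ}

lemma kerQ_smul_le {ζ a : En n} {r : ℝ} (hr : r ∈ Ioo (0 : ℝ) 1) (ha : ‖a‖ < 1) :
    kerQ (r • ζ) a ≤ kerQ ζ (r • a) := by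
  have h1 : dI (r • ζ) a = dI ζ (r • a) := by
    unfold dI; rw [herm_real_smul_left, herm_real_smul_right]
  have h2 : ‖r • a‖ ≤ ‖a‖ := by
    rw [norm_smul, Real.norm_of_nonneg hr.1.le]
    exact mul_le_of_le_one_left (norm_nonneg _) hr.2.le
  have h3 : 0 ≤ 1 - ‖a‖ ^ 2 := by nlinarith [norm_nonneg a]
  unfold kerQ
  rw [h1]
  have := dI_nonneg ζ (r • a)
  gcongr

lemma exists_hardyBound_testFn (hn : 1 ≤ n) {p : ℝ} (hp : 0 < p) : ∃ C : ℝ≥0∞, C ≠ ⊤ ∧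
    ∀ a : En n, ‖a‖ < 1 → HardyBound n p (testFn p a) C := by
  obtain ⟨C, hC, h⟩ := exists_sigmaS_cap_le hn
  refine ⟨ENNReal.ofReal (2 * 8 ^ n) * C, by finiteness, fun a ha r hr => ?_⟩
  have hra : ‖r • a‖ < 1 := mem_ball_zero_iff.1 (smul_mem_Bn hr ha.le)
  calc ∫⁻ ζ, ‖testFn p a (r • ζ)‖ₑ ^ p ∂(sigmaS n)
      ≤ ∫⁻ ζ, ENNReal.ofReal (kerQ ζ (r • a)) ∂(sigmaS n) := lintegral_mono fun ζ => by
        rw [enorm_testFn_rpow hp ha]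
        exact ENNReal.ofReal_le_ofReal (kerQ_smul_le hr ha)
    _ ≤ _ := lintegral_kernel_le hn (by
        filter_upwards [ae_sigmaS (n := n)] with s hs
        exact le_of_eq (by simpa [Sn] using hs)) h hra

/-- Testing against the kernels `kerQ · a` controls the measures of the boxes. -/
lemma CarlesonBound.of_lintegral_kerQ_le {μ : Measure (En n)}
    (hμ : ∀ᵐ s ∂μ, s ∈ Bn n) {S : ℝ≥0∞}
    (hS : ∀ a : En n, ‖a‖ < 1 → ∫⁻ s, ENNReal.ofReal (kerQ s a) ∂μ ≤ S) :
    CarlesonBound n μ (ENNReal.ofReal (8 ^ n) * S) := by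
  refine ⟨hμ, fun ζ hζ δ hδ => ?_⟩
  have hζ1 : ‖ζ‖ = 1 := by simpa [Sn] using hζ
  obtain ⟨a, ha, hk⟩ : ∃ a : En n, ‖a‖ < 1 ∧
      ∀ s ∈ Bn n, dI s ζ < δ → 1 ≤ (8 * δ) ^ n * kerQ s a := by
    rcases le_total δ 1 with h1 | h1
    · refine ⟨(1 - δ / 2) • ζ, ?_, fun s hs hsζ => ?_⟩
      · rw [norm_smul, hζ1, Real.norm_of_nonneg (by linarith)]; linarith
      · have hs1 : ‖s‖ < 1 := mem_ball_zero_iff.1 hs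
        have hna : ‖(1 - δ / 2) • ζ‖ = 1 - δ / 2 := by
          rw [norm_smul, hζ1, Real.norm_of_nonneg (by linarith), mul_one]
        have hpos : 0 < dI s ((1 - δ / 2) • ζ) := dI_pos hs1 (by rw [hna]; linarith)
        have hle : dI s ((1 - δ / 2) • ζ) ≤ 2 * δ := by
          have e : (1 : ℂ) - herm s ((1 - δ / 2) • ζ) =
              (1 - δ / 2 : ℝ) * (1 - herm s ζ) + (δ / 2 : ℝ) := by
            rw [herm_real_smul_right]; push_cast; ring
          unfold dI at hsζ ⊢
          rw [e]
          refine (norm_add_le _ _).trans ?_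
          rw [norm_mul, Complex.norm_real, Complex.norm_real, Real.norm_of_nonneg (by linarith),
            Real.norm_of_nonneg (by linarith)]
          nlinarith [norm_nonneg ((1 : ℂ) - herm s ζ)]
        have hρ : δ / 2 ≤ 1 - ‖(1 - δ / 2) • ζ‖ ^ 2 := by rw [hna]; nlinarith
        unfold kerQ
        rw [pow_mul, ← div_pow, ← mul_pow]
        refine one_le_pow₀ ?_
        rw [← mul_div_assoc, one_le_div (by positivity)]
        calc _ ≤ (2 * δ) ^ 2 := by gcongr
          _ = 8 * δ * (δ / 2) := by ring
          _ ≤ _ := by gcongr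
    · refine ⟨0, by simp, fun s _ _ => ?_⟩
      have : kerQ s 0 = 1 := by simp [kerQ, dI, herm_zero_right]
      rw [this, mul_one]
      exact one_le_pow₀ (by linarith)
  have hm : Measurable fun s => ENNReal.ofReal (kerQ s a) := by
    have := (measurable_kerQ (n := n)).comp (measurable_id.prodMk (measurable_const (a := a)))
    exact this.ennreal_ofReal
  calc μ {s | dI s ζ < δ} ≤ ∫⁻ s, ENNReal.ofReal ((8 * δ) ^ n) * ENNReal.ofReal (kerQ s a) ∂μ := by
        have hb : MeasurableSet {s : En n | dI s ζ < δ} := measurableSet_dI_lt continuous_id ζ δ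
        rw [← lintegral_indicator_one hb]
        refine lintegral_mono_ae ?_
        filter_upwards [hμ] with s hs
        by_cases h : s ∈ {s : En n | dI s ζ < δ}
        · rw [indicator_of_mem h, ← ENNReal.ofReal_mul (by positivity), Pi.one_apply,
            ENNReal.one_le_ofReal]
          exact hk s hs h
        · rw [indicator_of_notMem h]; exact zero_le
    _ = ENNReal.ofReal ((8 * δ) ^ n) * ∫⁻ s, ENNReal.ofReal (kerQ s a) ∂μ :=
        lintegral_const_mul' _ _ ENNReal.ofReal_ne_top
    _ ≤ ENNReal.ofReal ((8 * δ) ^ n) * S := by gcongr; exact hS a ha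
    _ = _ := by rw [mul_pow, ENNReal.ofReal_mul (by positivity)]; ring

lemma exists_rpow_le_add {p κ : ℝ} (hp : 0 < p) (hκ : 0 < κ) : ∃ C : ℝ, 0 ≤ C ∧
    ∀ W x : ℝ, 0 ≤ x → 0 < W → x ^ 2 ≤ W →
      x ^ p ≤ κ ^ (p / 2) * W ^ (p / 2) + C * (W ^ (p / 2 - 1) * x ^ 2) := by
  refine ⟨1 + κ ^ (p / 2 - 1), by positivity, fun W x hx hW hxW => ?_⟩
  have h1 : 0 ≤ (1 + κ ^ (p / 2 - 1)) * (W ^ (p / 2 - 1) * x ^ 2) := by positivity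
  have h2 : 0 ≤ κ ^ (p / 2) * W ^ (p / 2) := by positivity
  rw [← sq_rpow_half hx p]
  rcases le_total (x ^ 2) (κ * W) with h | h
  · refine le_trans ?_ (le_add_of_nonneg_right h1)
    rw [← Real.mul_rpow hκ.le hW.le]
    exact Real.rpow_le_rpow (by positivity) h (by positivity)
  · have hx0 : 0 < x ^ 2 := lt_of_lt_of_le (by positivity) h
    refine le_trans ?_ (le_add_of_nonneg_left h2)
    have h3 : (x ^ 2) ^ (p / 2) = (x ^ 2) ^ (p / 2 - 1) * x ^ 2 := by
      rw [Real.rpow_sub_one hx0.ne', div_mul_cancel₀ _ hx0.ne']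
    rw [h3, ← mul_assoc]
    gcongr ?_ * _
    have h4 : 0 ≤ W ^ (p / 2 - 1) := by positivity
    have h5 : 0 ≤ κ ^ (p / 2 - 1) * W ^ (p / 2 - 1) := by positivity
    rw [add_mul, one_mul]
    rcases le_total 0 (p / 2 - 1) with he | he
    · exact (Real.rpow_le_rpow hx0.le hxW he).trans (le_add_of_nonneg_right h5)
    · refine le_trans ?_ (le_add_of_nonneg_left h4)
      rw [← Real.mul_rpow hκ.le hW.le]
      exact Real.rpow_le_rpow_of_nonpos (by positivity) h he

/-- Testing `J_g` on kernels, in terms of the Hardy–Stein integrand. -/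
lemma exists_lintegral_testFn_le (hn : 1 ≤ n) {p : ℝ} (hp : 0 < p) : ∃ C : ℝ≥0∞, C ≠ ⊤ ∧
    ∀ g : En n → ℂ, DifferentiableOn ℂ g (Bn n) →
      (∀ f, DifferentiableOn ℂ f (Bn n) → ∀ M : ℝ≥0∞, M ≠ ⊤ → HardyBound n p f M →
        HardyBound n p (J g f) M) →
      ∀ a : En n, ‖a‖ < 1 → HardyBound n p (testFn p a) C ∧ HardyBound n p (J g (testFn p a)) C ∧
        ∫⁻ z in shell n, ENNReal.ofReal (hsW 1 (J g (testFn p a)) (testFn p a) z ^ (p / 2 - 1) *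
          ‖testFn p a z‖ ^ 2) ∂(muJ n g) ≤ C := by
  obtain ⟨C₀, hC₀, h₀⟩ := exists_hardyBound_testFn hn hp
  obtain ⟨C₁, hC₁, h₁⟩ := exists_hardyStein_lower hn hp
  set T := ENNReal.ofReal (3 ^ (p / 2)) with hT
  refine ⟨C₀ + C₁ * (T * (1 + C₀ + C₀)), by finiteness, fun g hg hJ a ha => ?_⟩
  set f := testFn p a with hf
  have hfd : DifferentiableOn ℂ f (Bn n) := differentiableOn_testFn a (by linarith)
  have hF := differentiableOn_J hg hfd
  have hfb : HardyBound n p f C₀ := h₀ a ha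
  have hFb : HardyBound n p (J g f) C₀ := hJ f hfd C₀ hC₀ hfb
  refine ⟨fun r hr => (hfb r hr).trans le_self_add, fun r hr => (hFb r hr).trans le_self_add, ?_⟩
  have key := h₁ _ _ hF hfd 1 one_pos _ (HardyBound.ofReal_hsW hn hp one_pos hF hfd hFb hfb)
  rw [Real.one_rpow, ENNReal.ofReal_one] at key
  refine le_trans ?_ (key.trans le_add_self)
  rw [setLIntegral_muJ g _ isOpen_shell.measurableSet]
  refine setLIntegral_mono' isOpen_shell.measurableSet fun z hz => ?_
  have hρ : 0 ≤ 1 - ‖z‖ ^ 2 := by nlinarith [norm_nonneg z, hz.2]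
  have hW := hsW_pos one_pos (J g f) f z
  rw [← ofReal_norm, ← ENNReal.ofReal_pow (norm_nonneg _),
    ← ENNReal.ofReal_mul (by positivity), ← ENNReal.ofReal_mul (by positivity)]
  refine ENNReal.ofReal_le_ofReal ?_
  rw [hsY, radD_J hg hfd (shell_subset_Bn hz), norm_mul, mul_pow]
  have : 0 ≤ hsW 1 (J g f) f z ^ (p / 2 - 1) * ‖radD f z‖ ^ 2 * (1 - ‖z‖ ^ 2) := by positivity
  nlinarith [this]

/-- The part of the shell inside the ball of radius `R`. -/
def shellR (n : ℕ) (R : ℝ) : Set (En n) := {z | 1 / 2 < ‖z‖ ∧ ‖z‖ < R}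

lemma measurableSet_shellR (R : ℝ) : MeasurableSet (shellR n R) :=
  ((isOpen_lt continuous_const continuous_norm).inter
    (isOpen_lt continuous_norm continuous_const)).measurableSet

lemma shellR_subset {R : ℝ} (hR : R ≤ 1) : shellR n R ⊆ shell n := fun _ hz =>
  ⟨hz.1, hz.2.trans_le hR⟩

lemma muJ_shellR_ne_top {g : En n → ℂ} (hg : DifferentiableOn ℂ g (Bn n)) {R : ℝ}
    (hR : R < 1) : muJ n g (shellR n R) ≠ ⊤ := by
  have hsub : closedBall (0 : En n) R ⊆ Bn n := closedBall_subset_ball hR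
  have hc : ContinuousOn (fun z => ‖radD g z‖) (closedBall (0 : En n) R) :=
    ((differentiableOn_radD isOpen_ball hg).continuousOn.mono hsub).norm
  obtain ⟨B, hB⟩ := (isCompact_closedBall (0 : En n) R).bddAbove_image hc
  have h := setLIntegral_muJ g (fun _ => 1) (measurableSet_shellR (n := n) R)
  rw [setLIntegral_one] at h
  rw [h]
  have hle : ∫⁻ z in shellR n R, ‖radD g z‖ₑ ^ 2 * ENNReal.ofReal (1 - ‖z‖ ^ 2) * 1 ∂(volN n) ≤
      ∫⁻ _z in shellR n R, ENNReal.ofReal B ^ 2 ∂(volN n) := by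
    refine setLIntegral_mono' (measurableSet_shellR R) fun z hz => ?_
    have h1 : ENNReal.ofReal (1 - ‖z‖ ^ 2) ≤ 1 := by
      rw [← ENNReal.ofReal_one]
      exact ENNReal.ofReal_le_ofReal (by nlinarith [norm_nonneg z])
    have h2 : ‖radD g z‖ₑ ≤ ENNReal.ofReal B := by
      rw [← ofReal_norm]
      exact ENNReal.ofReal_le_ofReal (hB ⟨z, mem_closedBall_zero_iff.2 hz.2.le, rfl⟩)
    calc _ ≤ ENNReal.ofReal B ^ 2 * 1 * 1 := by gcongr
      _ = _ := by simp
  refine (hle.trans ?_).trans_lt (b := ENNReal.ofReal B ^ 2) (by finiteness) |>.ne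
  rw [setLIntegral_const]
  refine mul_le_of_le_one_right' ((measure_mono (subset_univ _)).trans ?_)
  exact (volN_univ (n := n)).le

lemma exists_lintegral_kerQ_ne_top {g : En n → ℂ}
    (hg : DifferentiableOn ℂ g (Bn n)) {R : ℝ} (hR : R < 1) : ∃ S : ℝ≥0∞, S ≠ ⊤ ∧
    ∀ a : En n, ‖a‖ < 1 → ∫⁻ s in shellR n R, ENNReal.ofReal (kerQ s a) ∂(muJ n g) ≤ S := by
  have := muJ_shellR_ne_top hg hR
  refine ⟨ENNReal.ofReal (1 / (1 - R) ^ (2 * n)) * muJ n g (shellR n R), by finiteness,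
    fun a ha => ?_⟩
  rw [← setLIntegral_const]
  refine setLIntegral_mono' (measurableSet_shellR R) fun s hs => ENNReal.ofReal_le_ofReal ?_
  have h1 : 1 - R ≤ dI s a := by linarith [one_sub_norm_le_dI (x := s) ha.le, hs.2]
  have h2 : 0 < 1 - R := by linarith
  have h3 : (1 - ‖a‖ ^ 2) ^ n ≤ 1 :=
    pow_le_one₀ (by nlinarith [norm_nonneg a]) (by nlinarith [norm_nonneg a])
  unfold kerQ
  gcongr

/-- Uniform estimate over the truncated shells. -/
lemma exists_carlesonBound_shellR (hn : 1 ≤ n) {p : ℝ} (hp : 0 < p) : ∃ C : ℝ≥0∞, C ≠ ⊤ ∧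
    ∀ g : En n → ℂ, DifferentiableOn ℂ g (Bn n) →
      (∀ f, DifferentiableOn ℂ f (Bn n) → ∀ M : ℝ≥0∞, M ≠ ⊤ → HardyBound n p f M →
        HardyBound n p (J g f) M) →
      ∀ R < 1, CarlesonBound n ((muJ n g).restrict (shellR n R)) C := by
  obtain ⟨C₁, hC₁, h₁⟩ := exists_lintegral_testFn_le hn hp
  obtain ⟨C₂, hC₂, h₂⟩ := exists_carleson_embedding hn
  set T := ENNReal.ofReal (3 ^ (p / 2)) with hT
  set E := ENNReal.ofReal (8 ^ n) with hE
  set Q := T * (E * ENNReal.ofReal (3 ^ n) + C₂ * E * C₁ + C₂ * E * C₁) with hQ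
  have hQt : Q ≠ ⊤ := by finiteness
  obtain ⟨κ, hκ, hκQ⟩ : ∃ κ : ℝ, 0 < κ ∧ ENNReal.ofReal (κ ^ (p / 2)) * Q ≤ 1 / 2 := by
    have ht : Tendsto (fun κ : ℝ => ENNReal.ofReal (κ ^ (p / 2)) * Q) (𝓝[>] 0) (𝓝 (0 * Q)) := by
      refine ENNReal.Tendsto.mul_const ?_ (Or.inr hQt)
      have h0 : Tendsto (fun κ : ℝ => κ ^ (p / 2)) (𝓝[>] 0) (𝓝 0) := by
        have := (Real.continuousAt_rpow_const 0 (p / 2) (Or.inr (by positivity))).tendsto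
        rw [Real.zero_rpow (by positivity)] at this
        exact this.mono_left nhdsWithin_le_nhds
      simpa using ENNReal.tendsto_ofReal h0
    rw [zero_mul] at ht
    obtain ⟨κ, h1, h2⟩ := ((ht.eventually_le_const (u := 1 / 2) (by simp)).and
      self_mem_nhdsWithin).exists
    exact ⟨κ, h2, h1⟩
  obtain ⟨A, hA0, hA⟩ := exists_rpow_le_add hp hκ
  refine ⟨E * (2 * (ENNReal.ofReal A * C₁)), by finiteness, fun g hg hJ R hR => ?_⟩
  set μ := (muJ n g).restrict (shellR n R) with hμ
  have hμae : ∀ᵐ s ∂μ, s ∈ Bn n := ae_restrict_of_ae (ae_muJ g)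
  set S := ⨆ a : {a : En n // ‖a‖ < 1}, ∫⁻ s, ENNReal.ofReal (kerQ s a.1) ∂μ with hS
  have hSt : S ≠ ⊤ := by
    obtain ⟨S', h, h'⟩ := exists_lintegral_kerQ_ne_top hg hR
    exact ne_top_of_le_ne_top h (iSup_le fun a => h' a.1 a.2)
  have hSle : ∀ a : En n, ‖a‖ < 1 → ∫⁻ s, ENNReal.ofReal (kerQ s a) ∂μ ≤ S := fun a ha =>
    le_iSup (fun a : {a : En n // ‖a‖ < 1} => ∫⁻ s, ENNReal.ofReal (kerQ s a.1) ∂μ) ⟨a, ha⟩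
  have hcar : CarlesonBound n μ (E * S) := CarlesonBound.of_lintegral_kerQ_le hμae hSle
  suffices hfin : S ≤ 2 * (ENNReal.ofReal A * C₁) from
    hcar.mono le_rfl (mul_le_mul_right hfin _)
  refine le_of_le_add_half hSt (iSup_le fun ⟨a, ha⟩ => ?_)
  obtain ⟨hb₁, hb₂, hint⟩ := h₁ g hg hJ a ha
  set f := testFn p a with hf
  have hfd : DifferentiableOn ℂ f (Bn n) := differentiableOn_testFn a (by linarith)
  have hF := differentiableOn_J hg hfd
  have hEt : E * S ≠ ⊤ := by finiteness
  have e₁ := h₂ p hp μ _ hEt hcar f hfd _ hb₁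
  have e₂ := h₂ p hp μ _ hEt hcar _ hF _ hb₂
  have m₁ := aemeasurable_enorm_rpow hfd p hμae
  have m₂ := aemeasurable_enorm_rpow hF p hμae
  have hWint : ∫⁻ z, ENNReal.ofReal (hsW 1 (J g f) f z ^ (p / 2)) ∂μ ≤ Q * S := by
    calc ∫⁻ z, ENNReal.ofReal (hsW 1 (J g f) f z ^ (p / 2)) ∂μ
        ≤ ∫⁻ z, T * (1 + ‖J g f z‖ₑ ^ p + ‖f z‖ₑ ^ p) ∂μ := lintegral_mono fun z => by
          simpa using ofReal_hsW_rpow_le hp.le one_pos (J g f) f z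
      _ = T * (μ univ + ∫⁻ z, ‖J g f z‖ₑ ^ p ∂μ + ∫⁻ z, ‖f z‖ₑ ^ p ∂μ) := by
          rw [lintegral_const_mul' _ _ ENNReal.ofReal_ne_top, lintegral_add_right' _ m₁,
            lintegral_add_right' _ m₂, lintegral_one]
      _ ≤ T * (E * S * ENNReal.ofReal (3 ^ n) + C₂ * (E * S) * C₁ + C₂ * (E * S) * C₁) := by
          gcongr
          exact hcar.measure_univ_le hn
      _ = Q * S := by rw [hQ]; ring
  calc ∫⁻ s, ENNReal.ofReal (kerQ s a) ∂μ
      ≤ ∫⁻ z, (ENNReal.ofReal (κ ^ (p / 2)) * ENNReal.ofReal (hsW 1 (J g f) f z ^ (p / 2)) +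
          ENNReal.ofReal A * ENNReal.ofReal (hsW 1 (J g f) f z ^ (p / 2 - 1) * ‖f z‖ ^ 2)) ∂μ :=
        lintegral_mono fun z => by
          have hW := hsW_pos one_pos (J g f) f z
          rw [← enorm_testFn_rpow hp ha, ← ofReal_norm_rpow hp.le,
            ← ENNReal.ofReal_mul (by positivity), ← ENNReal.ofReal_mul hA0,
            ← ENNReal.ofReal_add (by positivity) (by positivity)]
          exact ENNReal.ofReal_le_ofReal (hA _ _ (norm_nonneg _) hW (by
            unfold hsW; nlinarith [sq_nonneg ‖J g f z‖]))
    _ = ENNReal.ofReal (κ ^ (p / 2)) * ∫⁻ z, ENNReal.ofReal (hsW 1 (J g f) f z ^ (p / 2)) ∂μ +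
        ENNReal.ofReal A *
          ∫⁻ z, ENNReal.ofReal (hsW 1 (J g f) f z ^ (p / 2 - 1) * ‖f z‖ ^ 2) ∂μ := by
        have hm : AEMeasurable (fun z => ENNReal.ofReal (hsW 1 (J g f) f z ^ (p / 2))) μ := by
          refine AEMeasurable.ennreal_ofReal (aemeasurable_of_continuousOn
            (show MeasurableSet (Bn n) from measurableSet_ball)
            (ContinuousOn.rpow_const ?_ fun z _ => Or.inr (by positivity)) hμae)
          exact (continuousOn_const.add (hF.continuousOn.norm.pow 2)).add
            (hfd.continuousOn.norm.pow 2)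
        rw [lintegral_add_left' (hm.const_mul _), lintegral_const_mul' _ _ ENNReal.ofReal_ne_top,
          lintegral_const_mul' _ _ ENNReal.ofReal_ne_top]
    _ ≤ ENNReal.ofReal (κ ^ (p / 2)) * (Q * S) + ENNReal.ofReal A * C₁ := by
        gcongr
        refine le_trans ?_ hint
        exact lintegral_mono' (Measure.restrict_mono (shellR_subset hR.le) le_rfl) le_rfl
    _ = ENNReal.ofReal (κ ^ (p / 2)) * Q * S + ENNReal.ofReal A * C₁ := by ring
    _ ≤ 1 / 2 * S + ENNReal.ofReal A * C₁ := by gcongr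
    _ = _ := by rw [add_comm, one_div, mul_comm (2⁻¹ : ℝ≥0∞) S, ← div_eq_mul_inv]

lemma CarlesonBound.of_shellR {μ : Measure (En n)} {K : ℝ≥0∞}
    (h : ∀ R < 1, CarlesonBound n (μ.restrict (shellR n R)) K) :
    CarlesonBound n (μ.restrict (shell n)) K := by
  have hu : shell n = ⋃ k : ℕ, shellR n (1 - 1 / (k + 1)) := by
    ext z
    simp only [mem_iUnion]
    constructor
    · intro hz
      obtain ⟨k, hk⟩ := exists_nat_one_div_lt (show 0 < 1 - ‖z‖ by linarith [hz.2])
      exact ⟨k, hz.1, by linarith⟩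
    · rintro ⟨k, hk⟩
      exact shellR_subset (by
        have : (0 : ℝ) ≤ 1 / (k + 1) := by positivity
        linarith) hk
  refine ⟨?_, fun ζ hζ δ hδ => ?_⟩
  · filter_upwards [ae_restrict_mem isOpen_shell.measurableSet] with z hz
    exact shell_subset_Bn hz
  · have hm : MeasurableSet {s : En n | dI s ζ < δ} := measurableSet_dI_lt continuous_id ζ δ
    rw [Measure.restrict_apply hm, hu, inter_iUnion, Monotone.measure_iUnion]
    · refine iSup_le fun k => ?_
      rw [← Measure.restrict_apply hm]
      exact (h _ (by
        have : (0 : ℝ) < 1 / (k + 1) := by positivity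
        linarith)).box_le ζ hζ δ hδ
    · intro i j hij z hz
      refine ⟨hz.1, hz.2.1, hz.2.2.trans_le ?_⟩
      have : (1 : ℝ) / (j + 1) ≤ 1 / (i + 1) := by
        have : (i : ℝ) ≤ j := by exact_mod_cast hij
        gcongr
      linarith

lemma exists_carlesonBound_of_shell (hn : 1 ≤ n) : ∃ C : ℝ≥0∞, C ≠ ⊤ ∧
    ∀ g : En n → ℂ, DifferentiableOn ℂ g (Bn n) → ∀ K : ℝ≥0∞,
      CarlesonBound n ((muJ n g).restrict (shell n)) K → CarlesonBound n (muJ n g) (C * K) := by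
  obtain ⟨C, hC, h⟩ := exists_radD_le hn
  refine ⟨1 + C * ENNReal.ofReal (3 ^ n) * ENNReal.ofReal (2 ^ n), by finiteness,
    fun g hg K hK => ⟨ae_muJ g, fun ζ hζ δ hδ => ?_⟩⟩
  have hζ1 : ‖ζ‖ = 1 := by simpa [Sn] using hζ
  have hm : MeasurableSet {s : En n | dI s ζ < δ} := measurableSet_dI_lt continuous_id ζ δ
  have hsm : MeasurableSet (closedBall (0 : En n) (1 / 2)) := isClosed_closedBall.measurableSet
  have hin : muJ n g ({s | dI s ζ < δ} ∩ closedBall 0 (1 / 2)) ≤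
      C * ENNReal.ofReal (3 ^ n) * ENNReal.ofReal (2 ^ n) * K * ENNReal.ofReal (δ ^ n) := by
    rcases le_total δ (1 / 2) with hδ2 | hδ2
    · have he : {s : En n | dI s ζ < δ} ∩ closedBall 0 (1 / 2) = ∅ := by
        refine eq_empty_of_forall_notMem fun s hs => ?_
        have h1 := one_sub_norm_le_dI (x := s) hζ1.le
        have h2 : dI s ζ < δ := hs.1
        have h3 := mem_closedBall_zero_iff.1 hs.2
        linarith
      rw [he, measure_empty]; exact zero_le
    · have hsh : muJ n g (shell n) ≤ K * ENNReal.ofReal (3 ^ n) := by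
        have := hK.measure_univ_le hn
        rwa [Measure.restrict_apply_univ] at this
      have hcb : muJ n g (closedBall 0 (1 / 2)) ≤ C * muJ n g (shell n) := by
        rw [← setLIntegral_one, setLIntegral_muJ g _ hsm]
        calc _ ≤ ∫⁻ _z in closedBall (0 : En n) (1 / 2), C * muJ n g (shell n) ∂(volN n) := by
              refine setLIntegral_mono' hsm fun z hz => ?_
              have h1 : ENNReal.ofReal (1 - ‖z‖ ^ 2) ≤ 1 := by
                rw [← ENNReal.ofReal_one]
                exact ENNReal.ofReal_le_ofReal (by nlinarith [norm_nonneg z])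
              have h2 := h g hg z ((mem_closedBall_zero_iff.1 hz).trans (by norm_num))
              calc _ ≤ C * muJ n g (shell n) * 1 * 1 := by gcongr
                _ = _ := by simp
          _ ≤ _ := by
              rw [setLIntegral_const]
              exact mul_le_of_le_one_right'
                ((measure_mono (subset_univ _)).trans (volN_univ (n := n)).le)
      have h2δ : 1 ≤ ENNReal.ofReal (2 ^ n) * ENNReal.ofReal (δ ^ n) := by
        rw [← ENNReal.ofReal_mul (by positivity), ← mul_pow, ENNReal.one_le_ofReal]
        exact one_le_pow₀ (by linarith)
      calc muJ n g ({s | dI s ζ < δ} ∩ closedBall 0 (1 / 2))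
          ≤ muJ n g (closedBall 0 (1 / 2)) := measure_mono inter_subset_right
        _ ≤ C * (K * ENNReal.ofReal (3 ^ n)) * 1 := by rw [mul_one]; exact hcb.trans (by gcongr)
        _ ≤ C * (K * ENNReal.ofReal (3 ^ n)) * (ENNReal.ofReal (2 ^ n) * ENNReal.ofReal (δ ^ n)) := by
            gcongr
        _ = _ := by ring
  have hout : muJ n g ({s | dI s ζ < δ} ∩ shell n) ≤ K * ENNReal.ofReal (δ ^ n) := by
    rw [← Measure.restrict_apply hm]
    exact hK.box_le ζ hζ δ hδ
  have hcov : muJ n g {s | dI s ζ < δ} ≤ muJ n g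
      (({s | dI s ζ < δ} ∩ shell n) ∪ ({s | dI s ζ < δ} ∩ closedBall 0 (1 / 2))) := by
    refine measure_mono_ae ?_
    filter_upwards [ae_muJ g] with z hz hzζ
    rcases lt_or_ge (1 / 2) ‖z‖ with h1 | h1
    · exact Or.inl ⟨hzζ, h1, mem_ball_zero_iff.1 hz⟩
    · exact Or.inr ⟨hzζ, mem_closedBall_zero_iff.2 h1⟩
  calc _ ≤ _ := hcov.trans (measure_union_le _ _)
    _ ≤ _ := add_le_add hout hin
    _ = _ := by ring

/-- Necessity, normalized. -/
lemma exists_carlesonBound_of_J (hn : 1 ≤ n) {p : ℝ} (hp : 0 < p) : ∃ C : ℝ≥0∞, C ≠ ⊤ ∧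
    ∀ g : En n → ℂ, DifferentiableOn ℂ g (Bn n) →
      (∀ f, DifferentiableOn ℂ f (Bn n) → ∀ M : ℝ≥0∞, M ≠ ⊤ → HardyBound n p f M →
        HardyBound n p (J g f) M) →
      CarlesonBound n (muJ n g) C := by
  obtain ⟨C₁, hC₁, h₁⟩ := exists_carlesonBound_shellR hn hp
  obtain ⟨C₂, hC₂, h₂⟩ := exists_carlesonBound_of_shell hn
  exact ⟨C₂ * C₁, by finiteness, fun g hg hJ =>
    h₂ g hg C₁ (CarlesonBound.of_shellR (h₁ g hg hJ))⟩

end Necessity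

section Scaling

variable {n : ℕ}

lemma hardyBound_iff {p : ℝ} (hp : 0 < p) {f : En n → ℂ} {M : ℝ≥0∞} :
    HardyBound n p f M ↔ hNorm n p f ≤ M ^ (1 / p) := by
  rw [hNorm, ENNReal.rpow_le_rpow_iff (by positivity), iSup₂_le_iff]
  rfl

lemma hardyBound_hNorm {p : ℝ} (hp : 0 < p) (f : En n → ℂ) :
    HardyBound n p f (hNorm n p f ^ p) := by
  rw [hardyBound_iff hp, ← ENNReal.rpow_mul, mul_one_div_cancel hp.ne', ENNReal.rpow_one]

lemma hNorm_const_mul {p : ℝ} (hp : 0 < p) (c : ℂ) (f : En n → ℂ) :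
    hNorm n p (fun z => c * f z) = ‖c‖ₑ * hNorm n p f := by
  have h : ∀ r : ℝ, ∫⁻ ζ, (‖c * f (r • ζ)‖₊ : ℝ≥0∞) ^ p ∂(sigmaS n) =
      ‖c‖ₑ ^ p * ∫⁻ ζ, (‖f (r • ζ)‖₊ : ℝ≥0∞) ^ p ∂(sigmaS n) := fun r => by
    rw [← lintegral_const_mul' _ _ (ENNReal.rpow_ne_top_of_nonneg hp.le enorm_ne_top)]
    refine lintegral_congr fun ζ => ?_
    rw [nnnorm_mul, ENNReal.coe_mul, ENNReal.mul_rpow_of_nonneg _ _ hp.le]; rfl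
  simp only [hNorm, h, ← ENNReal.mul_iSup]
  rw [ENNReal.mul_rpow_of_nonneg _ _ (by positivity), ← ENNReal.rpow_mul,
    mul_one_div_cancel hp.ne', ENNReal.rpow_one]

lemma radD_const_mul (c : ℂ) (g : En n → ℂ) (z : En n) :
    radD (fun w => c * g w) z = c * radD g z := by
  have := congrArg (fun L => L z) (congrFun (fderiv_const_smul_field (𝕜 := ℂ) c (f := g)) z)
  exact this

lemma J_const_mul (c : ℂ) (g f : En n → ℂ) :
    J (fun w => c * g w) f = fun z => c * J g f z := by
  funext z
  simp only [J, radD_const_mul]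
  rw [← integral_const_mul]
  refine integral_congr_ae (Eventually.of_forall fun t => ?_)
  simp only; ring

lemma muJ_const_mul (c : ℂ) (g : En n → ℂ) :
    muJ n (fun w => c * g w) = ‖c‖ₑ ^ 2 • muJ n g := by
  unfold muJ
  rw [← withDensity_smul' _ _ (by finiteness)]
  congr 1
  funext z
  rw [radD_const_mul, nnnorm_mul, ENNReal.coe_mul, Pi.smul_apply, smul_eq_mul, mul_pow, mul_assoc]
  rfl

lemma carlesonBound_muJ_iff {g : En n → ℂ} {K : ℝ≥0∞} :
    CarlesonBound n (muJ n g) K ↔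
      ∀ ζ ∈ Sn n, ∀ δ > (0 : ℝ), muJ n g (cBox ζ δ) ≤ K * ENNReal.ofReal (δ ^ n) := by
  have h : ∀ ζ δ, muJ n g {s | dI s ζ < δ} = muJ n g (cBox ζ δ) := fun ζ δ => by
    refine measure_congr ?_
    filter_upwards [ae_muJ g] with z hz
    exact propext ⟨fun h => ⟨hz, h⟩, fun h => h.2⟩
  refine ⟨fun hK ζ hζ δ hδ => ?_, fun hK => ⟨ae_muJ g, fun ζ hζ δ hδ => ?_⟩⟩
  · rw [← h]; exact hK.box_le ζ hζ δ hδ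
  · rw [h]; exact hK ζ hζ δ hδ

lemma carlesonConst_le_iff {g : En n → ℂ} {K : ℝ≥0∞} :
    carlesonConst n (muJ n g) ≤ K ↔ CarlesonBound n (muJ n g) K := by
  rw [carlesonBound_muJ_iff]
  simp only [carlesonConst, iSup_le_iff]
  refine forall₂_congr fun ζ _ => forall₂_congr fun δ hδ => ?_
  have : 0 < δ := hδ
  rw [ENNReal.div_le_iff (by simpa using pow_pos this n) ENNReal.ofReal_ne_top]

lemma isCarleson_muJ_iff {g : En n → ℂ} :
    IsCarleson n (muJ n g) ↔ carlesonConst n (muJ n g) < ⊤ := by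
  refine ⟨fun ⟨C, hC, h⟩ => ?_, fun h => ⟨_, h, ?_⟩⟩
  · exact (carlesonConst_le_iff.2 (carlesonBound_muJ_iff.2 h)).trans_lt hC
  · exact carlesonBound_muJ_iff.1 (carlesonConst_le_iff.1 le_rfl)

lemma CarlesonBound.const_mul {g : En n → ℂ} {K : ℝ≥0∞} (h : CarlesonBound n (muJ n g) K) (c : ℂ) :
    CarlesonBound n (muJ n fun w => c * g w) (‖c‖ₑ ^ 2 * K) := by
  refine ⟨ae_muJ _, fun ζ hζ δ hδ => ?_⟩
  rw [muJ_const_mul, Measure.smul_apply, smul_eq_mul, mul_assoc]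
  exact mul_le_mul_right (h.box_le ζ hζ δ hδ) _

lemma enorm_ofReal_inv_mul {t : ℝ} (ht : 0 < t) : ‖((t⁻¹ : ℝ) : ℂ)‖ₑ * ENNReal.ofReal t = 1 := by
  rw [← ofReal_norm, Complex.norm_real, Real.norm_of_nonneg (by positivity),
    ← ENNReal.ofReal_mul (by positivity), inv_mul_cancel₀ ht.ne', ENNReal.ofReal_one]

lemma eq_const_mul_inv_mul {t : ℝ} (ht : 0 < t) (g : En n → ℂ) :
    (fun w => (t : ℂ) * (((t⁻¹ : ℝ) : ℂ) * g w)) = g := by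
  funext w
  rw [← mul_assoc, ← Complex.ofReal_mul, mul_inv_cancel₀ ht.ne', Complex.ofReal_one, one_mul]

lemma enorm_ofReal_complex {t : ℝ} (ht : 0 < t) : ‖(t : ℂ)‖ₑ = ENNReal.ofReal t := by
  rw [← ofReal_norm, Complex.norm_real, Real.norm_of_nonneg ht.le]

lemma exists_carlesonConst_le (hn : 1 ≤ n) {p : ℝ} (hp : 0 < p) : ∃ A : ℝ≥0∞, A ≠ ⊤ ∧
    ∀ g : En n → ℂ, DifferentiableOn ℂ g (Bn n) → ∀ C : ℝ≥0∞, C ≠ ⊤ →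
      (∀ f, MemHp n p f → hNorm n p (J g f) ≤ C * hNorm n p f) →
      carlesonConst n (muJ n g) ≤ C ^ 2 * A := by
  obtain ⟨A, hA, h⟩ := exists_carlesonBound_of_J hn hp
  refine ⟨A, hA, fun g hg C hC hb => ?_⟩
  have key : ∀ t : ℝ, C.toReal < t → carlesonConst n (muJ n g) ≤ ENNReal.ofReal t ^ 2 * A := by
    intro t ht
    have ht0 : 0 < t := ENNReal.toReal_nonneg.trans_lt ht
    have hCt : C ≤ ENNReal.ofReal t := (ENNReal.le_ofReal_iff_toReal_le hC ht0.le).2 ht.le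
    have hK := h (fun w => ((t⁻¹ : ℝ) : ℂ) * g w) (hg.const_mul _) fun f hf M hM hfM => by
      rw [hardyBound_iff hp] at hfM ⊢
      have hmem : MemHp n p f := ⟨hf, hfM.trans_lt (by
        exact (ENNReal.rpow_ne_top_of_nonneg (by positivity) hM).lt_top)⟩
      rw [J_const_mul, hNorm_const_mul hp]
      calc _ ≤ ‖((t⁻¹ : ℝ) : ℂ)‖ₑ * (ENNReal.ofReal t * hNorm n p f) := by
            gcongr; exact (hb f hmem).trans (by gcongr)
        _ = hNorm n p f := by rw [← mul_assoc, enorm_ofReal_inv_mul ht0, one_mul]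
        _ ≤ _ := hfM
    have h2 := hK.const_mul (t : ℂ)
    rw [eq_const_mul_inv_mul ht0, enorm_ofReal_complex ht0] at h2
    exact carlesonConst_le_iff.2 h2
  have ht : Tendsto (fun t : ℝ => ENNReal.ofReal t ^ 2 * A) (𝓝[>] C.toReal) (𝓝 (C ^ 2 * A)) := by
    refine ENNReal.Tendsto.mul_const (ENNReal.Tendsto.pow ?_) (Or.inr hA)
    have := ENNReal.tendsto_ofReal ((tendsto_id (α := ℝ) (x := 𝓝 C.toReal)).mono_left
      (nhdsWithin_le_nhds (s := Ioi C.toReal)))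
    rwa [ENNReal.ofReal_toReal hC] at this
  exact ge_of_tendsto ht (eventually_nhdsWithin_of_forall key)

lemma exists_hNorm_J_le (hn : 1 ≤ n) {p : ℝ} (hp : 0 < p) : ∃ A : ℝ≥0∞, A ≠ ⊤ ∧
    ∀ g : En n → ℂ, DifferentiableOn ℂ g (Bn n) → carlesonConst n (muJ n g) < ⊤ →
      ∀ f, MemHp n p f →
        hNorm n p (J g f) ≤ carlesonConst n (muJ n g) ^ (1 / 2 : ℝ) * (A * hNorm n p f) := by
  obtain ⟨A, hA, h⟩ := exists_J_bound hn hp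
  refine ⟨A ^ (1 / p), ENNReal.rpow_ne_top_of_nonneg (by positivity) hA, fun g hg hK f hf => ?_⟩
  set K := carlesonConst n (muJ n g) with hKd
  set k := K ^ (1 / 2 : ℝ) with hk
  have hkt : k ≠ ⊤ := ENNReal.rpow_ne_top_of_nonneg (by positivity) hK.ne
  have hkK : k ^ 2 = K := by
    rw [hk, ← ENNReal.rpow_natCast, ← ENNReal.rpow_mul]; norm_num
  have key : ∀ t : ℝ, k.toReal < t →
      hNorm n p (J g f) ≤ ENNReal.ofReal t * (A ^ (1 / p) * hNorm n p f) := by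
    intro t ht
    have ht0 : 0 < t := ENNReal.toReal_nonneg.trans_lt ht
    have hkt' : k ≤ ENNReal.ofReal t := (ENNReal.le_ofReal_iff_toReal_le hkt ht0.le).2 ht.le
    have h1 : CarlesonBound n (muJ n fun w => ((t⁻¹ : ℝ) : ℂ) * g w) 1 := by
      refine ((carlesonConst_le_iff.1 hKd.ge).const_mul ((t⁻¹ : ℝ) : ℂ)).mono le_rfl ?_
      rw [← hkK, ← mul_pow]
      refine pow_le_one₀ zero_le ?_
      rw [← enorm_ofReal_inv_mul ht0]
      gcongr
    have h2 := h _ (hg.const_mul _) h1 f hf.1 _ (hardyBound_hNorm hp f)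
    rw [hardyBound_iff hp, ENNReal.mul_rpow_of_nonneg _ _ (by positivity), ← ENNReal.rpow_mul,
      mul_one_div_cancel hp.ne', ENNReal.rpow_one] at h2
    have h3 := J_const_mul (t : ℂ) (fun w => ((t⁻¹ : ℝ) : ℂ) * g w) f
    rw [eq_const_mul_inv_mul ht0] at h3
    rw [h3, hNorm_const_mul hp, enorm_ofReal_complex ht0]
    gcongr
  have ht : Tendsto (fun t : ℝ => ENNReal.ofReal t * (A ^ (1 / p) * hNorm n p f)) (𝓝[>] k.toReal)
      (𝓝 (k * (A ^ (1 / p) * hNorm n p f))) := by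
    refine ENNReal.Tendsto.mul_const ?_ (Or.inr (ENNReal.mul_ne_top
      (ENNReal.rpow_ne_top_of_nonneg (by positivity) hA) hf.2.ne))
    have := ENNReal.tendsto_ofReal ((tendsto_id (α := ℝ) (x := 𝓝 k.toReal)).mono_left
      (nhdsWithin_le_nhds (s := Ioi k.toReal)))
    rwa [ENNReal.ofReal_toReal hkt] at this
  exact ge_of_tendsto ht (eventually_nhdsWithin_of_forall key)

end Scaling

/-- For `0 < p < ∞` and `g` holomorphic on `B_n`, the operator `J_g` is
bounded on `H^p` iff `dμ_g = |Rg|²(1-|z|²)dv` is a Carleson measure; moreover, the square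
of the least admissible constant is comparable to the Carleson constant of `μ_g`, with
comparison constants depending only on `n` and `p`. -/
theorem stmt0 (n : ℕ) (hn : 1 ≤ n) (p : ℝ) (hp : 0 < p) :
    ∃ c₁ c₂ : ℝ≥0∞, 0 < c₁ ∧ c₁ < ⊤ ∧ 0 < c₂ ∧ c₂ < ⊤ ∧
      ∀ g : En n → ℂ, DifferentiableOn ℂ g (Bn n) →
        (((∃ C : ℝ≥0∞, 0 < C ∧ C < ⊤ ∧
              ∀ f, MemHp n p f → hNorm n p (J g f) ≤ C * hNorm n p f) ↔
            IsCarleson n (muJ n g)) ∧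
          (∀ C : ℝ≥0∞, (∀ f, MemHp n p f → hNorm n p (J g f) ≤ C * hNorm n p f) →
            carlesonConst n (muJ n g) ≤ c₁ * C ^ 2) ∧
          (carlesonConst n (muJ n g) < ⊤ →
            ∀ f, MemHp n p f →
              hNorm n p (J g f) ≤
                (c₂ * carlesonConst n (muJ n g)) ^ (1 / 2 : ℝ) * hNorm n p f)) := by
  obtain ⟨A, hA, h₁⟩ := exists_carlesonConst_le hn hp
  obtain ⟨B, hB, h₂⟩ := exists_hNorm_J_le hn hp
  have hne : ∀ g : En n → ℂ, DifferentiableOn ℂ g (Bn n) → ∀ C : ℝ≥0∞,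
      (∀ f, MemHp n p f → hNorm n p (J g f) ≤ C * hNorm n p f) →
        carlesonConst n (muJ n g) ≤ (A + 1) * C ^ 2 := by
    intro g hg C hb
    rcases eq_or_ne C ⊤ with rfl | hC
    · simp [ENNReal.mul_top]
    · calc _ ≤ C ^ 2 * A := h₁ g hg C hC hb
        _ ≤ C ^ 2 * (A + 1) := by gcongr; exact le_self_add
        _ = _ := mul_comm _ _
  have hsu : ∀ g : En n → ℂ, DifferentiableOn ℂ g (Bn n) → carlesonConst n (muJ n g) < ⊤ →
      ∀ f, MemHp n p f → hNorm n p (J g f) ≤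
        ((B ^ 2 + 1) * carlesonConst n (muJ n g)) ^ (1 / 2 : ℝ) * hNorm n p f := by
    intro g hg hK f hf
    have hBB : B ≤ (B ^ 2 + 1) ^ (1 / 2 : ℝ) := by
      calc B = (B ^ 2) ^ (1 / 2 : ℝ) := by
            rw [← ENNReal.rpow_natCast, ← ENNReal.rpow_mul]; norm_num
        _ ≤ _ := by gcongr; exact le_self_add
    calc _ ≤ _ := h₂ g hg hK f hf
      _ ≤ carlesonConst n (muJ n g) ^ (1 / 2 : ℝ) *
          ((B ^ 2 + 1) ^ (1 / 2 : ℝ) * hNorm n p f) := by gcongr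
      _ = _ := by rw [ENNReal.mul_rpow_of_nonneg _ _ (by positivity)]; ring
  refine ⟨A + 1, B ^ 2 + 1, by positivity, by finiteness, by positivity, by finiteness,
    fun g hg => ⟨⟨?_, fun hc => ?_⟩, hne g hg, hsu g hg⟩⟩
  · rintro ⟨C, -, hC, hb⟩
    exact isCarleson_muJ_iff.2 ((hne g hg C hb).trans_lt (by finiteness))
  · have hK := isCarleson_muJ_iff.1 hc
    refine ⟨((B ^ 2 + 1) * carlesonConst n (muJ n g)) ^ (1 / 2 : ℝ) + 1, by positivity, ?_,
      fun f hf => (hsu g hg hK f hf).trans (by gcongr; exact le_self_add)⟩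
    exact ENNReal.add_lt_top.2 ⟨(ENNReal.rpow_ne_top_of_nonneg (by positivity)
      (ENNReal.mul_ne_top (by finiteness) hK.ne)).lt_top, ENNReal.one_lt_top⟩

end
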